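/- Let ε > 0 be a constant and consider the random graph process {G_i} on n vertices. Then asymptotically almost surely, for every integer m ≥ ((1+ε)/6)·n·log n, the 2-core of G_m is (1/2 − ε)-resilient with respect to being Hamiltonian. -/

import Mathlib

open MeasureTheory Filter ENNReal

namespace RGP

noncomputable section

variable {V : Type*}

/-- The degree of a vertex. -/
def deg (G : SimpleGraph V) (v : V) : ℕ := (G.neighborSet v).ncard

/-- `N^ℓ_G(v)`: vertices at distance at most `ℓ` from `v`, excluding `v`. -/
def nbhd (G : SimpleGraph V) (ℓ : ℕ) (v : V) : Set V :=
  {u | u ≠ v ∧ ∃ p : G.Walk v u, p.length ≤ ℓ}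

/-- `TINY_{p,δ}(G)`. -/
def TINY (G : SimpleGraph V) (p δ : ℝ) : Set V :=
  {v | (deg G v : ℝ) < δ * (Nat.card V) * p}

/-- `ATYP_{p,δ}(G)`. -/
def ATYP (G : SimpleGraph V) (p δ : ℝ) : Set V :=
  {v | (deg G v : ℝ) < (1 - δ) * (Nat.card V) * p ∨ (1 + δ) * (Nat.card V) * p < (deg G v : ℝ)}

/-- Edge density `|E| / C(n,2)`. -/
def density (G : SimpleGraph V) : ℝ :=
  (G.edgeSet.ncard : ℝ) / ((Nat.card V).choose 2 : ℕ)

/-- A matching covering all but at most one vertex. -/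
def HasNearPerfectMatching (G : SimpleGraph V) : Prop :=
  ∃ M : G.Subgraph, M.IsMatching ∧ (M.vertsᶜ).ncard ≤ 1

/-- Hamiltonicity (for finite vertex types). -/
def IsHam [Finite V] (G : SimpleGraph V) : Prop :=
  letI := Classical.decEq V; letI := Fintype.ofFinite V; G.IsHamiltonian

/-- `α`-resilience with respect to a property `P`. -/
def Resilient (G : SimpleGraph V) (α : ℝ) (P : SimpleGraph V → Prop) : Prop :=
  ∀ H : SimpleGraph V, H ≤ G → (∀ v, (deg H v : ℝ) ≤ α * (deg G v : ℝ)) → P (G \ H)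

/-- `(α, δt, Kt, δa, Ka)`-resilience with respect to a property `P`. -/
def StrongResilient (G : SimpleGraph V) (α δt : ℝ) (Kt : ℕ) (δa : ℝ) (Ka : ℕ)
    (P : SimpleGraph V → Prop) : Prop :=
  ∀ H : SimpleGraph V, H ≤ G →
    (∀ v ∈ TINY G (density G) δt, (deg H v : ℝ) ≤ (deg G v : ℝ) - Kt) →
    (∀ v, v ∈ ATYP G (density G) δa → v ∉ TINY G (density G) δt →
      (deg H v : ℝ) ≤ (deg G v : ℝ) - Ka) →
    (∀ v, v ∉ TINY G (density G) δt → v ∉ ATYP G (density G) δa →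
      (deg H v : ℝ) ≤ α * (deg G v : ℝ)) →
    P (G \ H)

/-! ### The random graph process -/

/-- Potential edges of the complete graph on `Fin n`. -/
abbrev EdgeType (n : ℕ) := {e : Sym2 (Fin n) // ¬ e.IsDiag}

/-- A sample point of the random graph process: a uniformly random ordering of the edges. -/
abbrev ProcessSpace (n : ℕ) := Fin (Fintype.card (EdgeType n)) ≃ EdgeType n

instance (n : ℕ) : MeasurableSpace (ProcessSpace n) := ⊤

/-- The uniform measure on orderings of the edges of `K_n`. -/
def processMeasure (n : ℕ) : Measure (ProcessSpace n) :=
  (Fintype.card (ProcessSpace n) : ℝ≥0∞)⁻¹ • Measure.sum (fun σ => Measure.dirac σ)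

/-- The graph `G_m` of the process: the first `m` edges in the random ordering. -/
def processGraph {n : ℕ} (σ : ProcessSpace n) (m : ℕ) : SimpleGraph (Fin n) :=
  SimpleGraph.fromEdgeSet {e | ∃ i : Fin (Fintype.card (EdgeType n)), (i : ℕ) < m ∧ (σ i : Sym2 (Fin n)) = e}

/-! ### The binomial random graph G(n,p) -/

abbrev GnpSpace (n : ℕ) := EdgeType n → Bool

/-- The Bernoulli product weight of an outcome. -/
def gnpWeight {n : ℕ} (p : ℝ) (ω : GnpSpace n) : ℝ≥0∞ :=
  ∏ e : EdgeType n, (if ω e then ENNReal.ofReal p else ENNReal.ofReal (1 - p))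

/-- The `G(n,p)` probability measure. -/
def gnp (n : ℕ) (p : ℝ) : Measure (GnpSpace n) :=
  Measure.sum (fun ω => gnpWeight p ω • Measure.dirac ω)

/-- The graph determined by an outcome of `G(n,p)`. -/
def gnpGraph {n : ℕ} (ω : GnpSpace n) : SimpleGraph (Fin n) :=
  SimpleGraph.fromEdgeSet {e | ∃ h : ¬ e.IsDiag, ω ⟨e, h⟩ = true}

/-- Joint distribution of two independent binomial random graphs. -/
def gnp2 (n : ℕ) (p₀ p' : ℝ) : Measure (GnpSpace n × GnpSpace n) :=
  Measure.sum (fun ω : GnpSpace n × GnpSpace n =>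
    (gnpWeight p₀ ω.1 * gnpWeight p' ω.2) • Measure.dirac ω)

/-! ### The 2-core -/

/-- The vertex set of the 2-core: the largest set every vertex of which has
at least two neighbours inside the set. -/
def coreSet (G : SimpleGraph V) : Set V :=
  ⋃₀ {S : Set V | ∀ v ∈ S, 2 ≤ ((G.neighborSet v) ∩ S).ncard}

/-- The 2-core of a graph, as a graph on the corresponding vertex subset. -/
def twoCore (G : SimpleGraph V) : SimpleGraph (coreSet G) := G.induce (coreSet G)

/-- `b` directly follows `a` in the list. -/
def Nxt : List V → V → V → Prop
  | [], _, _ => False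
  | c :: l, a, b => (c = a ∧ l.head? = some b) ∨ Nxt l a b

lemma Nxt.mem_left {l : List V} {a b : V} (h : Nxt l a b) : a ∈ l := by
  induction l with
  | nil => exact h.elim
  | cons c l ih =>
    rcases h with ⟨rfl, _⟩ | h
    · simp
    · exact List.mem_cons_of_mem _ (ih h)

lemma Nxt.mem_tail {l : List V} {a b : V} (h : Nxt l a b) : b ∈ l.tail := by
  induction l with
  | nil => exact h.elim
  | cons c l ih =>
    rcases h with ⟨rfl, h⟩ | h
    · exact List.mem_of_mem_head? h
    · exact List.mem_of_mem_tail (ih h)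

lemma Nxt.mem_right {l : List V} {a b : V} (h : Nxt l a b) : b ∈ l :=
  List.mem_of_mem_tail h.mem_tail

lemma nxt_append {l₁ l₂ : List V} {a b : V} :
    Nxt (l₁ ++ l₂) a b ↔ Nxt l₁ a b ∨ Nxt l₂ a b ∨
      (l₁.getLast? = some a ∧ l₂.head? = some b) := by
  induction l₁ with
  | nil => simp [Nxt]
  | cons c l ih =>
    cases l with
    | nil => simp [Nxt]; tauto
    | cons d l =>
      simp only [List.cons_append, Nxt, List.getLast?_cons_cons] at ih ⊢
      rw [ih]
      simp only [List.head?_cons]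
      tauto

lemma nxt_reverse {l : List V} {a b : V} : Nxt l.reverse a b ↔ Nxt l b a := by
  induction l with
  | nil => simp [Nxt]
  | cons c l ih =>
    simp only [List.reverse_cons, nxt_append, ih, List.getLast?_reverse, Nxt, List.head?_cons,
      List.head?_nil, Option.some.injEq]
    simp
    tauto

lemma nxt_iff_exists {l : List V} {a b : V} : Nxt l a b ↔ ∃ p s, l = p ++ a :: b :: s := by
  constructor
  · intro h
    induction l with
    | nil => exact h.elim
    | cons c l ih =>
      rcases h with ⟨rfl, h⟩ | h
      · cases l with
        | nil => simp at h
        | cons d l =>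
          obtain rfl : d = b := by simpa using h
          exact ⟨[], l, rfl⟩
      · obtain ⟨p, s, rfl⟩ := ih h
        exact ⟨c :: p, s, rfl⟩
  · rintro ⟨p, s, rfl⟩
    rw [nxt_append]
    right; left; left; simp

lemma isChain_iff_nxt {R : V → V → Prop} {l : List V} :
    l.IsChain R ↔ ∀ a b, Nxt l a b → R a b := by
  induction l with
  | nil => simp [Nxt]
  | cons c l ih =>
    rw [List.isChain_cons, ih]
    simp only [Nxt]
    constructor
    · rintro ⟨h1, h2⟩ a b (⟨rfl, h⟩ | h)
      · exact h1 b h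
      · exact h2 a b h
    · intro h
      exact ⟨fun b hb => h c b (Or.inl ⟨rfl, hb⟩), fun a b hb => h a b (Or.inr hb)⟩

lemma Nxt.unique_right {l : List V} (hl : l.Nodup) {a b b' : V} (h : Nxt l a b)
    (h' : Nxt l a b') : b = b' := by
  induction l with
  | nil => exact h.elim
  | cons c l ih =>
    rw [List.nodup_cons] at hl
    rcases h with ⟨rfl, h⟩ | h <;> rcases h' with ⟨e, h'⟩ | h'
    · rw [h] at h'; simpa using h'
    · exact (hl.1 h'.mem_left).elim
    · subst e; exact (hl.1 h.mem_left).elim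
    · exact ih hl.2 h h'

lemma Nxt.unique_left {l : List V} (hl : l.Nodup) {a a' b : V} (h : Nxt l a b)
    (h' : Nxt l a' b) : a = a' :=
  Nxt.unique_right (List.nodup_reverse.2 hl) (nxt_reverse.2 h) (nxt_reverse.2 h')

lemma Nxt.asymm {l : List V} (hl : l.Nodup) {a b : V} (h : Nxt l a b) : ¬ Nxt l b a := by
  induction l with
  | nil => exact h.elim
  | cons c l ih =>
    rw [List.nodup_cons] at hl
    rintro (⟨rfl, h'⟩ | h')
    · rcases h with ⟨rfl, h⟩ | h
      · exact hl.1 (List.mem_of_mem_head? h)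
      · exact hl.1 h.mem_right
    · rcases h with ⟨rfl, h⟩ | h
      · exact hl.1 h'.mem_right
      · exact ih hl.2 h h'

lemma not_nxt_head {l : List V} (hl : l.Nodup) {a x : V} (hx : l.head? = some x) :
    ¬ Nxt l a x := by
  intro h
  cases l with
  | nil => exact h.elim
  | cons c l =>
    obtain rfl : c = x := by simpa using hx
    have := h.mem_tail
    simp at this hl
    exact hl.1 this

lemma exists_nxt_of_ne_last {l : List V} {a y : V} (hy : l.getLast? = some y) (ha : a ∈ l)
    (hay : a ≠ y) : ∃ b, Nxt l a b := by
  obtain ⟨p, s, rfl⟩ := List.append_of_mem ha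
  cases s with
  | nil => simp at hy; exact (hay hy).elim
  | cons b s => exact ⟨b, nxt_iff_exists.2 ⟨p, s, rfl⟩⟩

lemma exists_nxt_of_ne_head {l : List V} {a x : V} (hx : l.head? = some x) (ha : a ∈ l)
    (hax : a ≠ x) : ∃ b, Nxt l b a := by
  obtain ⟨b, hb⟩ := exists_nxt_of_ne_last (l := l.reverse) (by simpa using hx) (by simpa using ha)
    hax
  exact ⟨b, nxt_reverse.1 hb⟩

/-- `l` is a path in `Γ` from `x` to `y` with vertex set `U`. -/
structure SpanPath (Γ : SimpleGraph V) (U : Set V) (x y : V) (l : List V) : Prop where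
  chain : l.IsChain Γ.Adj
  nodup : l.Nodup
  mem : ∀ v, v ∈ l ↔ v ∈ U
  head : l.head? = some x
  last : l.getLast? = some y

lemma SpanPath.reverse {Γ : SimpleGraph V} {U : Set V} {x y : V} {l : List V}
    (h : SpanPath Γ U x y l) : SpanPath Γ U y x l.reverse where
  chain := by
    rw [isChain_iff_nxt]
    intro a b hab
    exact (isChain_iff_nxt.1 h.chain _ _ (nxt_reverse.1 hab)).symm
  nodup := List.nodup_reverse.2 h.nodup
  mem v := by simpa using h.mem v
  head := by simpa using h.last
  last := by simpa using h.head

lemma SpanPath.mono {Γ Γ' : SimpleGraph V} (hΓ : Γ ≤ Γ') {U : Set V} {x y : V} {l : List V}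
    (h : SpanPath Γ U x y l) : SpanPath Γ' U x y l :=
  ⟨h.chain.imp fun _ _ hab => hΓ hab, h.nodup, h.mem, h.head, h.last⟩

/-- Pósa rotation. -/
lemma SpanPath.rotate {Γ : SimpleGraph V} {U : Set V} {x y z t : V} {p s : List V}
    (h : SpanPath Γ U x y (p ++ z :: t :: s)) (hyz : Γ.Adj y z) :
    SpanPath Γ U x t (p ++ z :: (t :: s).reverse) where
  chain := by
    have hy := h.last
    have h := h.chain
    rw [isChain_iff_nxt] at h ⊢
    intro a b hab
    rw [nxt_append] at hab
    rcases hab with hab | hab | hab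
    · exact h _ _ (nxt_append.2 (Or.inl hab))
    · rcases hab with ⟨rfl, hb⟩ | hab
      · have : b = y := by
          rw [List.head?_reverse] at hb
          simp only [List.getLast?_append, List.getLast?_cons_cons] at hy
          rw [hb] at hy
          simpa using hy
        subst this
        exact hyz.symm
      · refine (h _ _ (nxt_append.2 (Or.inr (Or.inl (Or.inr (nxt_reverse.1 hab)))))).symm
    · exact h _ _ (nxt_append.2 (Or.inr (Or.inr (by simpa using hab))))
  nodup := by
    have : (p ++ z :: (t :: s).reverse).Perm (p ++ z :: t :: s) :=
      List.Perm.append_left _ (List.Perm.cons _ (List.reverse_perm _))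
    exact this.nodup_iff.2 h.nodup
  mem v := by
    rw [← h.mem]
    simp [or_comm]
  head := by
    rw [← h.head]; cases p <;> simp
  last := by simp [List.getLast?_append, List.getLast?_cons]

/-- Lists obtained from `l₀` by successive rotations. -/
inductive Rotated (Γ : SimpleGraph V) (U : Set V) (x : V) (l₀ : List V) : List V → Prop
  | base : Rotated Γ U x l₀ l₀
  | step (y z t : V) (p s : List V) : Rotated Γ U x l₀ (p ++ z :: t :: s) →
      SpanPath Γ U x y (p ++ z :: t :: s) → Γ.Adj y z →
      Rotated Γ U x l₀ (p ++ z :: (t :: s).reverse)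

/-- Pósa's lemma. -/
lemma posa {Γ : SimpleGraph V} {U : Set V} {x y₀ : V} {l₀ : List V}
    (h₀ : SpanPath Γ U x y₀ l₀) : ∃ Y : Set V, y₀ ∈ Y ∧
      (∀ y ∈ Y, ∃ l, SpanPath Γ U x y l ∧ ∀ z t, Γ.Adj y z → Nxt l z t → t ∈ Y) ∧
      ∀ y ∈ Y, ∀ w ∈ U, Γ.Adj y w → w ∈ Y ∨ ∃ y' ∈ Y, Nxt l₀ w y' ∨ Nxt l₀ y' w := by
  set Y : Set V := {y | ∃ l, Rotated Γ U x l₀ l ∧ SpanPath Γ U x y l} with hY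
  have hrot : ∀ y l, Rotated Γ U x l₀ l → SpanPath Γ U x y l → ∀ z t, Γ.Adj y z → Nxt l z t →
      t ∈ Y := by
    intro y l hr hs z t hyz hzt
    obtain ⟨p, s, rfl⟩ := nxt_iff_exists.1 hzt
    exact ⟨_, Rotated.step y z t p s hr hs hyz, hs.rotate hyz⟩
  have hinv : ∀ l, Rotated Γ U x l₀ l → ∀ a b, Nxt l₀ a b → a ∉ Y → b ∉ Y →
      Nxt l a b ∨ Nxt l b a := by
    intro l hl
    induction hl with
    | base => intro a b h _ _; exact Or.inl h
    | step y z t p s hr hs hyz ih =>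
      have key : ∀ a b, b ∉ Y → Nxt (p ++ z :: t :: s) a b →
          Nxt (p ++ z :: (t :: s).reverse) a b ∨ Nxt (p ++ z :: (t :: s).reverse) b a := by
        intro a b hb hab
        rw [nxt_append] at hab
        rcases hab with hab | hab | hab
        · exact Or.inl (nxt_append.2 (Or.inl hab))
        · rcases hab with ⟨rfl, hb'⟩ | hab
          · exfalso
            obtain rfl : t = b := by simpa using hb'
            exact hb (hrot y _ hr hs z t hyz (nxt_iff_exists.2 ⟨p, s, rfl⟩))
          · exact Or.inr (nxt_append.2 (Or.inr (Or.inl (Or.inr (nxt_reverse.2 hab)))))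
        · exact Or.inl (nxt_append.2 (Or.inr (Or.inr (by simpa using hab))))
      intro a b hab ha hb
      rcases ih a b hab ha hb with h | h
      · exact key a b hb h
      · exact (key b a ha h).symm
  refine ⟨Y, ⟨l₀, Rotated.base, h₀⟩, ?_, ?_⟩
  · rintro y ⟨l, hl, hs⟩
    exact ⟨l, hs, hrot y l hl hs⟩
  · rintro y ⟨l, hl, hs⟩ w hw hyw
    by_contra! hcon
    obtain ⟨hwY, hcon⟩ := hcon
    have hp : ∀ a, Nxt l₀ a w → a ∉ Y := fun a h ha => (hcon a ha).2 h
    have hsu : ∀ a, Nxt l₀ w a → a ∉ Y := fun a h ha => (hcon a ha).1 h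
    obtain ⟨t, ht⟩ := exists_nxt_of_ne_last hs.last ((hs.mem w).2 hw) hyw.ne'
    have htY : t ∈ Y := hrot y l hl hs w t hyw ht
    obtain ⟨b, hb⟩ := exists_nxt_of_ne_last h₀.last ((h₀.mem w).2 hw)
      (by rintro rfl; exact hwY ⟨l₀, Rotated.base, h₀⟩)
    have hbw : Nxt l b w := by
      rcases hinv l hl w b hb hwY (hsu b hb) with h | h
      · exact (hsu b hb ((ht.unique_right hs.nodup h) ▸ htY)).elim
      · exact h
    have hwx : w ≠ x := by
      rintro rfl
      exact not_nxt_head hs.nodup hs.head hbw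
    obtain ⟨a, ha⟩ := exists_nxt_of_ne_head h₀.head ((h₀.mem w).2 hw) hwx
    have haw : Nxt l a w := by
      rcases hinv l hl a w ha (hp a ha) hwY with h | h
      · exact h
      · exact (hp a ha ((ht.unique_right hs.nodup h) ▸ htY)).elim
    have hab : a = b := haw.unique_left hs.nodup hbw
    subst hab
    exact ha.asymm h₀.nodup hb

section Deterministic

set_option linter.unusedSectionVars false

open scoped Classical
variable [Fintype V] [DecidableEq V]

/-- The neighbours of a vertex as a finset. -/
def nb (G : SimpleGraph V) (v : V) : Finset V := Finset.univ.filter fun u => G.Adj v u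

/-- The number of ordered pairs in `F` that are adjacent in `G`. -/
def pairs (G : SimpleGraph V) (F : Finset (V × V)) : ℕ :=
  (F.filter fun q => G.Adj q.1 q.2).card

/-- The vertices at distance at most `k` from `c`. -/
def ball (G : SimpleGraph V) : ℕ → V → Finset V
  | 0, c => {c}
  | k + 1, c => ball G k c ∪ (ball G k c).biUnion (nb G)

/-- The vertices of `T` are far apart in `G`. -/
structure Sparse (G : SimpleGraph V) (T : Finset V) : Prop where
  ball : ∀ c, (T ∩ ball G 3 c).card ≤ 2
  tri : ∀ a ∈ T, ∀ b ∈ T, ∀ u, G.Adj a b → G.Adj a u → ¬ G.Adj b u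
  quad : ∀ a ∈ T, ∀ b ∈ T, ∀ u v, a ≠ b → u ≠ v → G.Adj a u → G.Adj b u → G.Adj a v →
    ¬ G.Adj b v

@[simp] lemma mem_nb {G : SimpleGraph V} {u v : V} : u ∈ nb G v ↔ G.Adj v u := by
  simp [nb]

lemma nb_mono {G G' : SimpleGraph V} (h : G ≤ G') (v : V) : nb G v ⊆ nb G' v := by
  intro u; simp only [mem_nb]; exact fun hu => h hu

lemma pairs_mono_left {G G' : SimpleGraph V} (h : G ≤ G') (F : Finset (V × V)) :
    pairs G F ≤ pairs G' F := by
  apply Finset.card_le_card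
  intro q; simp only [Finset.mem_filter]; exact fun hq => ⟨hq.1, h hq.2⟩

lemma pairs_mono (G : SimpleGraph V) {F F' : Finset (V × V)}
    (h : ∀ q ∈ F, G.Adj q.1 q.2 → q ∈ F') : pairs G F ≤ pairs G F' := by
  apply Finset.card_le_card
  intro q; simp only [Finset.mem_filter]; exact fun hq => ⟨h q hq.1 hq.2, hq.2⟩

lemma pairs_union_le (G : SimpleGraph V) (F F' : Finset (V × V)) :
    pairs G (F ∪ F') ≤ pairs G F + pairs G F' := by
  unfold pairs
  rw [Finset.filter_union]
  exact Finset.card_union_le _ _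

lemma pairs_prod (G : SimpleGraph V) (A B : Finset V) :
    pairs G (A ×ˢ B) = ∑ a ∈ A, (B.filter fun b => G.Adj a b).card := by
  unfold pairs
  rw [Finset.card_filter, Finset.sum_product]
  simp only [Finset.card_filter]

lemma pairs_univ_right (G : SimpleGraph V) (A : Finset V) :
    pairs G (A ×ˢ Finset.univ) = ∑ a ∈ A, (nb G a).card := by
  rw [pairs_prod]; rfl

lemma self_mem_ball {G : SimpleGraph V} {k : ℕ} {c : V} : c ∈ ball G k c := by
  induction k with
  | zero => simp [ball]
  | succ k ih => exact Finset.mem_union_left _ ih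

lemma mem_ball_succ {G : SimpleGraph V} {k : ℕ} {c u v : V} (hu : u ∈ ball G k c)
    (h : G.Adj u v) : v ∈ ball G (k + 1) c :=
  Finset.mem_union_right _ (Finset.mem_biUnion.2 ⟨u, hu, mem_nb.2 h⟩)

lemma ball_mono_right {G : SimpleGraph V} {k : ℕ} {c u : V} (hu : u ∈ ball G k c) :
    u ∈ ball G (k + 1) c := Finset.mem_union_left _ hu

lemma ball_mono {G G' : SimpleGraph V} (h : G ≤ G') (k : ℕ) (c : V) : ball G k c ⊆ ball G' k c := by
  induction k with
  | zero => simp [ball]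
  | succ k ih =>
    exact Finset.union_subset_union ih (Finset.biUnion_subset_biUnion_of_subset_left _ ih |>.trans
      (Finset.biUnion_mono fun v _ => nb_mono h v))

lemma Sparse.mono {G G' : SimpleGraph V} (h : G ≤ G') {T : Finset V} (hs : Sparse G' T) :
    Sparse G T where
  ball c := (Finset.card_le_card (Finset.inter_subset_inter_left (ball_mono h 3 c))).trans
    (hs.ball c)
  tri a ha b hb u h1 h2 h3 := hs.tri a ha b hb u (h h1) (h h2) (h h3)
  quad a ha b hb u v hab huv h1 h2 h3 h4 :=
    hs.quad a ha b hb u v hab huv (h h1) (h h2) (h h3) (h h4)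

lemma Sparse.not_three {G : SimpleGraph V} {T : Finset V} (hs : Sparse G T) {c x y z : V}
    (hx : x ∈ T) (hy : y ∈ T) (hz : z ∈ T) (hxy : x ≠ y) (hxz : x ≠ z) (hyz : y ≠ z)
    (hx' : x ∈ RGP.ball G 3 c) (hy' : y ∈ RGP.ball G 3 c) (hz' : z ∈ RGP.ball G 3 c) : False := by
  have h := hs.ball c
  have h3 : ({x, y, z} : Finset V).card = 3 := Finset.card_eq_three.2 ⟨x, y, z, hxy, hxz, hyz, rfl⟩
  have : ({x, y, z} : Finset V) ⊆ T ∩ RGP.ball G 3 c := by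
    intro v hv
    simp only [Finset.mem_insert, Finset.mem_singleton] at hv
    rcases hv with rfl | rfl | rfl <;> simp [*]
  have := Finset.card_le_card this
  omega

lemma mem_ball_one {G : SimpleGraph V} {c u : V} (h : G.Adj c u) : u ∈ ball G 1 c :=
  mem_ball_succ self_mem_ball h

lemma mem_ball_two {G : SimpleGraph V} {c u v : V} (h : G.Adj c u) (h' : G.Adj u v) :
    v ∈ ball G 2 c := mem_ball_succ (mem_ball_one h) h'

lemma mem_ball_three {G : SimpleGraph V} {c u v w : V} (h₁ : G.Adj c u) (h₂ : G.Adj u v)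
    (h₃ : G.Adj v w) : w ∈ ball G 3 c := mem_ball_succ (mem_ball_two h₁ h₂) h₃

/-- The pruned spanning subgraph in which the Hamilton cycle is found: `T` holds the vertices of
small degree, `W` the other vertices with two neighbours in `T`. -/
structure Pruned (Q : SimpleGraph V) (C T W Z : Finset V) (p q : ℝ) : Prop where
  mem_core : ∀ a b, Q.Adj a b → a ∈ C
  two_le : ∀ a ∈ C, 2 ≤ (nb Q a).card
  normal_mem : ∀ a, a ∉ T → a ∉ W → a ∈ C
  le_deg : ∀ a, a ∉ T → a ∉ W → p ≤ (nb Q a).card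
  le_deg' : ∀ a, a ∉ T → a ∉ W → a ∉ Z → q ≤ (nb Q a).card
  tiny_step : ∀ y z t, y ∈ T → z ∉ W → t ≠ y → Q.Adj y z → Q.Adj z t → t ∉ T ∧ t ∉ W
  wide_step : ∀ y z t, y ∈ W → t ≠ y → Q.Adj y z → Q.Adj z t → t ∉ T ∧ t ∉ W
  wide_card : ∀ w ∈ W, (nb Q w).card ≤ 2
  wide_unique : ∀ a w w', w ∈ W → w' ∈ W → Q.Adj a w → Q.Adj a w' → w = w'
  card_near : ∀ t, (Finset.univ.filter fun y =>
    (y ∈ T ∨ y ∈ W) ∧ ∃ z, Q.Adj y z ∧ Q.Adj z t).card ≤ 3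
  card_wide : W.card ≤ T.card

/-- Vertices outside `T` with at least two neighbours in `T`. -/
def wide (G : SimpleGraph V) (T : Finset V) : Finset V :=
  Finset.univ.filter fun w => w ∉ T ∧ 2 ≤ (T ∩ nb G w).card

/-- Delete the edges between `W` and the complement of `T`. -/
def prune (G : SimpleGraph V) (T W : Finset V) : SimpleGraph V where
  Adj a b := G.Adj a b ∧ ¬ (a ∈ W ∧ b ∉ T) ∧ ¬ (b ∈ W ∧ a ∉ T)
  symm := ⟨fun _ _ h => ⟨h.1.symm, h.2.2, h.2.1⟩⟩
  loopless := ⟨fun a h => G.loopless.irrefl a h.1⟩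

lemma exists_other_of_wide {G : SimpleGraph V} {T : Finset V} {w : V} (hw : w ∈ wide G T) (z : V) :
    ∃ b ∈ T, b ≠ z ∧ G.Adj w b := by
  simp only [wide, Finset.mem_filter, Finset.mem_univ, true_and] at hw
  obtain ⟨b, hb, hbz⟩ := Finset.exists_mem_ne (by omega : 1 < (T ∩ nb G w).card) z
  simp only [Finset.mem_inter, mem_nb] at hb
  exact ⟨b, hb.1, hbz, hb.2⟩

/-- Two wide vertices have tiny neighbours leading to a third tiny vertex. -/
lemma Sparse.wide_eq {G : SimpleGraph V} {T : Finset V} (hs : Sparse G T) {w w' z z' c : V}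
    (hw : w ∈ wide G T) (hw' : w' ∈ wide G T) (hz : z ∈ T) (hz' : z' ∈ T)
    (hwz : G.Adj w z) (hwz' : G.Adj w' z')
    (hc : ∀ u, G.Adj w u → u ∈ RGP.ball G 3 c) (hc' : ∀ u, G.Adj w' u → u ∈ RGP.ball G 3 c) :
    w = w' := by
  by_contra hne
  obtain ⟨b, hb, hbz, hwb⟩ := exists_other_of_wide hw z
  by_cases h1 : G.Adj w' b
  · by_cases h2 : G.Adj w' z
    · exact hs.quad b hb z hz w w' hbz hne hwb.symm hwz.symm h1.symm h2.symm
    · obtain ⟨e, he, heb, hwe⟩ := exists_other_of_wide hw' b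
      have hez : e ≠ z := by rintro rfl; exact h2 hwe
      exact hs.not_three hb hz he hbz heb.symm hez.symm (hc _ hwb) (hc _ hwz) (hc' _ hwe)
  · have hbz' : b ≠ z' := by rintro rfl; exact h1 hwz'
    by_cases h2 : z = z'
    · subst h2
      obtain ⟨e, he, hez, hwe⟩ := exists_other_of_wide hw' z
      have heb : e ≠ b := by rintro rfl; exact h1 hwe
      exact hs.not_three hb hz he hbz heb.symm hez.symm (hc _ hwb) (hc _ hwz) (hc' _ hwe)
    · exact hs.not_three hb hz hz' hbz hbz' h2 (hc _ hwb) (hc _ hwz) (hc' _ hwz')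

lemma Sparse.card_tiny_nb {G : SimpleGraph V} {T : Finset V} (hs : Sparse G T) (v : V) :
    (T ∩ nb G v).card ≤ 2 := by
  refine (Finset.card_le_card ?_).trans (hs.ball v)
  refine Finset.inter_subset_inter_left fun u hu => ?_
  exact ball_mono_right (ball_mono_right (mem_ball_one (mem_nb.1 hu)))

lemma Sparse.wide_unique {G : SimpleGraph V} {T : Finset V} (hs : Sparse G T) {a w w' : V}
    (hw : w ∈ wide G T) (hw' : w' ∈ wide G T) (h : G.Adj a w) (h' : G.Adj a w') : w = w' := by
  obtain ⟨z, hz, -, hwz⟩ := exists_other_of_wide hw w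
  obtain ⟨z', hz', -, hwz'⟩ := exists_other_of_wide hw' w
  exact hs.wide_eq hw hw' hz hz' hwz hwz' (fun u hu => ball_mono_right (mem_ball_two h hu))
    (fun u hu => ball_mono_right (mem_ball_two h' hu))

lemma Sparse.card_wide {G : SimpleGraph V} {T : Finset V} (hs : Sparse G T) :
    (wide G T).card ≤ T.card := by
  have h : ∀ w : V, ∃ t, w ∈ wide G T → t ∈ T ∧ G.Adj w t := by
    intro w
    by_cases hw : w ∈ wide G T
    · obtain ⟨z, hz, -, hwz⟩ := exists_other_of_wide hw w
      exact ⟨z, fun _ => ⟨hz, hwz⟩⟩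
    · exact ⟨w, fun h => (hw h).elim⟩
  choose f hf using h
  refine Finset.card_le_card_of_injOn f (fun w hw => (hf w hw).1) ?_
  intro w hw w' hw' e
  have h2 := (hf w' hw').2
  rw [← e] at h2
  exact hs.wide_unique hw hw' (hf w hw).2.symm h2.symm

lemma pruned_of_sparse {G G' : SimpleGraph V} {C T Z : Finset V} {ε δ d η : ℝ}
    (hε : 0 < ε) (hε' : ε ≤ 1 / 10) (hη : η ≤ ε / 100) (hη0 : 0 < η) (hδd : 8 ≤ δ * d)
    (hεd : 10 ≤ ε * d)
    (hs : Sparse G T) (hG' : G' ≤ G) (hG'C : ∀ a b, G'.Adj a b → a ∈ C)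
    (hC : ∀ a ∈ C, 2 ≤ (nb G a ∩ C).card) (hTC : ∀ a, a ∉ T → a ∈ C)
    (hdeg : ∀ a ∈ C, (1 / 2 + ε) * ((nb G a ∩ C).card : ℝ) ≤ (nb G' a).card)
    (hT : ∀ a, a ∉ T → δ * d ≤ (nb G a).card)
    (hZ : ∀ a, a ∉ Z → (1 - η) * d ≤ (nb G a).card) :
    Pruned (prune G' T (wide G' T)) C T (wide G' T) Z (δ * d / 4) ((1 / 2 + ε / 2) * d) := by
  have hs' : Sparse G' T := hs.mono hG'
  have hWT : ∀ w ∈ wide G' T, w ∉ T := fun w hw => by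
    simp only [wide, Finset.mem_filter] at hw; exact hw.2.1
  have hle : prune G' T (wide G' T) ≤ G' := fun a b h => h.1
  have hWadj : ∀ w b, w ∈ wide G' T → (prune G' T (wide G' T)).Adj w b → b ∈ T := by
    intro w b hw h
    by_contra hb
    exact h.2.1 ⟨hw, hb⟩
  have hcore : ∀ a, a ∉ T → ((nb G a).card : ℝ) - 2 ≤ (nb G a ∩ C).card := by
    intro a ha
    have h1 : nb G a ⊆ (nb G a ∩ C) ∪ (T ∩ nb G a) := by
      intro b hb
      by_cases hbT : b ∈ T
      · simp [hb, hbT]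
      · simp [hb, hTC b hbT]
    have h2 := (Finset.card_le_card h1).trans (Finset.card_union_le _ _)
    have h3 := hs.card_tiny_nb a
    have h4 : (nb G a).card ≤ (nb G a ∩ C).card + 2 := by omega
    have h5 : ((nb G a).card : ℝ) ≤ (nb G a ∩ C).card + 2 := by exact_mod_cast h4
    linarith
  have hloss : ∀ a, a ∉ T → a ∉ wide G' T →
      ((nb G' a).card : ℝ) - 1 ≤ (nb (prune G' T (wide G' T)) a).card := by
    intro a ha haW
    have h1 : nb G' a ⊆ nb (prune G' T (wide G' T)) a ∪ (wide G' T ∩ nb G' a) := by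
      intro b hb
      rw [mem_nb] at hb
      by_cases hbW : b ∈ wide G' T
      · simp [hb, hbW]
      · simp [prune, hb, hbW, haW]
    have h3 : (wide G' T ∩ nb G' a).card ≤ 1 := by
      rw [Finset.card_le_one]
      intro w hw w' hw'
      simp only [Finset.mem_inter, mem_nb] at hw hw'
      exact hs'.wide_unique hw.1 hw'.1 hw.2 hw'.2
    have h2 := (Finset.card_le_card h1).trans (Finset.card_union_le _ _)
    have h4 : (nb G' a).card ≤ (nb (prune G' T (wide G' T)) a).card + 1 := by omega
    have h5 : ((nb G' a).card : ℝ) ≤ (nb (prune G' T (wide G' T)) a).card + 1 := by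
      exact_mod_cast h4
    linarith
  have hnorm : ∀ a, a ∉ T → a ∉ wide G' T → (1 / 2 + ε) * (((nb G a).card : ℝ) - 2) - 1 ≤
      (nb (prune G' T (wide G' T)) a).card := by
    intro a ha haW
    have h1 := hcore a ha
    have h2 := hdeg a (hTC a ha)
    have h3 := hloss a ha haW
    have h4 : (1 / 2 + ε) * (((nb G a).card : ℝ) - 2) ≤ (1 / 2 + ε) * ((nb G a ∩ C).card : ℝ) :=
      mul_le_mul_of_nonneg_left h1 (by linarith)
    linarith
  have hdeg1 : ∀ a, a ∉ T → a ∉ wide G' T →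
      δ * d / 4 ≤ (nb (prune G' T (wide G' T)) a).card := by
    intro a ha haW
    have h1 := hnorm a ha haW
    have h2 := hT a ha
    nlinarith
  refine ⟨fun a b h => hG'C a b h.1, ?_, fun a ha _ => hTC a ha, hdeg1, ?_, ?_, ?_, ?_, ?_, ?_, ?_⟩
  · intro a ha
    by_cases haT : a ∈ T
    · have h1 : nb G' a ⊆ nb (prune G' T (wide G' T)) a := by
        intro b hb
        rw [mem_nb] at hb ⊢
        exact ⟨hb, fun h => hWT a h.1 haT, fun h => h.2 haT⟩
      refine le_trans ?_ (Finset.card_le_card h1)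
      have h2 : (2 : ℝ) ≤ (nb G a ∩ C).card := by exact_mod_cast hC a ha
      have h3 := hdeg a ha
      have h4 : (1 : ℝ) < (nb G' a).card := by nlinarith
      exact_mod_cast h4
    · by_cases haW : a ∈ wide G' T
      · have h1 : T ∩ nb G' a ⊆ nb (prune G' T (wide G' T)) a := by
          intro b hb
          simp only [Finset.mem_inter, mem_nb] at hb ⊢
          exact ⟨hb.2, fun h => h.2 hb.1, fun h => hWT b h.1 hb.1⟩
        refine le_trans ?_ (Finset.card_le_card h1)
        simp only [wide, Finset.mem_filter] at haW
        exact haW.2.2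
      · have h1 := hdeg1 a haT haW
        have h2 : (2 : ℝ) ≤ (nb (prune G' T (wide G' T)) a).card := by linarith
        exact_mod_cast h2
  · intro a ha haW haZ
    have h1 := hnorm a ha haW
    have h2 := hZ a haZ
    have hd : 0 < d := by
      by_contra hd
      nlinarith
    nlinarith
  · intro y z t hy hz hty hyz hzt
    constructor
    · intro ht
      by_cases hzT : z ∈ T
      · exact hs'.not_three (c := z) hy hzT ht hyz.1.ne hty.symm hzt.1.ne
          (ball_mono_right (ball_mono_right (mem_ball_one hyz.1.symm))) self_mem_ball
          (ball_mono_right (ball_mono_right (mem_ball_one hzt.1)))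
      · apply hz
        simp only [wide, Finset.mem_filter, Finset.mem_univ, true_and]
        refine ⟨hzT, ?_⟩
        have : ({y, t} : Finset V) ⊆ T ∩ nb G' z := by
          intro v hv
          simp only [Finset.mem_insert, Finset.mem_singleton] at hv
          rcases hv with rfl | rfl
          · simp [hy, hyz.1.symm]
          · simp [ht, hzt.1]
        have h2 := Finset.card_le_card this
        rwa [Finset.card_pair hty.symm] at h2
    · intro ht
      have hzT : z ∈ T := hWadj t z ht hzt.symm
      obtain ⟨b, hb, hbz, htb⟩ := exists_other_of_wide ht z
      by_cases hyb : y = b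
      · subst hyb
        exact hs'.tri y hy z hzT t hyz.1 htb.symm hzt.1
      · exact hs'.not_three (c := z) hy hzT hb hyz.1.ne hyb hbz.symm
          (ball_mono_right (ball_mono_right (mem_ball_one hyz.1.symm))) self_mem_ball
          (ball_mono_right (mem_ball_two hzt.1 htb))
  · intro y z t hy hty hyz hzt
    have hzT : z ∈ T := hWadj y z hy hyz
    constructor
    · intro ht
      obtain ⟨b, hb, hbz, hyb⟩ := exists_other_of_wide hy z
      by_cases htb : t = b
      · subst htb
        exact hs'.tri z hzT t ht y hzt.1 hyz.1.symm hyb.symm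
      · exact hs'.not_three (c := z) hzT hb ht hbz.symm hzt.1.ne (Ne.symm htb) self_mem_ball
          (ball_mono_right (mem_ball_two hyz.1.symm hyb))
          (ball_mono_right (ball_mono_right (mem_ball_one hzt.1)))
    · intro ht
      exact hty (hs'.wide_unique ht hy hzt.1 hyz.1.symm)
  · intro w hw
    refine (Finset.card_le_card ?_).trans (hs'.card_tiny_nb w)
    intro b hb
    rw [mem_nb] at hb
    simp [hWadj w b hw hb, hb.1]
  · intro a w w' hw hw' h h'
    exact hs'.wide_unique hw hw' h.1 h'.1
  · intro t
    have h1 : (Finset.univ.filter fun y => (y ∈ T ∨ y ∈ wide G' T) ∧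
        ∃ z, (prune G' T (wide G' T)).Adj y z ∧ (prune G' T (wide G' T)).Adj z t) ⊆
        (T ∩ RGP.ball G' 3 t) ∪ (Finset.univ.filter fun y => y ∈ wide G' T ∧
        ∃ z, (prune G' T (wide G' T)).Adj y z ∧ (prune G' T (wide G' T)).Adj z t) := by
      intro y hy
      simp only [Finset.mem_filter, Finset.mem_univ, true_and] at hy
      obtain ⟨hy, z, hyz, hzt⟩ := hy
      rcases hy with hy | hy
      · refine Finset.mem_union_left _ ?_
        simp [hy, ball_mono_right (mem_ball_two hzt.1.symm hyz.1.symm)]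
      · refine Finset.mem_union_right _ ?_
        simp only [Finset.mem_filter, Finset.mem_univ, true_and]
        exact ⟨hy, z, hyz, hzt⟩
    have h3 : (Finset.univ.filter fun y => y ∈ wide G' T ∧
        ∃ z, (prune G' T (wide G' T)).Adj y z ∧ (prune G' T (wide G' T)).Adj z t).card ≤ 1 := by
      rw [Finset.card_le_one]
      intro w hw w' hw'
      simp only [Finset.mem_filter, Finset.mem_univ, true_and] at hw hw'
      obtain ⟨hw, z, hwz, hzt⟩ := hw
      obtain ⟨hw', z', hwz', hzt'⟩ := hw'
      exact hs'.wide_eq hw hw' (hWadj _ _ hw hwz) (hWadj _ _ hw' hwz') hwz.1 hwz'.1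
        (fun u hu => mem_ball_three hzt.1.symm hwz.1.symm hu)
        (fun u hu => mem_ball_three hzt'.1.symm hwz'.1.symm hu)
    have h2 := (Finset.card_le_card h1).trans (Finset.card_union_le _ _)
    have := hs'.ball t
    omega
  · exact hs'.card_wide

end Deterministic

section Rotation

set_option linter.unusedSectionVars false

open scoped Classical
variable [Fintype V] [DecidableEq V]

lemma exists_hitting {α ι : Type*} [DecidableEq α] (D : Finset α) (hD : D.Nonempty)
    (I : Finset ι) (F : ι → Finset α) (ρ : ℝ) (r : ℕ)
    (hF : ∀ i ∈ I, ρ * D.card ≤ (D ∩ F i).card) (hI : I.card * (1 - ρ) ^ r < 1) :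
    ∃ S ⊆ D, S.card ≤ r ∧ ∀ i ∈ I, (S ∩ F i).Nonempty := by
  by_contra! hcon
  have hsub : Fintype.piFinset (fun _ : Fin r => D) ⊆
      I.biUnion fun i => Fintype.piFinset (fun _ : Fin r => D \ F i) := by
    intro f hf
    rw [Fintype.mem_piFinset] at hf
    obtain ⟨i, hi, hi'⟩ := hcon (Finset.univ.image f) (by
      intro x hx
      obtain ⟨j, -, rfl⟩ := Finset.mem_image.1 hx
      exact hf j) (Finset.card_image_le.trans (by simp))
    rw [Finset.mem_biUnion]
    refine ⟨i, hi, ?_⟩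
    rw [Fintype.mem_piFinset]
    intro j
    rw [Finset.mem_sdiff]
    refine ⟨hf j, fun hj => ?_⟩
    have : f j ∈ Finset.univ.image f ∩ F i := by simp [hj]
    rw [hi'] at this
    simp at this
  have h1 := (Finset.card_le_card hsub).trans Finset.card_biUnion_le
  simp only [Fintype.card_piFinset, Finset.prod_const, Finset.card_univ, Fintype.card_fin] at h1
  have h2 : ((D.card : ℝ)) ^ r ≤ ∑ i ∈ I, ((D \ F i).card : ℝ) ^ r := by exact_mod_cast h1
  have hDpos : (0 : ℝ) < D.card := by exact_mod_cast hD.card_pos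
  have h3 : ∀ i ∈ I, ((D \ F i).card : ℝ) ^ r ≤ ((1 - ρ) * D.card) ^ r := by
    intro i hi
    apply pow_le_pow_left₀ (by positivity)
    have h4 : ((D \ F i).card : ℝ) + (D ∩ F i).card = D.card := by
      exact_mod_cast Finset.card_sdiff_add_card_inter D (F i)
    have := hF i hi
    linarith
  have h4 := h2.trans (Finset.sum_le_sum h3)
  rw [Finset.sum_const, nsmul_eq_mul, mul_pow, ← mul_assoc] at h4
  have h5 : (0 : ℝ) < (D.card : ℝ) ^ r := by positivity
  nlinarith

/-- The end vertices of the paths of `Γ` starting at `x` with vertex set `U`. -/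
def ends (Γ : SimpleGraph V) (U : Finset V) (x : V) : Finset V :=
  Finset.univ.filter fun y => ∃ l, SpanPath Γ U x y l

lemma mem_ends {Γ : SimpleGraph V} {U : Finset V} {x y : V} :
    y ∈ ends Γ U x ↔ ∃ l, SpanPath Γ U x y l := by simp [ends]

variable {Q Γ : SimpleGraph V} {C T W Z : Finset V} {p q : ℝ}

/-- Every set of normal vertices that expands little has a large neighbourhood. -/
def Expands (Γ : SimpleGraph V) (T W : Finset V) : Prop :=
  ∀ A : Finset V, A.Nonempty → (∀ a ∈ A, a ∉ T ∧ a ∉ W) →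
    (A ∪ A.biUnion (nb Γ)).card ≤ 13 * A.card →
    (Fintype.card V : ℝ) / 2 < (A.biUnion (nb Γ)).card

lemma Pruned.card_le_of_steps (hP : Pruned Q C T W Z p q) (A : Finset V)
    (h : ∀ y ∈ A, (y ∈ T ∨ y ∈ W) → ∃ z t, Q.Adj y z ∧ Q.Adj z t ∧ t ∈ A ∧ t ∉ T ∧ t ∉ W) :
    A.card ≤ 4 * (A.filter fun a => a ∉ T ∧ a ∉ W).card := by
  have h1 : A ⊆ (A.filter fun a => a ∉ T ∧ a ∉ W) ∪
      (A.filter fun a => a ∉ T ∧ a ∉ W).biUnion fun t => Finset.univ.filter fun y =>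
        (y ∈ T ∨ y ∈ W) ∧ ∃ z, Q.Adj y z ∧ Q.Adj z t := by
    intro y hy
    by_cases hyb : y ∈ T ∨ y ∈ W
    · obtain ⟨z, t, hyz, hzt, ht, ht'⟩ := h y hy hyb
      refine Finset.mem_union_right _ (Finset.mem_biUnion.2 ⟨t, ?_, ?_⟩)
      · simp [ht, ht']
      · simp only [Finset.mem_filter, Finset.mem_univ, true_and]
        exact ⟨hyb, z, hyz, hzt⟩
    · refine Finset.mem_union_left _ ?_
      simp [hy]; tauto
  have h2 := (Finset.card_le_card h1).trans (Finset.card_union_le _ _)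
  have h3 : _ ≤ _ * 3 := Finset.card_biUnion_le_card_mul (A.filter fun a => a ∉ T ∧ a ∉ W)
    (fun t => Finset.univ.filter fun y => (y ∈ T ∨ y ∈ W) ∧ ∃ z, Q.Adj y z ∧ Q.Adj z t) 3
    (fun t _ => hP.card_near t)
  omega

lemma Pruned.closed_large (hP : Pruned Q C T W Z p q) (hΓ : Γ ≤ Q) (hexp : Expands Γ T W)
    (A : Finset V) (hAC : A ⊆ C) (hA : A.Nonempty) (hcl : ∀ a ∈ A, ∀ b, Q.Adj a b → b ∈ A) :
    (Fintype.card V : ℝ) / 2 < A.card := by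
  have hother : ∀ z ∈ A, ∀ y, ∃ t, Q.Adj z t ∧ t ≠ y := by
    intro z hz y
    obtain ⟨t, ht, hty⟩ := Finset.exists_mem_ne (hP.two_le z (hAC hz)) y
    exact ⟨t, mem_nb.1 ht, hty⟩
  have hstep : ∀ y ∈ A, (y ∈ T ∨ y ∈ W) →
      ∃ z t, Q.Adj y z ∧ Q.Adj z t ∧ t ∈ A ∧ t ∉ T ∧ t ∉ W := by
    intro y hy hyb
    rcases hyb with hyT | hyW
    · have : ∃ z, Q.Adj y z ∧ z ∉ W := by
        by_contra! hcon
        obtain ⟨z, hz, -⟩ := hother y hy y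
        obtain ⟨z', hz', hne⟩ := hother y hy z
        exact hne (hP.wide_unique y z' z (hcon _ hz') (hcon _ hz) hz' hz)
      obtain ⟨z, hz, hzW⟩ := this
      obtain ⟨t, ht, hty⟩ := hother z (hcl y hy z hz) y
      exact ⟨z, t, hz, ht, hcl z (hcl y hy z hz) t ht, hP.tiny_step y z t hyT hzW hty hz ht⟩
    · obtain ⟨z, hz, -⟩ := hother y hy y
      obtain ⟨t, ht, hty⟩ := hother z (hcl y hy z hz) y
      exact ⟨z, t, hz, ht, hcl z (hcl y hy z hz) t ht, hP.wide_step y z t hyW hty hz ht⟩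
  have h1 := hP.card_le_of_steps A hstep
  set B := A.filter fun a => a ∉ T ∧ a ∉ W with hB
  have hBne : B.Nonempty := by
    rw [← Finset.card_pos]
    have := hA.card_pos
    omega
  have hBA : B ⊆ A := Finset.filter_subset _ _
  have hNB : B.biUnion (nb Γ) ⊆ A := by
    intro v hv
    obtain ⟨b, hb, hv⟩ := Finset.mem_biUnion.1 hv
    exact hcl b (hBA hb) v (hΓ (mem_nb.1 hv))
  have h2 := hexp B hBne (fun a ha => (Finset.mem_filter.1 ha).2) (by
    have := Finset.card_le_card (Finset.union_subset hBA hNB)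
    omega)
  have h3 : ((B.biUnion (nb Γ)).card : ℝ) ≤ A.card := by
    exact_mod_cast Finset.card_le_card hNB
  linarith

lemma Pruned.posa_ends (hP : Pruned Q C T W Z p q) (hΓ : Γ ≤ Q) (hexp : Expands Γ T W)
    (htwo : ∀ a ∈ C, 2 ≤ (nb Γ a).card) {U : Finset V} (hUC : U ⊆ C)
    (hext : ∀ x y l, SpanPath Q U x y l → ∀ w, Q.Adj y w → w ∈ U)
    (hclose : ∀ x y l, SpanPath Q U x y l → ¬ Q.Adj y x)
    {x y₀ : V} {l₀ : List V} (h₀ : SpanPath Γ U x y₀ l₀) :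
    (Fintype.card V : ℝ) / 6 < (ends Γ U x).card := by
  obtain ⟨Y', hy₀, hY1, hY2⟩ := posa h₀
  set Y : Finset V := Finset.univ.filter (· ∈ Y') with hY
  have hmY : ∀ v, v ∈ Y ↔ v ∈ Y' := by intro v; simp [hY]
  have hYends : Y ⊆ ends Γ U x := by
    intro y hy
    obtain ⟨l, hl, -⟩ := hY1 y ((hmY y).1 hy)
    exact mem_ends.2 ⟨l, hl⟩
  have hstep : ∀ y ∈ Y, (y ∈ T ∨ y ∈ W) →
      ∃ z t, Q.Adj y z ∧ Q.Adj z t ∧ t ∈ Y ∧ t ∉ T ∧ t ∉ W := by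
    intro y hy hyb
    obtain ⟨l, hl, hrot⟩ := hY1 y ((hmY y).1 hy)
    have hlQ := hl.mono hΓ
    have hyU : y ∈ U := by
      have := (hl.mem y).1 (List.mem_of_getLast? hl.last)
      exact_mod_cast this
    have hz : ∃ z, Γ.Adj y z ∧ ¬ Nxt l z y := by
      by_contra! hcon
      obtain ⟨z, hz⟩ := Finset.card_pos.1 (lt_of_lt_of_le two_pos (htwo y (hUC hyU)))
      obtain ⟨z', hz', hne⟩ := Finset.exists_mem_ne (htwo y (hUC hyU)) z
      rw [mem_nb] at hz hz'
      exact hne ((hcon z' hz').unique_left hl.nodup (hcon z hz))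
    obtain ⟨z, hyz, hzy⟩ := hz
    have hzU : z ∈ U := hext x y l hlQ z (hΓ hyz)
    have hzl : z ∈ l := (hl.mem z).2 (by exact_mod_cast hzU)
    obtain ⟨t, ht⟩ := exists_nxt_of_ne_last hl.last hzl hyz.ne'
    have hty : t ≠ y := by rintro rfl; exact hzy ht
    have hzt : Q.Adj z t := isChain_iff_nxt.1 hlQ.chain z t ht
    refine ⟨z, t, hΓ hyz, hzt, (hmY t).2 (hrot z t hyz ht), ?_⟩
    rcases hyb with hyT | hyW
    · refine hP.tiny_step y z t hyT ?_ hty (hΓ hyz) hzt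
      intro hzW
      have hzx : z ≠ x := by
        rintro rfl
        exact hclose z y l hlQ (hΓ hyz)
      obtain ⟨b, hb⟩ := exists_nxt_of_ne_head hl.head hzl hzx
      have hbz : Q.Adj b z := isChain_iff_nxt.1 hlQ.chain b z hb
      have hbt : b ≠ t := by
        rintro rfl
        exact hb.asymm hl.nodup ht
      have hby : b ≠ y := by
        rintro rfl
        have := hl.reverse
        exact not_nxt_head this.nodup this.head (nxt_reverse.2 hb)
      have h3 : ({b, t, y} : Finset V).card = 3 :=
        Finset.card_eq_three.2 ⟨b, t, y, hbt, hby, hty, rfl⟩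
      have hsub : ({b, t, y} : Finset V) ⊆ nb Q z := by
        intro v hv
        simp only [Finset.mem_insert, Finset.mem_singleton] at hv
        rw [mem_nb]
        rcases hv with rfl | rfl | rfl
        · exact hbz.symm
        · exact hzt
        · exact (hΓ hyz).symm
      have := Finset.card_le_card hsub
      have := hP.wide_card z hzW
      omega
    · exact hP.wide_step y z t hyW hty (hΓ hyz) hzt
  have h1 := hP.card_le_of_steps Y hstep
  set B := Y.filter fun a => a ∉ T ∧ a ∉ W with hB
  have hYpos : 0 < Y.card := Finset.card_pos.2 ⟨y₀, (hmY _).2 hy₀⟩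
  have hBne : B.Nonempty := by
    rw [← Finset.card_pos]
    omega
  have hBY : B ⊆ Y := Finset.filter_subset _ _
  have hpred : (Finset.univ.filter fun w => ∃ y ∈ Y, Nxt l₀ w y).card ≤ Y.card := by
    have : ∀ w : V, ∃ y, (∃ y ∈ Y, Nxt l₀ w y) → y ∈ Y ∧ Nxt l₀ w y := by
      intro w
      by_cases h : ∃ y ∈ Y, Nxt l₀ w y
      · obtain ⟨y, hy⟩ := h
        exact ⟨y, fun _ => hy⟩
      · exact ⟨w, fun h' => (h h').elim⟩
    choose f hf using this
    refine Finset.card_le_card_of_injOn f (fun w hw => (hf w (by simpa using hw)).1) ?_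
    intro w hw w' hw' e
    have h1 := (hf w (by simpa using hw)).2
    have h2 := (hf w' (by simpa using hw')).2
    rw [← e] at h2
    exact h1.unique_left h₀.nodup h2
  have hsucc : (Finset.univ.filter fun w => ∃ y ∈ Y, Nxt l₀ y w).card ≤ Y.card := by
    have : ∀ w : V, ∃ y, (∃ y ∈ Y, Nxt l₀ y w) → y ∈ Y ∧ Nxt l₀ y w := by
      intro w
      by_cases h : ∃ y ∈ Y, Nxt l₀ y w
      · obtain ⟨y, hy⟩ := h
        exact ⟨y, fun _ => hy⟩
      · exact ⟨w, fun h' => (h h').elim⟩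
    choose f hf using this
    refine Finset.card_le_card_of_injOn f (fun w hw => (hf w (by simpa using hw)).1) ?_
    intro w hw w' hw' e
    have h1 := (hf w (by simpa using hw)).2
    have h2 := (hf w' (by simpa using hw')).2
    rw [← e] at h2
    exact h1.unique_right h₀.nodup h2
  have hsub : Y ∪ B.biUnion (nb Γ) ⊆ Y ∪ ((Finset.univ.filter fun w => ∃ y ∈ Y, Nxt l₀ w y) ∪
      (Finset.univ.filter fun w => ∃ y ∈ Y, Nxt l₀ y w)) := by
    refine Finset.union_subset Finset.subset_union_left ?_
    intro w hw
    obtain ⟨y, hy, hw⟩ := Finset.mem_biUnion.1 hw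
    rw [mem_nb] at hw
    have hyY := (hmY y).1 (hBY hy)
    obtain ⟨l, hl, -⟩ := hY1 y hyY
    rcases hY2 y hyY w (by exact_mod_cast hext x y l (hl.mono hΓ) w (hΓ hw)) hw with h | h
    · exact Finset.mem_union_left _ ((hmY w).2 h)
    · refine Finset.mem_union_right _ ?_
      obtain ⟨y', hy', h | h⟩ := h
      · refine Finset.mem_union_left _ ?_
        simp only [Finset.mem_filter, Finset.mem_univ, true_and]
        exact ⟨y', (hmY y').2 hy', h⟩
      · refine Finset.mem_union_right _ ?_
        simp only [Finset.mem_filter, Finset.mem_univ, true_and]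
        exact ⟨y', (hmY y').2 hy', h⟩
  have hcard : (Y ∪ B.biUnion (nb Γ)).card ≤ 3 * Y.card := by
    have h2 := (Finset.card_le_card hsub).trans (Finset.card_union_le _ _)
    have h3 := Finset.card_union_le (Finset.univ.filter fun w => ∃ y ∈ Y, Nxt l₀ w y)
      (Finset.univ.filter fun w => ∃ y ∈ Y, Nxt l₀ y w)
    omega
  have h2 := hexp B hBne (fun a ha => (Finset.mem_filter.1 ha).2) (by
    have := Finset.card_le_card (Finset.union_subset_union_left hBY (t := B.biUnion (nb Γ)))
    omega)
  have h3 : ((B.biUnion (nb Γ)).card : ℝ) ≤ 3 * Y.card := by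
    exact_mod_cast (Finset.card_le_card Finset.subset_union_right).trans hcard
  have h4 : (Y.card : ℝ) ≤ (ends Γ U x).card := by exact_mod_cast Finset.card_le_card hYends
  linarith

end Rotation

section Rotation

set_option linter.unusedSectionVars false

open scoped Classical
variable [Fintype V] [DecidableEq V]
variable {Q Γ : SimpleGraph V} {C T W Z : Finset V} {p q : ℝ}

lemma SpanPath.length_eq {U : Finset V} {x y : V} {l : List V} (h : SpanPath Q U x y l) :
    l.length = U.card := by
  rw [← List.toFinset_card_of_nodup h.nodup]
  congr 1
  ext v
  simpa using h.mem v

lemma Pruned.exists_maximal_path (hP : Pruned Q C T W Z p q) (hC : C.Nonempty)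
    (hcl : ∀ A : Finset V, A ⊆ C → A.Nonempty → (∀ a ∈ A, ∀ b, Q.Adj a b → b ∈ A) →
      (Fintype.card V : ℝ) / 2 < A.card)
    (hno : ∀ x y l, SpanPath Q C x y l → 3 ≤ l.length → ¬ Q.Adj y x) :
    ∃ U ⊆ C, (∃ x y l, SpanPath Q U x y l) ∧
      (∀ x y l, SpanPath Q U x y l → ∀ w, Q.Adj y w → w ∈ U) ∧
      (∀ x y l, SpanPath Q U x y l → ¬ Q.Adj y x) := by
  set P : List V → Prop := fun l => l.IsChain Q.Adj ∧ l.Nodup ∧ ∀ v ∈ l, v ∈ C with hPdef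
  have hbd : ∀ l, P l → l.length ≤ Fintype.card V := fun l hl => hl.2.1.length_le_card
  have hmem : ∀ a b, Q.Adj a b → b ∈ C := fun a b h => hP.mem_core b a h.symm
  obtain ⟨l₃, hl₃, hlen₃⟩ : ∃ l, P l ∧ l.length = 3 := by
    obtain ⟨v, hv⟩ := hC
    obtain ⟨a, ha⟩ := Finset.card_pos.1 (lt_of_lt_of_le two_pos (hP.two_le v hv))
    obtain ⟨b, hb, hba⟩ := Finset.exists_mem_ne (hP.two_le v hv) a
    rw [mem_nb] at ha hb
    refine ⟨[a, v, b], ⟨?_, ?_, ?_⟩, rfl⟩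
    · simp [ha.symm, hb]
    · simp [ha.ne', hb.ne, hba.symm]
    · simp [hv, hmem v a ha, hmem v b hb]
  obtain ⟨l₀, hl₀, hmax⟩ : ∃ l, P l ∧ ∀ l', P l' → l'.length ≤ l.length := by
    have h := Nat.findGreatest_spec (P := fun k => ∃ l, P l ∧ l.length = k) (n := Fintype.card V)
      (m := 3) (hlen₃ ▸ hbd l₃ hl₃) ⟨l₃, hl₃, hlen₃⟩
    obtain ⟨l, hl, hlen⟩ := h
    refine ⟨l, hl, fun l' hl' => ?_⟩
    rw [hlen]
    exact Nat.le_findGreatest (hbd l' hl') ⟨l', hl', rfl⟩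
  have hlen : 3 ≤ l₀.length := hlen₃ ▸ hmax l₃ hl₃
  have hUC : l₀.toFinset ⊆ C := fun v hv => hl₀.2.2 v (by simpa using hv)
  have hcard : l₀.toFinset.card = l₀.length := List.toFinset_card_of_nodup hl₀.2.1
  refine ⟨l₀.toFinset, hUC, ?_, ?_, ?_⟩
  · have hne : l₀ ≠ [] := by rintro rfl; simp at hlen
    exact ⟨l₀.head hne, l₀.getLast hne, l₀, hl₀.1, hl₀.2.1, by simp, List.head?_eq_some_head hne,
      List.getLast?_eq_some_getLast hne⟩
  · intro x y l hl w hyw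
    by_contra hw
    have hwl : w ∉ l := fun h => hw (by exact_mod_cast (hl.mem w).1 h)
    have := hmax (l ++ [w]) ⟨?_, ?_, ?_⟩
    · simp only [List.length_append, List.length_singleton] at this
      have := hl.length_eq
      omega
    · rw [List.isChain_append]
      refine ⟨hl.chain, by simp, ?_⟩
      intro a ha b hb
      rw [hl.last] at ha
      simp at ha hb
      subst ha hb
      exact hyw
    · rw [List.nodup_append]
      refine ⟨hl.nodup, by simp, ?_⟩
      intro a ha b hb
      simp at hb
      subst hb
      rintro rfl
      exact hwl ha
    · intro v hv
      rw [List.mem_append] at hv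
      rcases hv with hv | hv
      · exact hUC (by exact_mod_cast (hl.mem v).1 hv)
      · simp at hv; subst hv; exact hmem y v hyw
  · intro x y l hl hyx
    have hll := hl.length_eq
    by_cases hUC' : l₀.toFinset = C
    · rw [hUC'] at hl hcard
      exact hno x y l hl (by have := hl.length_eq; omega) hyx
    · have hleave : ∃ u ∈ l₀.toFinset, ∃ w, w ∉ l₀.toFinset ∧ Q.Adj u w := by
        by_contra! hcon
        have h1 := hcl l₀.toFinset hUC (Finset.card_pos.1 (by omega)) (by
          intro a ha b hab
          by_contra hb
          exact hcon a ha b hb hab)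
        have h2 := hcl (C \ l₀.toFinset) Finset.sdiff_subset (by
          rw [Finset.sdiff_nonempty]
          intro h
          exact hUC' (Finset.Subset.antisymm hUC h)) (by
          intro a ha b hab
          rw [Finset.mem_sdiff] at ha ⊢
          exact ⟨hmem a b hab, fun hb => hcon b hb a ha.2 hab.symm⟩)
        have h3 : (l₀.toFinset).card + (C \ l₀.toFinset).card ≤ Fintype.card V := by
          rw [add_comm, Finset.card_sdiff_add_card_eq_card hUC]
          exact Finset.card_le_univ C
        have h4 : ((l₀.toFinset).card : ℝ) + (C \ l₀.toFinset).card ≤ Fintype.card V := by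
          exact_mod_cast h3
        linarith
      obtain ⟨u, hu, w, hw, huw⟩ := hleave
      have hul : u ∈ l := (hl.mem u).2 (by exact_mod_cast hu)
      have hwl : w ∉ l := fun h => hw (by exact_mod_cast (hl.mem w).1 h)
      obtain ⟨a, s, rfl⟩ := List.append_of_mem hul
      have hperm : (s ++ (a ++ [u])).Perm (a ++ u :: s) := by
        have : a ++ u :: s = (a ++ [u]) ++ s := by simp
        rw [this]
        exact List.perm_append_comm
      have := hmax (s ++ (a ++ [u]) ++ [w]) ⟨?_, ?_, ?_⟩
      · simp only [List.length_append, List.length_cons, List.length_nil] at this hll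
        omega
      · have hch := hl.chain
        have e : a ++ u :: s = (a ++ [u]) ++ s := by simp
        have hhead := hl.head
        have hlast := hl.last
        rw [e] at hch hhead hlast
        rw [List.isChain_append] at hch
        rw [List.isChain_append, List.isChain_append]
        refine ⟨⟨hch.2.1, hch.1, ?_⟩, by simp, ?_⟩
        · intro b hb c hc
          have h1 : b = y := by
            rw [List.getLast?_append, hb] at hlast
            simpa using hlast
          have h2 : c = x := by
            rw [List.head?_append, hc] at hhead
            simpa using hhead
          rw [h1, h2]
          exact hyx
        · intro b hb c hc
          simp at hb hc
          subst hb hc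
          exact huw
      · rw [List.nodup_append]
        refine ⟨hperm.nodup_iff.2 hl.nodup, by simp, ?_⟩
        intro b hb c hc
        simp at hc
        subst hc
        rintro rfl
        exact hwl (hperm.mem_iff.1 hb)
      · intro v hv
        rw [List.mem_append] at hv
        rcases hv with hv | hv
        · exact hUC (by exact_mod_cast (hl.mem v).1 (hperm.mem_iff.1 hv))
        · simp at hv; subst hv; exact hmem u v huw

lemma le_pairs_of_le_deg {q : ℝ} (hq : 0 ≤ q) (A B : Finset V)
    (h : ∀ a ∈ A, a ∉ B → q ≤ (nb Q a).card) :
    ((A.card : ℝ) - B.card) * q ≤ pairs Q (A ×ˢ Finset.univ) := by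
  rw [pairs_univ_right]
  push_cast
  have h1 : (A.card : ℝ) ≤ (A \ B).card + B.card := by
    exact_mod_cast Finset.card_le_card_sdiff_add_card
  have h2 : ((A \ B).card : ℝ) * q ≤ ∑ a ∈ A \ B, ((nb Q a).card : ℝ) := by
    rw [← nsmul_eq_mul]
    apply Finset.card_nsmul_le_sum
    intro a ha
    rw [Finset.mem_sdiff] at ha
    exact h a ha.1 ha.2
  have h3 : ∑ a ∈ A \ B, ((nb Q a).card : ℝ) ≤ ∑ a ∈ A, ((nb Q a).card : ℝ) :=
    Finset.sum_le_sum_of_subset_of_nonneg Finset.sdiff_subset (fun _ _ _ => by positivity)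
  nlinarith

lemma expands_of_hit {G : SimpleGraph V} (hP : Pruned Q C T W Z p q) (hQG : Q ≤ G) (hΓ : Γ ≤ Q)
    {n m d k c γ ε τ₂ τ₃ : ℝ} (hn : n = Fintype.card V) (hm : 2 * m = n * d) (hd : 0 < d)
    (hε : 0 < ε) (hε' : ε ≤ 1 / 10) (hq : q = (1 / 2 + ε / 2) * d)
    (hk : ∀ a, a ∉ T → a ∉ W → k ≤ (nb Γ a).card) (hkγ : 13 * γ * d < k)
    (hγ : 0 ≤ γ)
    (hhit : ∀ A B : Finset V, τ₃ * m ≤ pairs Q (A ×ˢ B) → ∃ a ∈ A, ∃ b ∈ B, Γ.Adj a b)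
    (hloc : ∀ B : Finset V, (B.card : ℝ) ≤ c * n → (pairs G (B ×ˢ B) : ℝ) ≤ γ * d * B.card)
    (hunif : ∀ A B : Finset V, (pairs G (A ×ˢ B) : ℝ) ≤
      (2 * (A.card * B.card) / n ^ 2 + τ₂) * m)
    (hc : 0 < c)
    (hτ₃ : τ₃ ≤ c / 13 * ε / 4) (hτ₂ : τ₂ ≤ c / 13 * ε / 8)
    (hZ : (Z.card : ℝ) ≤ c / 13 * ε / 8 * n) : Expands Γ T W := by
  intro A hA hAn hAcard
  set N := A.biUnion (nb Γ) with hN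
  have hApos : (0 : ℝ) < A.card := by exact_mod_cast hA.card_pos
  have hnpos : 0 < n := by
    rw [hn]
    exact_mod_cast hA.card_pos.trans_le (Finset.card_le_univ A)
  have hnd := mul_pos hnpos hd
  have hbig : c / 13 * n < A.card := by
    have hB13 : ((A ∪ N).card : ℝ) ≤ 13 * A.card := by exact_mod_cast hAcard
    by_contra! hcon
    have h1 := hloc (A ∪ N) (by linarith)
    have h2 : (A.card : ℝ) * k ≤ pairs G ((A ∪ N) ×ˢ (A ∪ N)) := by
      have e1 : (A.card : ℝ) * k ≤ pairs Γ (A ×ˢ Finset.univ) := by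
        rw [pairs_univ_right]
        push_cast
        rw [← nsmul_eq_mul]
        apply Finset.card_nsmul_le_sum
        intro a ha
        exact hk a (hAn a ha).1 (hAn a ha).2
      have e2 : pairs Γ (A ×ˢ Finset.univ) ≤ pairs Γ ((A ∪ N) ×ˢ (A ∪ N)) := by
        apply pairs_mono
        rintro ⟨a, b⟩ hab hadj
        simp only [Finset.mem_product, Finset.mem_univ, and_true] at hab
        simp only [Finset.mem_product, Finset.mem_union]
        exact ⟨Or.inl hab, Or.inr (Finset.mem_biUnion.2 ⟨a, hab, mem_nb.2 hadj⟩)⟩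
      have e3 := pairs_mono_left (hΓ.trans hQG) ((A ∪ N) ×ˢ (A ∪ N))
      exact e1.trans (by exact_mod_cast e2.trans e3)
    have h3 : γ * d * (A ∪ N).card ≤ γ * d * (13 * A.card) :=
      mul_le_mul_of_nonneg_left hB13 (by positivity)
    have h4 := mul_lt_mul_of_pos_left hkγ hApos
    linarith
  rw [← hn]
  by_contra! hsmall
  have h1 : (pairs Q (A ×ˢ Nᶜ) : ℝ) ≤ τ₃ * m := by
    by_contra! hcon
    obtain ⟨a, ha, b, hb, hab⟩ := hhit A Nᶜ hcon.le
    rw [Finset.mem_compl] at hb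
    exact hb (Finset.mem_biUnion.2 ⟨a, ha, mem_nb.2 hab⟩)
  have h2 : (pairs Q (A ×ˢ N) : ℝ) ≤ (2 * (A.card * N.card) / n ^ 2 + τ₂) * m :=
    le_trans (by exact_mod_cast pairs_mono_left hQG _) (hunif A N)
  have h3 : pairs Q (A ×ˢ Finset.univ) ≤ pairs Q (A ×ˢ N) + pairs Q (A ×ˢ Nᶜ) := by
    refine le_trans (pairs_mono Q ?_) (pairs_union_le _ _ _)
    rintro ⟨a, b⟩ hab -
    simp only [Finset.mem_product, Finset.mem_univ, and_true] at hab
    simp only [Finset.mem_union, Finset.mem_product, Finset.mem_compl]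
    tauto
  have h3' : (pairs Q (A ×ˢ Finset.univ) : ℝ) ≤ pairs Q (A ×ˢ N) + pairs Q (A ×ˢ Nᶜ) := by
    exact_mod_cast h3
  have h4 := le_pairs_of_le_deg (Q := Q) (q := q) (by rw [hq]; positivity) A Z
    (fun a ha haZ => hP.le_deg' a (hAn a ha).1 (hAn a ha).2 haZ)
  have h5 : 2 * ((A.card : ℝ) * N.card) / n ^ 2 * m ≤ A.card * d / 2 := by
    have e : 2 * ((A.card : ℝ) * N.card) / n ^ 2 * m = A.card * d * (N.card / n) := by
      have : m = n * d / 2 := by linarith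
      rw [this]
      field_simp
    rw [e]
    have : (N.card : ℝ) / n ≤ 1 / 2 := by
      rw [div_le_iff₀ hnpos]; linarith
    have := mul_le_mul_of_nonneg_left this (mul_pos hApos hd).le
    linarith
  rw [hq] at h4
  have h6 : ((A.card : ℝ) - Z.card) * ((1 / 2 + ε / 2) * d) ≤
      A.card * d / 2 + (τ₂ + τ₃) * (n * d / 2) := by
    have : (τ₂ + τ₃) * (n * d / 2) = (τ₂ + τ₃) * m := by rw [← hm]; ring
    rw [this]
    rw [add_mul] at h2 ⊢
    linarith
  have h7 : ((A.card : ℝ) - Z.card) * (1 / 2 + ε / 2) ≤ A.card / 2 + (τ₂ + τ₃) * (n / 2) := by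
    by_contra! hcon
    have := mul_lt_mul_of_pos_right hcon hd
    linarith
  have h8 : (Z.card : ℝ) * (1 / 2 + ε / 2) ≤ Z.card := by
    have : (0 : ℝ) ≤ Z.card := by positivity
    exact mul_le_of_le_one_right this (by linarith)
  have h9 : (τ₂ + τ₃) * (n / 2) ≤ (c / 13 * ε / 8 + c / 13 * ε / 4) * (n / 2) :=
    mul_le_mul_of_nonneg_right (by linarith) (by positivity)
  have h10 : c / 13 * n * (ε / 2) < A.card * (ε / 2) := mul_lt_mul_of_pos_right hbig (by positivity)
  have h11 : 0 < c / 13 * n * ε := by positivity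
  rw [sub_mul] at h7
  linarith

end Rotation

section Booster

set_option linter.unusedSectionVars false

open scoped Classical
variable [Fintype V] [DecidableEq V]
variable {Q Γ : SimpleGraph V} {C T W Z : Finset V} {p q : ℝ}

/-- The graph whose edges are the pairs in `S`. -/
def ofPairs (S : Finset (V × V)) : SimpleGraph V := SimpleGraph.fromRel fun a b => (a, b) ∈ S

lemma ofPairs_le {S : Finset (V × V)} (h : ∀ q ∈ S, Q.Adj q.1 q.2) : ofPairs S ≤ Q := by
  intro a b hab
  rcases hab with ⟨-, hab | hab⟩
  · exact h _ hab
  · exact (h _ hab).symm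

lemma ofPairs_adj {S : Finset (V × V)} (h : ∀ q ∈ S, Q.Adj q.1 q.2) {a b : V} (hab : (a, b) ∈ S) :
    (ofPairs S).Adj a b := ⟨(h _ hab).ne, Or.inl hab⟩

lemma pairs_ofPairs (S : Finset (V × V)) : pairs (ofPairs S) Finset.univ ≤ 2 * S.card := by
  have : (Finset.univ.filter fun q : V × V => (ofPairs S).Adj q.1 q.2) ⊆
      S ∪ S.image Prod.swap := by
    rintro ⟨a, b⟩ hab
    simp only [Finset.mem_filter, Finset.mem_univ, true_and] at hab
    rcases hab with ⟨-, hab | hab⟩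
    · exact Finset.mem_union_left _ hab
    · exact Finset.mem_union_right _ (Finset.mem_image.2 ⟨(b, a), hab, rfl⟩)
  have h1 := (Finset.card_le_card this).trans (Finset.card_union_le _ _)
  have h2 : (S.image Prod.swap).card ≤ S.card := Finset.card_image_le
  unfold pairs
  omega

lemma pairs_sup_le (Γ Γ' : SimpleGraph V) (F : Finset (V × V)) :
    pairs (Γ ⊔ Γ') F ≤ pairs Γ F + pairs Γ' F := by
  unfold pairs
  refine le_trans (Finset.card_le_card ?_) (Finset.card_union_le _ _)
  intro q
  simp only [Finset.mem_filter, Finset.mem_union, SimpleGraph.sup_adj]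
  tauto

lemma exists_hit_graph {ι : Type*} [Fintype ι] (F : ι → Finset (V × V)) {m τ : ℝ} (hm : 0 < m)
    (hτ : 0 < τ) (hτ1 : τ ≤ 1) (hQ : (pairs Q Finset.univ : ℝ) ≤ 2 * m) (r : ℕ)
    (hr : (Fintype.card ι : ℝ) * (1 - τ / 2) ^ r < 1) :
    ∃ Γ ≤ Q, pairs Γ Finset.univ ≤ 2 * r ∧
      ∀ i, τ * m ≤ pairs Q (F i) → ∃ q ∈ F i, Γ.Adj q.1 q.2 := by
  set D : Finset (V × V) := Finset.univ.filter fun q => Q.Adj q.1 q.2 with hD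
  have hDF : ∀ i, pairs Q (F i) = (D ∩ F i).card := by
    intro i
    unfold pairs
    congr 1
    ext q
    simp [hD, and_comm]
  rcases D.eq_empty_or_nonempty with hDe | hDne
  · refine ⟨⊥, bot_le, by simp [pairs], ?_⟩
    intro i hi
    rw [hDF, hDe] at hi
    have := mul_pos hτ hm
    simp at hi
    linarith
  · obtain ⟨S, hSD, hSr, hS⟩ := exists_hitting D hDne
      (Finset.univ.filter fun i => τ * m ≤ pairs Q (F i)) F (τ / 2) r (by
        intro i hi
        rw [Finset.mem_filter] at hi
        rw [← hDF]
        have h1 : (D.card : ℝ) ≤ 2 * m := hQ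
        nlinarith [hi.2]) (by
        refine lt_of_le_of_lt (mul_le_mul_of_nonneg_right ?_ ?_) hr
        · exact_mod_cast Finset.card_le_univ _
        · apply pow_nonneg; linarith)
    have hSQ : ∀ q ∈ S, Q.Adj q.1 q.2 := fun q hq => (Finset.mem_filter.1 (hSD hq)).2
    refine ⟨ofPairs S, ofPairs_le hSQ, (pairs_ofPairs S).trans (by omega), ?_⟩
    intro i hi
    obtain ⟨q, hq⟩ := hS i (by simp [hi])
    rw [Finset.mem_inter] at hq
    exact ⟨q, hq.2, ofPairs_adj hSQ hq.1⟩

lemma exists_degree_graph (Q : SimpleGraph V) (k : ℕ) :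
    ∃ Γ ≤ Q, pairs Γ Finset.univ ≤ 2 * (Fintype.card V * k) ∧
      ∀ a, min k (nb Q a).card ≤ (nb Γ a).card := by
  have h : ∀ a, ∃ t ⊆ nb Q a, t.card = min k (nb Q a).card := fun a =>
    Finset.exists_subset_card_eq (min_le_right _ _)
  choose f hf hfc using h
  set S : Finset (V × V) := Finset.univ.biUnion fun a => (f a).image fun b => (a, b) with hS
  have hmem : ∀ a b, (a, b) ∈ S ↔ b ∈ f a := by
    intro a b
    simp [hS]
  have hSQ : ∀ q ∈ S, Q.Adj q.1 q.2 := by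
    rintro ⟨a, b⟩ hq
    exact mem_nb.1 (hf a ((hmem a b).1 hq))
  refine ⟨ofPairs S, ofPairs_le hSQ, (pairs_ofPairs S).trans ?_, ?_⟩
  · have h1 : S.card ≤ Fintype.card V * k := by
      refine Finset.card_biUnion_le_card_mul _ _ _ fun a _ => ?_
      refine Finset.card_image_le.trans ?_
      rw [hfc]
      exact min_le_left _ _
    omega
  · intro a
    rw [← hfc a]
    apply Finset.card_le_card
    intro b hb
    rw [mem_nb]
    exact ofPairs_adj hSQ ((hmem a b).2 hb)

lemma SpanPath.exists_graph {U : Finset V} {x y : V} {l : List V} (h : SpanPath Q U x y l) :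
    ∃ Γ ≤ Q, pairs Γ Finset.univ ≤ 2 * Fintype.card V ∧ SpanPath Γ U x y l := by
  set S : Finset (V × V) := Finset.univ.filter fun q => Nxt l q.1 q.2 with hS
  have hSQ : ∀ q ∈ S, Q.Adj q.1 q.2 := by
    rintro ⟨a, b⟩ hq
    exact isChain_iff_nxt.1 h.chain _ _ (Finset.mem_filter.1 hq).2
  refine ⟨ofPairs S, ofPairs_le hSQ, (pairs_ofPairs S).trans ?_, ?_, h.nodup, h.mem, h.head, h.last⟩
  · have : S.card ≤ (Finset.univ : Finset V).card := by
      refine Finset.card_le_card_of_injOn Prod.fst (fun _ _ => Finset.mem_coe.2 (Finset.mem_univ _)) ?_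
      rintro ⟨a, b⟩ hq ⟨a', b'⟩ hq' e
      simp only [hS, Finset.coe_filter, Finset.mem_univ, true_and, Set.mem_ofPred_eq] at hq hq' e
      subst e
      rw [hq.unique_right h.nodup hq']
    rw [Finset.card_univ] at this
    omega
  · rw [isChain_iff_nxt]
    intro a b hab
    exact ofPairs_adj hSQ (by simp [hS, hab])

/-- A chosen path with given ends and vertex set. -/
def pathOf (Γ : SimpleGraph V) (U : Finset V) (x y : V) : List V :=
  if h : ∃ l, SpanPath Γ U x y l then h.choose else []

lemma pathOf_spec {U : Finset V} {x y : V} (h : y ∈ ends Γ U x) :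
    SpanPath Γ U x y (pathOf Γ U x y) := by
  rw [mem_ends] at h
  rw [pathOf, dif_pos h]
  exact h.choose_spec

/-- Pairs whose addition rotates the end of a path to a vertex in `S`. -/
def rotPairs (Γ : SimpleGraph V) (U S : Finset V) (x : V) : Finset (V × V) :=
  Finset.univ.filter fun q => q.1 ∈ ends Γ U x ∧ ∃ t ∈ S, Nxt (pathOf Γ U x q.1) q.2 t

/-- Pairs starting in `X` that do not close a path. -/
def openPairs (Γ : SimpleGraph V) (U X : Finset V) : Finset (V × V) :=
  Finset.univ.filter fun q => q.1 ∈ X ∧ q.2 ∉ ends Γ U q.1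

lemma card_rotPairs_le (Γ : SimpleGraph V) (U S : Finset V) (x : V) :
    (rotPairs Γ U S x).card ≤ (ends Γ U x).card * S.card := by
  rw [← Finset.card_product]
  have : ∀ q : V × V, ∃ t, q ∈ rotPairs Γ U S x → t ∈ S ∧ Nxt (pathOf Γ U x q.1) q.2 t := by
    intro q
    by_cases hq : q ∈ rotPairs Γ U S x
    · obtain ⟨t, ht⟩ := (Finset.mem_filter.1 hq).2.2
      exact ⟨t, fun _ => ht⟩
    · exact ⟨q.1, fun h => (hq h).elim⟩
  choose f hf using this
  refine Finset.card_le_card_of_injOn (fun q => (q.1, f q)) ?_ ?_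
  · intro q hq
    rw [Finset.mem_coe, Finset.mem_product]
    exact ⟨(Finset.mem_filter.1 hq).2.1, (hf q hq).1⟩
  · rintro ⟨a, b⟩ hq ⟨a', b'⟩ hq' e
    simp only [Prod.mk.injEq] at e
    obtain ⟨rfl, e⟩ := e
    have h1 := (hf _ hq).2
    have h2 := (hf _ hq').2
    rw [← e] at h2
    have h3 := (pathOf_spec (Finset.mem_filter.1 hq).2.1).nodup
    exact congrArg (Prod.mk a) (h1.unique_left h3 h2)

lemma card_openPairs_le (Γ : SimpleGraph V) (U X : Finset V) {t : ℝ}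
    (h : ∀ x ∈ X, t ≤ (ends Γ U x).card) :
    ((openPairs Γ U X).card : ℝ) ≤ X.card * ((Fintype.card V : ℝ) - t) := by
  have h1 : openPairs Γ U X ⊆ X.biUnion fun x => ((ends Γ U x)ᶜ).image fun w => (x, w) := by
    rintro ⟨a, b⟩ hq
    have := (Finset.mem_filter.1 hq).2
    simp only [Finset.mem_biUnion, Finset.mem_image, Finset.mem_compl, Prod.mk.injEq]
    exact ⟨a, this.1, b, this.2, rfl, rfl⟩
  have h2 := (Finset.card_le_card h1).trans Finset.card_biUnion_le
  have h3 : ((openPairs Γ U X).card : ℝ) ≤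
      ∑ x ∈ X, ((((ends Γ U x)ᶜ).image fun w => (x, w)).card : ℝ) := by exact_mod_cast h2
  refine h3.trans ?_
  rw [← nsmul_eq_mul]
  apply Finset.sum_le_card_nsmul
  intro x hx
  have h4 : ((((ends Γ U x)ᶜ).image fun w => (x, w)).card : ℝ) ≤ ((ends Γ U x)ᶜ).card := by
    exact_mod_cast Finset.card_image_le
  have h5 : (((ends Γ U x)ᶜ).card : ℝ) + (ends Γ U x).card = Fintype.card V := by
    have := Finset.card_add_card_compl (ends Γ U x)
    rw [add_comm]
    exact_mod_cast this
  have := h x hx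
  linarith

/-- The uniform-distribution property used for the rotations. -/
def PathUniform (G : SimpleGraph V) (κ τ m : ℝ) : Prop :=
  ∀ Γ ≤ G, (pairs Γ Finset.univ : ℝ) ≤ 2 * κ * m → ∀ U S : Finset V,
    (∀ x, (pairs G (rotPairs Γ U S x) : ℝ) ≤
      (2 * (rotPairs Γ U S x).card / (Fintype.card V : ℝ) ^ 2 + τ) * m) ∧
    (pairs G (openPairs Γ U S) : ℝ) ≤
      (2 * (openPairs Γ U S).card / (Fintype.card V : ℝ) ^ 2 + τ) * m

lemma exists_ham_list {G : SimpleGraph V} {n m d c γ ε τ₂ τ₃ κ : ℝ} {k r : ℕ}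
    (hP : Pruned Q C T W Z p ((1 / 2 + ε / 2) * d)) (hQG : Q ≤ G) (hC : C.Nonempty)
    (hn : n = Fintype.card V) (hm : 2 * m = n * d) (hd : 0 < d)
    (hε : 0 < ε) (hε' : ε ≤ 1 / 10)
    (hG : (pairs G Finset.univ : ℝ) ≤ 2 * m)
    (hk2 : 2 ≤ k) (hkp : (k : ℝ) ≤ p) (hkγ : 13 * γ * d < k) (hγ : 0 ≤ γ)
    (hloc : ∀ B : Finset V, (B.card : ℝ) ≤ c * n → (pairs G (B ×ˢ B) : ℝ) ≤ γ * d * B.card)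
    (hunif : ∀ A B : Finset V, (pairs G (A ×ˢ B) : ℝ) ≤
      (2 * (A.card * B.card) / n ^ 2 + τ₂) * m)
    (hc : 0 < c) (hτ₃0 : 0 < τ₃) (hτ₃1 : τ₃ ≤ 1)
    (hτ₃ : τ₃ ≤ c / 13 * ε / 4) (hτ₂ : τ₂ ≤ c / 13 * ε / 8)
    (hZ : (Z.card : ℝ) ≤ c / 13 * ε / 8 * n)
    (hbad : (Z.card : ℝ) + T.card + W.card ≤ 3 * (ε / 100) * n)
    (hr₃ : (4 : ℝ) ^ Fintype.card V * (1 - τ₃ / 2) ^ r < 1)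
    (hr : (4 : ℝ) ^ Fintype.card V * (1 - ε / 100 / 2) ^ r < 1)
    (hsize : 2 * (n * k) + 2 * r + 2 * n + 2 * r ≤ 2 * κ * m)
    (hU : PathUniform G κ (ε / 100) m) :
    ∃ x y l, SpanPath Q C x y l ∧ 3 ≤ l.length ∧ Q.Adj y x := by
  by_contra! hno
  have hnpos : 0 < n := by
    rw [hn]
    exact_mod_cast hC.card_pos.trans_le (Finset.card_le_univ C)
  have hnd := mul_pos hnpos hd
  have hmpos : 0 < m := by linarith
  have hQ2m : (pairs Q Finset.univ : ℝ) ≤ 2 * m :=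
    le_trans (by exact_mod_cast pairs_mono_left hQG _) hG
  obtain ⟨ΓD, hΓD, hDcard, hDdeg⟩ := exists_degree_graph Q k
  obtain ⟨ΓH, hΓH, hHcard, hHhit⟩ := exists_hit_graph (Q := Q)
    (fun i : Finset V × Finset V => i.1 ×ˢ i.2) hmpos hτ₃0 hτ₃1 hQ2m r (by
      rw [Fintype.card_prod, Fintype.card_finset]
      push_cast
      rw [← mul_pow]
      norm_num
      exact hr₃)
  have hdegk : ∀ Γ, ΓD ≤ Γ → ∀ a, a ∉ T → a ∉ W → (k : ℝ) ≤ (nb Γ a).card := by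
    intro Γ hΓ a ha haW
    have h1 := hDdeg a
    have h2 : k ≤ (nb Q a).card := by exact_mod_cast hkp.trans (hP.le_deg a ha haW)
    have h3 := Finset.card_le_card (nb_mono hΓ a)
    rw [min_eq_left h2] at h1
    exact_mod_cast h1.trans h3
  have hexp : ∀ Γ, ΓD ≤ Γ → ΓH ≤ Γ → Γ ≤ Q → Expands Γ T W := by
    intro Γ h1 h2 h3
    refine expands_of_hit hP hQG h3 hn hm hd hε hε' rfl (hdegk Γ h1) hkγ hγ ?_ hloc hunif hc hτ₃
      hτ₂ hZ
    intro A B hAB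
    obtain ⟨⟨a, b⟩, hab, hadj⟩ := hHhit (A, B) hAB
    rw [Finset.mem_product] at hab
    exact ⟨a, hab.1, b, hab.2, h2 hadj⟩
  obtain ⟨U, hUC, ⟨x₀, y₀, l₀, h₀⟩, hext, hclose⟩ := hP.exists_maximal_path hC
    (hP.closed_large (sup_le hΓD hΓH) (hexp (ΓD ⊔ ΓH) le_sup_left le_sup_right (sup_le hΓD hΓH)))
    hno
  obtain ⟨ΓP, hΓP, hPcard, hP₀⟩ := h₀.exists_graph
  set Γ₁ := ΓD ⊔ ΓH ⊔ ΓP with hΓ₁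
  have hΓ₁Q : Γ₁ ≤ Q := sup_le (sup_le hΓD hΓH) hΓP
  have hDΓ₁ : ΓD ≤ Γ₁ := le_sup_left.trans le_sup_left
  have hHΓ₁ : ΓH ≤ Γ₁ := le_sup_right.trans le_sup_left
  have hexp₁ := hexp Γ₁ hDΓ₁ hHΓ₁ hΓ₁Q
  have htwo : ∀ a ∈ C, 2 ≤ (nb Γ₁ a).card := by
    intro a ha
    refine le_trans ?_ (Finset.card_le_card (nb_mono hDΓ₁ a))
    refine le_trans ?_ (hDdeg a)
    exact le_min hk2 (hP.two_le a ha)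
  have hends : ∀ x y l, SpanPath Γ₁ U x y l → n / 6 < (ends Γ₁ U x).card := by
    intro x y l hl
    rw [hn]
    exact hP.posa_ends hΓ₁Q hexp₁ htwo hUC hext hclose hl
  have hΓ₁card : pairs Γ₁ Finset.univ ≤ 2 * (Fintype.card V * k) + 2 * r + 2 * Fintype.card V := by
    have h1 := pairs_sup_le (ΓD ⊔ ΓH) ΓP Finset.univ
    have h2 := pairs_sup_le ΓD ΓH Finset.univ
    rw [← hΓ₁] at h1
    omega
  have hΓ₁card' : (pairs Γ₁ Finset.univ : ℝ) ≤ 2 * (n * k) + 2 * r + 2 * n := by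
    rw [hn]; exact_mod_cast hΓ₁card
  set X := ends Γ₁ U x₀ with hX
  have hXbig : n / 6 < X.card := hends x₀ y₀ l₀ (hP₀.mono le_sup_right)
  have hYbig : ∀ x ∈ X, n / 6 < (ends Γ₁ U x).card := by
    intro x hx
    obtain ⟨l, hl⟩ := mem_ends.1 hx
    exact hends x x₀ _ hl.reverse
  obtain ⟨ΓR, hΓR, hRcard, hRhit⟩ := exists_hit_graph (Q := Q)
    (fun i : V × Finset V => rotPairs Γ₁ U i.2 i.1) hmpos (by positivity : 0 < ε / 100)
    (by linarith) hQ2m r (by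
      refine lt_of_le_of_lt (mul_le_mul_of_nonneg_right ?_ ?_) hr
      · rw [Fintype.card_prod, Fintype.card_finset]
        have : Fintype.card V ≤ 2 ^ Fintype.card V := Nat.lt_two_pow_self.le
        have h4 : Fintype.card V * 2 ^ Fintype.card V ≤ 4 ^ Fintype.card V := by
          calc _ ≤ 2 ^ Fintype.card V * 2 ^ Fintype.card V := Nat.mul_le_mul_right _ this
            _ = 4 ^ Fintype.card V := by rw [← mul_pow]; norm_num
        exact_mod_cast h4
      · apply pow_nonneg; linarith)
  set Γ₂ := Γ₁ ⊔ ΓR with hΓ₂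
  have hΓ₂Q : Γ₂ ≤ Q := sup_le hΓ₁Q hΓR
  have hΓ₁₂ : Γ₁ ≤ Γ₂ := le_sup_left
  have hΓ₂card : (pairs Γ₂ Finset.univ : ℝ) ≤ 2 * κ * m := by
    have h1 : (pairs Γ₂ Finset.univ : ℝ) ≤ pairs Γ₁ Finset.univ + pairs ΓR Finset.univ := by
      exact_mod_cast pairs_sup_le Γ₁ ΓR Finset.univ
    have h2 : (pairs ΓR Finset.univ : ℝ) ≤ 2 * r := by exact_mod_cast hRcard
    linarith
  have hrpos : (0 : ℝ) ≤ r := by positivity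
  have hq0 : 0 ≤ (1 / 2 + ε / 2) * d := by positivity
  have hbadset : ((Z ∪ T ∪ W).card : ℝ) ≤ 3 * (ε / 100) * n := by
    have h1 := Finset.card_union_le (Z ∪ T) W
    have h2 := Finset.card_union_le Z T
    have : ((Z ∪ T ∪ W).card : ℝ) ≤ Z.card + T.card + W.card := by
      exact_mod_cast h1.trans (by omega)
    linarith
  have hlow : ∀ A : Finset V, ((A.card : ℝ) - 3 * (ε / 100) * n) * ((1 / 2 + ε / 2) * d) ≤
      pairs Q (A ×ˢ Finset.univ) := by
    intro A
    refine le_trans (mul_le_mul_of_nonneg_right ?_ hq0) (le_pairs_of_le_deg hq0 A (Z ∪ T ∪ W) ?_)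
    · linarith
    · intro a _ hab
      simp only [Finset.mem_union, not_or] at hab
      exact hP.le_deg' a hab.1.2 hab.2 hab.1.1
  have hmnd : m = n * d / 2 := by linarith
  have hT : ∀ x ∈ X, (1 / 2 + ε / 4) * n ≤ (ends Γ₂ U x).card := by
    intro x hx
    set Y := ends Γ₁ U x with hY
    set S := ends Γ₂ U x with hS
    have hYn := hYbig x hx
    have h1 : (pairs Q (rotPairs Γ₁ U Sᶜ x) : ℝ) ≤ ε / 100 * m := by
      by_contra! hcon
      obtain ⟨⟨y, z⟩, hyz, hadj⟩ := hRhit (x, Sᶜ) hcon.le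
      have hyz' := (Finset.mem_filter.1 hyz).2
      obtain ⟨hy, t, ht, hzt⟩ := hyz'
      have hs := (pathOf_spec hy).mono hΓ₁₂
      obtain ⟨a, s, has⟩ := nxt_iff_exists.1 hzt
      rw [has] at hs
      have := hs.rotate ((le_sup_right : ΓR ≤ Γ₂) hadj)
      rw [Finset.mem_compl] at ht
      exact ht (mem_ends.2 ⟨_, this⟩)
    have h2 : (pairs Q (rotPairs Γ₁ U S x) : ℝ) ≤
        (2 * (Y.card * S.card) / n ^ 2 + ε / 100) * m := by
      have e1 : (pairs Q (rotPairs Γ₁ U S x) : ℝ) ≤ pairs G (rotPairs Γ₁ U S x) := by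
        exact_mod_cast pairs_mono_left hQG _
      have e2 := (hU Γ₁ (hΓ₁Q.trans hQG) (by linarith) U S).1 x
      refine e1.trans (e2.trans (mul_le_mul_of_nonneg_right ?_ hmpos.le))
      have e3 : ((rotPairs Γ₁ U S x).card : ℝ) ≤ Y.card * S.card := by
        exact_mod_cast card_rotPairs_le Γ₁ U S x
      rw [← hn]
      gcongr
    have h3 : pairs Q (Y ×ˢ Finset.univ) ≤
        pairs Q (rotPairs Γ₁ U S x) + pairs Q (rotPairs Γ₁ U Sᶜ x) := by
      refine le_trans (pairs_mono Q ?_) (pairs_union_le _ _ _)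
      rintro ⟨y, z⟩ hyz hadj
      simp only [Finset.mem_product, Finset.mem_univ, and_true] at hyz
      have hs := pathOf_spec hyz
      have hz : z ∈ U := hext x y _ (hs.mono hΓ₁Q) z hadj
      obtain ⟨t, ht⟩ := exists_nxt_of_ne_last hs.last ((hs.mem z).2 (by exact_mod_cast hz))
        (SimpleGraph.Adj.ne' hadj)
      simp only [Finset.mem_union, rotPairs, Finset.mem_filter, Finset.mem_univ, true_and]
      by_cases htS : t ∈ S
      · exact Or.inl ⟨hyz, t, htS, ht⟩
      · exact Or.inr ⟨hyz, t, Finset.mem_compl.2 htS, ht⟩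
    have h3' : (pairs Q (Y ×ˢ Finset.univ) : ℝ) ≤
        pairs Q (rotPairs Γ₁ U S x) + pairs Q (rotPairs Γ₁ U Sᶜ x) := by exact_mod_cast h3
    have h4 := hlow Y
    have h5 : 2 * ((Y.card : ℝ) * S.card) / n ^ 2 * m = Y.card * (S.card / n) * d := by
      rw [hmnd]
      field_simp
    have h6 : ((Y.card : ℝ) - 3 * (ε / 100) * n) * (1 / 2 + ε / 2) ≤
        Y.card * (S.card / n) + ε / 100 * n := by
      by_contra! hcon
      have e1 := mul_lt_mul_of_pos_right hcon hd
      have e2 : ε / 100 * m + ε / 100 * m = ε / 100 * n * d := by rw [hmnd]; ring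
      rw [add_mul] at h2
      linarith
    by_contra! hcon
    have h7 : (S.card : ℝ) / n < 1 / 2 + ε / 4 := by
      rw [div_lt_iff₀ hnpos]; exact hcon
    have hYpos : (0 : ℝ) < Y.card := by linarith
    have h8 := mul_lt_mul_of_pos_left h7 hYpos
    have h9 : 3 * (ε / 100) * n * (1 / 2 + ε / 2) ≤ 3 * (ε / 100) * n :=
      mul_le_of_le_one_right (by positivity) (by linarith)
    have h10 := mul_lt_mul_of_pos_left hYn hε
    have h11 := mul_pos hε hnpos
    linarith
  have h1 := hlow X
  have h2 : pairs Q (X ×ˢ Finset.univ) ≤ pairs G (openPairs Γ₂ U X) := by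
    refine le_trans (pairs_mono Q ?_) (pairs_mono_left hQG _)
    rintro ⟨x, w⟩ hxw hadj
    simp only [Finset.mem_product, Finset.mem_univ, and_true] at hxw
    simp only [openPairs, Finset.mem_filter, Finset.mem_univ, true_and]
    refine ⟨hxw, fun hw => ?_⟩
    obtain ⟨l, hl⟩ := mem_ends.1 hw
    exact hclose x w l (hl.mono hΓ₂Q) (SimpleGraph.Adj.symm hadj)
  have h2' : (pairs Q (X ×ˢ Finset.univ) : ℝ) ≤ pairs G (openPairs Γ₂ U X) := by
    exact_mod_cast h2
  have h3 := (hU Γ₂ (hΓ₂Q.trans hQG) hΓ₂card U X).2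
  have h4 := card_openPairs_le Γ₂ U X hT
  rw [← hn] at h3 h4
  have h5 : (2 * ((openPairs Γ₂ U X).card : ℝ) / n ^ 2 + ε / 100) * m ≤
      (2 * (X.card * (n - (1 / 2 + ε / 4) * n)) / n ^ 2 + ε / 100) * m := by
    gcongr
  have h6 : (2 * ((X.card : ℝ) * (n - (1 / 2 + ε / 4) * n)) / n ^ 2 + ε / 100) * m =
      (X.card * (1 / 2 - ε / 4) + ε / 100 * n / 2) * d := by
    rw [hmnd]
    field_simp
    ring
  have h7 : ((X.card : ℝ) - 3 * (ε / 100) * n) * (1 / 2 + ε / 2) ≤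
      X.card * (1 / 2 - ε / 4) + ε / 100 * n / 2 := by
    by_contra! hcon
    have e1 := mul_lt_mul_of_pos_right hcon hd
    linarith
  have h9 : 3 * (ε / 100) * n * (1 / 2 + ε / 2) ≤ 3 * (ε / 100) * n :=
    mul_le_of_le_one_right (by positivity) (by linarith)
  have h10 := mul_lt_mul_of_pos_left hXbig hε
  have h11 := mul_pos hε hnpos
  linarith

end Booster

section Closing
open scoped Classical

lemma isHam_of_walk {α : Type*} [Finite α] {G : SimpleGraph α} {x y : α} (p : G.Walk x y)
    (hp : p.IsPath) (hmem : ∀ v, v ∈ p.support) (hlen : 2 ≤ p.length) (hxy : G.Adj y x) :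
    IsHam G := by
  unfold IsHam
  intro _
  refine ⟨y, SimpleGraph.Walk.cons hxy p, ?_⟩
  rw [SimpleGraph.Walk.isHamiltonianCycle_isCycle_and_isHamiltonian_tail]
  refine ⟨(SimpleGraph.Walk.cons_isCycle_iff _ _).2 ⟨hp, ?_⟩, ?_⟩
  · intro he
    cases p with
    | nil => simp at hlen
    | @cons _ v _ h q =>
      rw [SimpleGraph.Walk.cons_isPath_iff] at hp
      rw [SimpleGraph.Walk.edges_cons, List.mem_cons] at he
      rcases he with he | he
      · have hv : y = v := by
          rcases Sym2.eq_iff.1 he with ⟨h1, -⟩ | ⟨h1, -⟩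
          · exact absurd h1.symm hxy.ne'
          · exact h1
        subst hv
        have := (SimpleGraph.Walk.isPath_iff_nil).1 hp.1
        rw [← SimpleGraph.Walk.length_eq_zero_iff] at this
        simp [this] at hlen
      · exact hp.2 (SimpleGraph.Walk.snd_mem_support_of_mem_edges _ he)
  · refine SimpleGraph.Walk.IsPath.isHamiltonian_of_mem ?_ ?_
    · simpa using hp
    · simpa using hmem

lemma isHam_of_spanPath {C : Set V} [Finite C] {K : SimpleGraph C} {Q : SimpleGraph V} {x y : V} {l : List V}
    (hQ : ∀ a b : C, Q.Adj a b → K.Adj a b)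
    (h : SpanPath Q C x y l) (hlen : 3 ≤ l.length) (hyx : Q.Adj y x) : IsHam K := by
  have hl : ∀ a ∈ l, a ∈ C := fun a ha => (h.mem a).1 ha
  have hne : l ≠ [] := by rintro rfl; simp at hlen
  have hx : l.head hne = x := by
    have := h.head; rw [List.head?_eq_some_head hne] at this; exact Option.some.inj this
  have hy : l.getLast hne = y := by
    have := h.last; rw [List.getLast?_eq_some_getLast hne] at this; exact Option.some.inj this
  set l' : List C := l.pmap Subtype.mk hl with hl'
  have hch : l'.IsChain K.Adj :=
    List.isChain_pmap_of_isChain (fun a b ha hb hab => hQ ⟨a, ha⟩ ⟨b, hb⟩ hab) h.chain hl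
  have hne' : l' ≠ [] := by simpa [hl'] using hne
  refine isHam_of_walk (SimpleGraph.Walk.ofSupport l' hne' hch) ?_ ?_ ?_ ?_
  · rw [SimpleGraph.Walk.isPath_def, SimpleGraph.Walk.support_ofSupport]
    exact h.nodup.pmap fun a _ b _ hab => congrArg Subtype.val hab
  · rintro ⟨v, hv⟩
    rw [SimpleGraph.Walk.support_ofSupport, List.mem_pmap]
    exact ⟨v, (h.mem v).2 hv, rfl⟩
  · rw [SimpleGraph.Walk.length_ofSupport, hl', List.length_pmap]
    omega
  · apply hQ
    have e1 : ((l'.getLast hne' : C) : V) = y := by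
      rw [← hy]; simp [hl', List.getLast_pmap]
    have e2 : ((l'.head hne' : C) : V) = x := by
      rw [← hx]; simp [hl', List.head_pmap]
    rw [e1, e2]
    exact hyx

end Closing

section Core
set_option linter.unusedSectionVars false
open scoped Classical
variable [Fintype V] [DecidableEq V]

lemma ncard_neighborSet_inter (G : SimpleGraph V) (S : Finset V) (v : V) :
    ((G.neighborSet v) ∩ (S : Set V)).ncard = (nb G v ∩ S).card := by
  rw [← Set.ncard_coe_finset]
  congr 1
  ext u
  simp

/-- The vertex set of the 2-core as a finset. -/
def core (G : SimpleGraph V) : Finset V := (coreSet G).toFinset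

@[simp] lemma coe_core (G : SimpleGraph V) : (core G : Set V) = coreSet G := by simp [core]

lemma mem_core {G : SimpleGraph V} {v : V} : v ∈ core G ↔ v ∈ coreSet G := by simp [core]

lemma two_le_core (G : SimpleGraph V) : ∀ a ∈ core G, 2 ≤ (nb G a ∩ core G).card := by
  intro a ha
  rw [mem_core] at ha
  obtain ⟨S, hS, haS⟩ := ha
  refine (hS a haS).trans ?_
  rw [← ncard_neighborSet_inter]
  refine Set.ncard_le_ncard ?_ (Set.toFinite _)
  refine Set.inter_subset_inter_right _ ?_
  rw [coe_core]
  exact Set.subset_sUnion_of_mem hS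

lemma subset_core {G : SimpleGraph V} {S : Finset V} (h : ∀ a ∈ S, 2 ≤ (nb G a ∩ S).card) :
    S ⊆ core G := by
  intro a ha
  rw [mem_core]
  refine ⟨S, fun v hv => ?_, ha⟩
  rw [ncard_neighborSet_inter]
  exact h v hv

/-- A graph on the 2-core regarded as a graph on all vertices. -/
def lift (G : SimpleGraph V) (K : SimpleGraph (coreSet G)) : SimpleGraph V :=
  K.map (Function.Embedding.subtype _)

lemma lift_adj {G : SimpleGraph V} {K : SimpleGraph (coreSet G)} {a b : V} :
    (lift G K).Adj a b ↔ ∃ (ha : a ∈ coreSet G) (hb : b ∈ coreSet G), K.Adj ⟨a, ha⟩ ⟨b, hb⟩ := by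
  rw [lift, SimpleGraph.map_adj]
  constructor
  · rintro ⟨⟨u, hu⟩, ⟨v, hv⟩, h, rfl, rfl⟩
    exact ⟨hu, hv, h⟩
  · rintro ⟨ha, hb, h⟩
    exact ⟨_, _, h, rfl, rfl⟩

lemma deg_eq_card {G : SimpleGraph V} {K : SimpleGraph (coreSet G)} (v : coreSet G) :
    deg K v = (nb (lift G K) v).card := by
  unfold deg
  rw [← Set.ncard_coe_finset, ← Set.ncard_image_of_injective _ Subtype.val_injective]
  congr 1
  ext u
  simp only [Set.mem_image, SimpleGraph.mem_neighborSet, Finset.mem_coe, mem_nb, lift_adj]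
  constructor
  · rintro ⟨⟨w, hw⟩, h, rfl⟩
    exact ⟨v.2, hw, h⟩
  · rintro ⟨_, hu, h⟩
    exact ⟨⟨u, hu⟩, h, rfl⟩

lemma nb_lift_twoCore {G : SimpleGraph V} {a : V} (ha : a ∈ core G) :
    nb (lift G (twoCore G)) a = nb G a ∩ core G := by
  rw [mem_core] at ha
  ext b
  simp [lift_adj, twoCore, ha, mem_core, and_comm]

lemma le_deg_lift_sdiff {G : SimpleGraph V} {H : SimpleGraph (coreSet G)} {ε : ℝ}
    (hH : ∀ v, (deg H v : ℝ) ≤ (1 / 2 - ε) * (deg (twoCore G) v : ℝ)) :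
    ∀ a ∈ core G, (1 / 2 + ε) * ((nb G a ∩ core G).card : ℝ) ≤
      (nb (lift G (twoCore G \ H)) a).card := by
  intro a ha
  have h1 := hH ⟨a, mem_core.1 ha⟩
  rw [deg_eq_card, deg_eq_card, nb_lift_twoCore ha] at h1
  have h2 : nb G a ∩ core G ⊆ nb (lift G (twoCore G \ H)) a ∪ nb (lift G H) a := by
    rw [← nb_lift_twoCore ha]
    intro b hb
    rw [mem_nb, lift_adj] at hb
    obtain ⟨ha', hb', hab⟩ := hb
    rw [Finset.mem_union, mem_nb, mem_nb, lift_adj, lift_adj]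
    by_cases h : H.Adj ⟨a, ha'⟩ ⟨b, hb'⟩
    · exact Or.inr ⟨ha', hb', h⟩
    · exact Or.inl ⟨ha', hb', hab, h⟩
  have h3 := (Finset.card_le_card h2).trans (Finset.card_union_le _ _)
  have h4 : ((nb G a ∩ core G).card : ℝ) ≤
    (nb (lift G (twoCore G \ H)) a).card + (nb (lift G H) a).card := by exact_mod_cast h3
  linarith

lemma card_low_degree {G : SimpleGraph V} {n m d τ η : ℝ} (hn : n = Fintype.card V) (hn0 : 0 < n)
    (hm : 2 * m = n * d) (hd : 0 < d) (hG : (pairs G Finset.univ : ℝ) = 2 * m)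
    (hunif : ∀ A B : Finset V, (pairs G (A ×ˢ B) : ℝ) ≤
      (2 * (A.card * B.card) / n ^ 2 + τ) * m) :
    ((Finset.univ.filter fun a => ((nb G a).card : ℝ) < (1 - η) * d).card : ℝ) * (2 * η) ≤
      τ * n := by
  set Z := Finset.univ.filter fun a => ((nb G a).card : ℝ) < (1 - η) * d with hZ
  have h1 : pairs G (Z ×ˢ Finset.univ) + pairs G (Zᶜ ×ˢ Finset.univ) = pairs G Finset.univ := by
    rw [← Finset.univ_product_univ, pairs_prod, pairs_prod, pairs_prod,
      Finset.sum_add_sum_compl]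
  have h2 := hunif Zᶜ Finset.univ
  have h3 : (pairs G (Z ×ˢ Finset.univ) : ℝ) ≤ Z.card * ((1 - η) * d) := by
    rw [pairs_prod]
    push_cast
    rw [← nsmul_eq_mul]
    apply Finset.sum_le_card_nsmul
    intro a ha
    exact (Finset.mem_filter.1 ha).2.le
  have h4 : ((Zᶜ : Finset V).card : ℝ) = n - Z.card := by
    rw [Finset.card_compl, Nat.cast_sub (Finset.card_le_univ _), hn]
  have h5 : (pairs G (Z ×ˢ Finset.univ) : ℝ) + pairs G (Zᶜ ×ˢ Finset.univ) = 2 * m := by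
    rw [← hG]; exact_mod_cast h1
  rw [h4, Finset.card_univ, ← hn] at h2
  have h6 : (2 * ((n - Z.card) * n) / n ^ 2 + τ) * m = (n - Z.card) * d + τ * n * d / 2 := by
    have : m = n * d / 2 := by linarith
    rw [this]
    field_simp
  rw [h6] at h2
  have h7 : (Z.card : ℝ) * (2 * η) * d ≤ τ * n * d := by linarith
  exact le_of_mul_le_mul_right h7 hd

lemma resilient_of_uniform {G : SimpleGraph V} {T : Finset V} {n m d ε δ η c γ τ₂ τ₃ κ : ℝ}
    {k r : ℕ} (hε : 0 < ε) (hε' : ε ≤ 1 / 10) (hη : η ≤ ε / 100) (hη0 : 0 < η) (hδd : 8 ≤ δ * d)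
    (hεd : 10 ≤ ε * d) (hs : Sparse G T) (hT : ∀ a, a ∉ T → δ * d ≤ (nb G a).card)
    (hTn : (T.card : ℝ) ≤ η * n) (hn : n = Fintype.card V) (hn0 : 0 < n)
    (hm : 2 * m = n * d) (hG : (pairs G Finset.univ : ℝ) = 2 * m)
    (hk2 : 2 ≤ k) (hkp : (k : ℝ) ≤ δ * d / 4) (hkγ : 13 * γ * d < k) (hγ : 0 ≤ γ)
    (hloc : ∀ B : Finset V, (B.card : ℝ) ≤ c * n → (pairs G (B ×ˢ B) : ℝ) ≤ γ * d * B.card)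
    (hunif : ∀ A B : Finset V, (pairs G (A ×ˢ B) : ℝ) ≤
      (2 * (A.card * B.card) / n ^ 2 + τ₂) * m)
    (hc : 0 < c) (hτ₃0 : 0 < τ₃) (hτ₃1 : τ₃ ≤ 1)
    (hτ₃ : τ₃ ≤ c / 13 * ε / 4) (hτ₂ : τ₂ ≤ c / 13 * ε / 8)
    (hτη : τ₂ ≤ 2 * η * (c / 13 * ε / 8)) (hτη' : τ₂ ≤ 2 * η * (ε / 100))
    (hr₃ : (4 : ℝ) ^ Fintype.card V * (1 - τ₃ / 2) ^ r < 1)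
    (hr : (4 : ℝ) ^ Fintype.card V * (1 - ε / 100 / 2) ^ r < 1)
    (hsize : 2 * (n * k) + 2 * r + 2 * n + 2 * r ≤ 2 * κ * m)
    (hU : PathUniform G κ (ε / 100) m) : Resilient (twoCore G) (1 / 2 - ε) IsHam := by
  intro H hH hdegH
  have hd : 0 < d := by
    by_contra hd
    have : ε * d ≤ 0 := mul_nonpos_of_nonneg_of_nonpos hε.le (not_lt.1 hd)
    linarith
  set Z := Finset.univ.filter fun a => ((nb G a).card : ℝ) < (1 - η) * d with hZdef
  have hZ := card_low_degree (η := η) hn hn0 hm hd hG hunif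
  have hZle : ∀ t : ℝ, τ₂ ≤ 2 * η * t → (Z.card : ℝ) ≤ t * n := by
    intro t ht
    have h1 : τ₂ * n ≤ 2 * η * t * n := mul_le_mul_of_nonneg_right ht hn0.le
    have h2 : (Z.card : ℝ) * (2 * η) ≤ t * n * (2 * η) := by linarith
    exact le_of_mul_le_mul_right h2 (by linarith)
  have hTC : ∀ a, a ∉ T → a ∈ core G := by
    intro a ha
    refine subset_core (S := Tᶜ) ?_ (by simpa using ha)
    intro b hb
    have hb : b ∉ T := by simpa using hb
    have h1 : nb G b ⊆ (nb G b ∩ Tᶜ) ∪ (T ∩ nb G b) := by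
      intro u hu
      by_cases huT : u ∈ T <;> simp [hu, huT]
    have h2 := (Finset.card_le_card h1).trans (Finset.card_union_le _ _)
    have h3 := hs.card_tiny_nb b
    have h4 : (8 : ℝ) ≤ (nb G b).card := hδd.trans (hT b hb)
    have h5 : 8 ≤ (nb G b).card := by exact_mod_cast h4
    omega
  have hP := pruned_of_sparse (G' := lift G (twoCore G \ H)) (C := core G) (Z := Z) hε hε' hη hη0
    hδd hεd hs
    (fun a b hab => by
      obtain ⟨ha, hb, h⟩ := lift_adj.1 hab
      exact h.1)
    (fun a b hab => by
      obtain ⟨ha, hb, h⟩ := lift_adj.1 hab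
      exact mem_core.2 ha)
    (two_le_core G) hTC (le_deg_lift_sdiff hdegH) hT (by
      intro a ha
      by_contra h
      exact ha (by simpa [hZdef] using h))
  have hCne : (core G).Nonempty := by
    by_contra hCe
    have hall : ∀ a : V, a ∈ T := by
      intro a
      by_contra ha
      exact hCe ⟨a, hTC a ha⟩
    have h1 : T.card = Fintype.card V := by
      rw [Finset.eq_univ_of_forall hall, Finset.card_univ]
    rw [h1, ← hn] at hTn
    have h2 : η * n < 1 * n := mul_lt_mul_of_pos_right (by linarith) hn0
    linarith
  have hQG : prune (lift G (twoCore G \ H)) T (wide (lift G (twoCore G \ H)) T) ≤ G := by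
    intro a b hab
    obtain ⟨ha, hb, h⟩ := lift_adj.1 hab.1
    exact h.1
  have hWcard := hP.card_wide
  have hWn : ((wide (lift G (twoCore G \ H)) T).card : ℝ) ≤ T.card := by exact_mod_cast hWcard
  obtain ⟨x, y, l, hl, hlen, hyx⟩ := exists_ham_list hP hQG hCne hn hm hd hε hε' hG.le hk2 hkp hkγ
    hγ hloc hunif hc hτ₃0 hτ₃1 hτ₃ hτ₂ (hZle _ hτη) (by
      have h1 := hZle _ hτη'
      have h2 : η * n ≤ ε / 100 * n := mul_le_mul_of_nonneg_right hη hn0.le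
      linarith) hr₃ hr hsize hU
  rw [coe_core] at hl
  exact isHam_of_spanPath (fun a b hab => by
    obtain ⟨ha, hb, h⟩ := lift_adj.1 hab.1
    exact h) hl hlen hyx

end Core

section Constants
set_option linter.unusedSectionVars false
open scoped Classical

lemma exists_pow_lt {τ : ℝ} (hτ0 : 0 < τ) (hτ1 : τ ≤ 1) :
    ∃ R₀ : ℕ, ∀ R ≥ R₀, ∀ n : ℕ, 0 < n → (4 : ℝ) ^ n * (1 - τ / 2) ^ (R * n) < 1 := by
  obtain ⟨R₀, hR₀⟩ := exists_pow_lt_of_lt_one (by norm_num : (0 : ℝ) < 1 / 4)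
    (by linarith : 1 - τ / 2 < 1)
  refine ⟨R₀, fun R hR n hn => ?_⟩
  have h1 : (1 - τ / 2) ^ R ≤ (1 - τ / 2) ^ R₀ :=
    pow_le_pow_of_le_one (by linarith) (by linarith) hR
  rw [pow_mul, ← mul_pow]
  refine pow_lt_one₀ ?_ ?_ hn.ne'
  · have : 0 ≤ (1 - τ / 2) ^ R := pow_nonneg (by linarith) _
    linarith
  · linarith

/-- The constants in the Hamiltonicity criterion can be chosen consistently. -/
lemma exists_constants {ε δ κ : ℝ} (hε : 0 < ε) (hε' : ε ≤ 1 / 10) (hδ : 0 < δ) (hκ : 0 < κ) :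
    ∃ γ : ℝ, 0 < γ ∧ ∀ c : ℝ, 0 < c → ∃ τ₂ : ℝ, 0 < τ₂ ∧ τ₂ ≤ ε / 100 ∧ ∃ D₀ : ℝ, ∀ (n : ℕ)
      (G : SimpleGraph (Fin n)) (T : Finset (Fin n)) (m d : ℝ), 0 < n → 2 * m = n * d → D₀ ≤ d →
      Sparse G T → (∀ a, a ∉ T → δ * d ≤ (nb G a).card) → (T.card : ℝ) ≤ ε / 100 * n →
      (pairs G Finset.univ : ℝ) = 2 * m →
      (∀ B : Finset (Fin n), (B.card : ℝ) ≤ c * n → (pairs G (B ×ˢ B) : ℝ) ≤ γ * d * B.card) →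
      (∀ A B : Finset (Fin n), (pairs G (A ×ˢ B) : ℝ) ≤
        (2 * (A.card * B.card) / (n : ℝ) ^ 2 + τ₂) * m) →
      PathUniform G κ (ε / 100) m → Resilient (twoCore G) (1 / 2 - ε) IsHam := by
  set κ' := min κ δ / 16 with hκ'
  have hκ'0 : 0 < κ' := by positivity
  have hκ'κ : κ' ≤ κ / 16 := by have := min_le_left κ δ; rw [hκ']; linarith
  have hκ'δ : κ' ≤ δ / 16 := by have := min_le_right κ δ; rw [hκ']; linarith
  refine ⟨κ' / 14, by positivity, fun c₀ hc₀ => ?_⟩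
  set c := min c₀ 1 with hcdef
  have hc : 0 < c := lt_min hc₀ one_pos
  have hc1 : c ≤ 1 := min_le_right _ _
  set τ₃ := c / 13 * ε / 4 with hτ₃
  have hτ₃0 : 0 < τ₃ := by positivity
  have hτ₃1 : τ₃ ≤ 1 := by
    have : c * ε ≤ 1 * 1 := mul_le_mul hc1 (by linarith) hε.le one_pos.le
    rw [hτ₃]; linarith
  have hη1 : 2 * (ε / 100) ≤ 1 := by linarith
  set b := c / 13 * ε / 8 with hb
  have hb0 : 0 < b := by positivity
  set τ₂ := min (2 * (ε / 100) * b) (2 * (ε / 100) * (ε / 100)) with hτ₂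
  have hτ₂b : τ₂ ≤ 2 * (ε / 100) * b := min_le_left _ _
  have hτ₂ε : τ₂ ≤ 2 * (ε / 100) * (ε / 100) := min_le_right _ _
  obtain ⟨R₁, hR₁⟩ := exists_pow_lt hτ₃0 hτ₃1
  obtain ⟨R₂, hR₂⟩ := exists_pow_lt (by positivity : 0 < ε / 100) (by linarith)
  set R := max R₁ R₂ with hR
  refine ⟨τ₂, by positivity, ?_, ?_⟩
  · have : 2 * (ε / 100) * (ε / 100) ≤ 1 * (ε / 100) :=
      mul_le_mul_of_nonneg_right hη1 (by positivity)
    linarith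
  refine ⟨max (max (8 / δ) (10 / ε)) (max (2 / κ') ((4 + 4 * R) / (κ / 2))), ?_⟩
  intro n G T m d hn0 hm hD hs hT hTn hG hloc hunif hU
  have hd1 : 8 ≤ δ * d := by
    rw [mul_comm]; exact (div_le_iff₀ hδ).1 (((le_max_left _ _).trans (le_max_left _ _)).trans hD)
  have hd2 : 10 ≤ ε * d := by
    rw [mul_comm]; exact (div_le_iff₀ hε).1 (((le_max_right _ _).trans (le_max_left _ _)).trans hD)
  have hd3 : 2 ≤ κ' * d := by
    rw [mul_comm]
    exact (div_le_iff₀ hκ'0).1 (((le_max_left _ _).trans (le_max_right _ _)).trans hD)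
  have hd4 : 4 + 4 * (R : ℝ) ≤ κ / 2 * d := by
    rw [mul_comm (κ / 2)]
    exact (div_le_iff₀ (by positivity)).1 (((le_max_right _ _).trans (le_max_right _ _)).trans hD)
  have hd : 0 < d := by
    by_contra h
    have : ε * d ≤ 0 := mul_nonpos_of_nonneg_of_nonpos hε.le (not_lt.1 h)
    linarith
  have hk1 : κ' * d ≤ (⌈κ' * d⌉₊ : ℝ) := Nat.le_ceil _
  have hk2 : (⌈κ' * d⌉₊ : ℝ) < κ' * d + 1 := Nat.ceil_lt_add_one (by positivity)
  have hn0' : (0 : ℝ) < n := by exact_mod_cast hn0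
  have hκd : κ' * d ≤ κ / 16 * d := mul_le_mul_of_nonneg_right hκ'κ hd.le
  have hδd : κ' * d ≤ δ / 16 * d := mul_le_mul_of_nonneg_right hκ'δ hd.le
  refine resilient_of_uniform (T := T) (n := n) (m := m) (d := d) (η := ε / 100) (c := c)
    (γ := κ' / 14) (τ₂ := τ₂) (τ₃ := τ₃) (κ := κ) (δ := δ) (k := ⌈κ' * d⌉₊) (r := R * n)
    hε hε' le_rfl (by positivity) hd1 hd2 hs hT hTn (by simp) hn0' hm hG ?_ ?_ ?_ (by positivity) ?_
    hunif hc hτ₃0 hτ₃1 le_rfl ?_ hτ₂b hτ₂ε ?_ ?_ ?_ hU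
  · have : (2 : ℝ) ≤ (⌈κ' * d⌉₊ : ℝ) := hd3.trans hk1
    exact_mod_cast this
  · linarith
  · have : 0 < κ' * d := by positivity
    linarith
  · intro B hB
    refine hloc B (hB.trans (mul_le_mul_of_nonneg_right (min_le_left _ _) hn0'.le))
  · have : 2 * (ε / 100) * b ≤ 1 * b := mul_le_mul_of_nonneg_right hη1 hb0.le
    linarith
  · rw [Fintype.card_fin]; exact hR₁ R (le_max_left _ _) n hn0
  · rw [Fintype.card_fin]; exact hR₂ R (le_max_right _ _) n hn0
  · push_cast
    have h1 : 2 * κ * m = n * (κ * d) := by linear_combination κ * hm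
    rw [h1]
    have h2 : 2 * (⌈κ' * d⌉₊ : ℝ) + 4 * R + 2 ≤ κ * d := by
      have : 0 < κ * d := by positivity
      linarith
    have h3 := mul_le_mul_of_nonneg_left h2 hn0'.le
    linarith

end Constants

section Permutations
open scoped Classical
set_option linter.unusedSectionVars false
variable {ι : Type*} [Fintype ι] [DecidableEq ι]

/-- The permutations of `ι` moving only elements of `A`. -/
def permsOn (A : Finset ι) : Finset (Equiv.Perm ι) := Finset.univ.filter fun π => ∀ i, i ∉ A → π i = i

/-- The permutations in `permsOn A` mapping `J` into `Q`. -/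
def permsInto (A Q J : Finset ι) : Finset (Equiv.Perm ι) :=
  (permsOn A).filter fun π => ∀ j ∈ J, π j ∈ Q

lemma permsOn_mem_iff {A : Finset ι} {π : Equiv.Perm ι} (hπ : π ∈ permsOn A) (i : ι) :
    π i ∈ A ↔ i ∈ A := by
  have h : ∀ i, i ∉ A → π i = i := (Finset.mem_filter.1 hπ).2
  constructor
  · intro hi
    by_contra hiA
    exact hiA (h i hiA ▸ hi)
  · intro hi
    by_contra hiA
    have h1 := h _ hiA
    rw [π.injective h1] at hiA
    exact hiA hi

lemma card_permsOn_pos (A : Finset ι) : 0 < (permsOn A).card :=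
  Finset.card_pos.2 ⟨1, by simp [permsOn]⟩

lemma card_permsInto_insert (A Q J : Finset ι) {a b : ι} (ha : a ∈ A) (hb : b ∈ A)
    (haJ : a ∉ J) (hbJ : b ∉ J) :
    (permsInto A Q (insert a J)).card ≤ (permsInto A Q (insert b J)).card := by
  refine Finset.card_le_card_of_injOn (fun π => π * Equiv.swap a b) ?_
    (fun π _ π' _ h => mul_right_cancel h)
  intro π hπ
  simp only [permsInto, permsOn, Finset.coe_filter, Finset.mem_filter, Finset.mem_univ, true_and,
    Set.mem_ofPred_eq, Finset.mem_insert, forall_eq_or_imp, Equiv.Perm.mul_apply] at hπ ⊢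
  refine ⟨fun i hi => ?_, ?_, fun j hj => ?_⟩
  · rw [Equiv.swap_apply_of_ne_of_ne (by rintro rfl; exact hi ha) (by rintro rfl; exact hi hb)]
    exact hπ.1 i hi
  · rw [Equiv.swap_apply_right]; exact hπ.2.1
  · rw [Equiv.swap_apply_of_ne_of_ne (by rintro rfl; exact haJ hj) (by rintro rfl; exact hbJ hj)]
    exact hπ.2.2 j hj

lemma sum_card_permsInto_insert {A Q J : Finset ι} (hQ : Q ⊆ A) :
    ∑ a ∈ A \ J, (permsInto A Q (insert a J)).card =
      (permsInto A Q J).card * (Q.card - J.card) := by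
  have h1 : ∀ a, (permsInto A Q (insert a J)).card =
      ∑ π ∈ permsInto A Q J, if π a ∈ Q then 1 else 0 := by
    intro a
    rw [← Finset.card_filter]
    congr 1
    ext π
    simp only [permsInto, Finset.mem_filter, Finset.mem_insert, forall_eq_or_imp]
    tauto
  simp_rw [h1]
  rw [Finset.sum_comm, Finset.card_eq_sum_ones (permsInto A Q J), Finset.sum_mul]
  refine Finset.sum_congr rfl fun π hπ => ?_
  rw [← Finset.card_filter, one_mul]
  have hπA : π ∈ permsOn A := (Finset.mem_filter.1 hπ).1
  have hπJ : ∀ j ∈ J, π j ∈ Q := (Finset.mem_filter.1 hπ).2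
  have h2 : (A \ J).filter (fun a => π a ∈ Q) = (Q.map π.symm.toEmbedding) \ J := by
    ext a
    simp only [Finset.mem_filter, Finset.mem_sdiff, Finset.mem_map_equiv, Equiv.symm_symm]
    constructor
    · tauto
    · rintro ⟨h, h'⟩
      exact ⟨⟨(permsOn_mem_iff hπA a).1 (hQ h), h'⟩, h⟩
  rw [h2, Finset.card_sdiff_of_subset, Finset.card_map]
  intro j hj
  simpa using hπJ j hj

lemma card_permsInto_le {A Q : Finset ι} (hQ : Q ⊆ A) (J : Finset ι) (hJ : J ⊆ A) :
    (permsInto A Q J).card * A.card ^ J.card ≤ (permsOn A).card * Q.card ^ J.card := by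
  induction J using Finset.induction_on with
  | empty =>
    simp only [Finset.card_empty, pow_zero, mul_one]
    exact Finset.card_le_card (Finset.filter_subset _ _)
  | insert a J haJ ih =>
    have haA : a ∈ A := hJ (Finset.mem_insert_self a J)
    have hJA : J ⊆ A := (Finset.subset_insert a J).trans hJ
    have ih := ih hJA
    rw [Finset.card_insert_of_notMem haJ]
    have h1 : (A.card - J.card) * (permsInto A Q (insert a J)).card ≤
        (permsInto A Q J).card * (Q.card - J.card) := by
      rw [← sum_card_permsInto_insert hQ, ← Finset.card_sdiff_of_subset hJA, ← smul_eq_mul]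
      apply Finset.card_nsmul_le_sum
      intro b hb
      rw [Finset.mem_sdiff] at hb
      exact card_permsInto_insert A Q J haA hb.1 haJ hb.2
    have hlt : J.card < A.card := by
      have := Finset.card_le_card hJ
      rw [Finset.card_insert_of_notMem haJ] at this
      omega
    have hQA := Finset.card_le_card hQ
    have h2 : (permsInto A Q (insert a J)).card * A.card ≤ (permsInto A Q J).card * Q.card := by
      by_cases hQJ : Q.card ≤ J.card
      · rw [Nat.sub_eq_zero_of_le hQJ, mul_zero] at h1
        have : (permsInto A Q (insert a J)).card = 0 := by
          rcases Nat.mul_eq_zero.1 (Nat.le_zero.1 h1) with h | h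
          · omega
          · exact h
        simp [this]
      · obtain ⟨s, hs⟩ := Nat.exists_eq_add_of_lt hlt
        obtain ⟨t, ht⟩ := Nat.exists_eq_add_of_lt (not_le.1 hQJ)
        have e1 : A.card - J.card = s + 1 := by omega
        have e2 : Q.card - J.card = t + 1 := by omega
        rw [e1, e2] at h1
        have hts : t ≤ s := by omega
        rw [hs, ht]
        set x := (permsInto A Q (insert a J)).card
        set y := (permsInto A Q J).card
        have hxy : x ≤ y := by
          by_contra h
          have : y * (t + 1) < (s + 1) * x := by
            calc y * (t + 1) ≤ y * (s + 1) := Nat.mul_le_mul_left _ (by omega)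
              _ < x * (s + 1) := Nat.mul_lt_mul_of_pos_right (by omega) (by omega)
              _ = _ := mul_comm _ _
          omega
        have := Nat.mul_le_mul_right J.card hxy
        calc x * (J.card + s + 1) = (s + 1) * x + x * J.card := by ring
          _ ≤ y * (t + 1) + y * J.card := Nat.add_le_add h1 this
          _ = _ := by ring
    calc _ = (permsInto A Q (insert a J)).card * A.card * A.card ^ J.card := by ring
      _ ≤ (permsInto A Q J).card * Q.card * A.card ^ J.card := Nat.mul_le_mul_right _ h2
      _ = (permsInto A Q J).card * A.card ^ J.card * Q.card := by ring
      _ ≤ (permsOn A).card * Q.card ^ J.card * Q.card := Nat.mul_le_mul_right _ ih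
      _ = _ := by ring

lemma card_permsInto_le' {A Q J : Finset ι} (hA : A.Nonempty) (hQ : Q ⊆ A) (hJ : J ⊆ A) :
    ((permsInto A Q J).card : ℝ) ≤ (permsOn A).card * ((Q.card : ℝ) / A.card) ^ J.card := by
  have h := card_permsInto_le hQ J hJ
  have hA' : (0 : ℝ) < (A.card : ℝ) ^ J.card := by
    have : (0 : ℝ) < A.card := by exact_mod_cast hA.card_pos
    positivity
  rw [div_pow, ← mul_div_assoc, le_div_iff₀ hA']
  exact_mod_cast h

/-- Exponential moments for the image of a set under a random permutation. -/
lemma sum_permsInto_pow_le {A Q J K : Finset ι} (hA : A.Nonempty) (hQ : Q ⊆ A) (hJ : J ⊆ A)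
    (hK : K ⊆ A) (hJK : Disjoint J K) {t : ℝ} (ht : 0 ≤ t) :
    ∑ π ∈ permsInto A Q J, (1 + t) ^ (K.filter fun k => π k ∈ Q).card ≤
      (permsOn A).card * (((Q.card : ℝ) / A.card) ^ J.card *
        (1 + t * ((Q.card : ℝ) / A.card)) ^ K.card) := by
  set q := (Q.card : ℝ) / A.card with hq
  have h1 : ∀ π : Equiv.Perm ι, (1 + t) ^ (K.filter fun k => π k ∈ Q).card =
      ∑ S ∈ K.powerset, if (∀ k ∈ S, π k ∈ Q) then t ^ S.card else 0 := by
    intro π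
    have : (1 + t) ^ (K.filter fun k => π k ∈ Q).card =
        ∏ k ∈ K, (1 + if π k ∈ Q then t else 0) := by
      rw [← Finset.prod_const, Finset.prod_filter]
      refine Finset.prod_congr rfl fun k _ => ?_
      split_ifs <;> simp
    rw [this, Finset.prod_one_add]
    refine Finset.sum_congr rfl fun S _ => ?_
    by_cases h : ∀ k ∈ S, π k ∈ Q
    · rw [if_pos h, Finset.prod_congr rfl (fun k hk => if_pos (h k hk)), Finset.prod_const]
    · rw [if_neg h]
      push Not at h
      obtain ⟨k, hk, hkQ⟩ := h
      exact Finset.prod_eq_zero hk (if_neg hkQ)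
  simp_rw [h1]
  rw [Finset.sum_comm]
  have h2 : (1 + t * q) ^ K.card = ∑ S ∈ K.powerset, (t * q) ^ S.card := by
    rw [← Finset.prod_const, Finset.prod_one_add]
    exact Finset.sum_congr rfl fun S _ => Finset.prod_const _
  rw [h2, Finset.mul_sum, Finset.mul_sum]
  refine Finset.sum_le_sum fun S hS => ?_
  rw [Finset.mem_powerset] at hS
  rw [← Finset.sum_filter]
  have h3 : (permsInto A Q J).filter (fun π => ∀ k ∈ S, π k ∈ Q) = permsInto A Q (J ∪ S) := by
    ext π
    simp only [permsInto, Finset.mem_filter, Finset.mem_union, or_imp, forall_and]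
    tauto
  rw [h3, Finset.sum_const, nsmul_eq_mul]
  have h4 := card_permsInto_le' hA hQ (Finset.union_subset hJ (hS.trans hK))
  rw [Finset.card_union_of_disjoint (Finset.disjoint_of_subset_right hS hJK), ← hq] at h4
  have h5 := mul_le_mul_of_nonneg_right h4 (pow_nonneg ht S.card)
  refine h5.trans (le_of_eq ?_)
  rw [pow_add, mul_pow]
  ring

lemma sum_permsOn_pow_le {A Q K : Finset ι} (hA : A.Nonempty) (hQ : Q ⊆ A) (hK : K ⊆ A)
    {θ : ℝ} (hθ : 0 < θ) (hθ1 : θ ≤ 1) :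
    ∑ π ∈ permsOn A, θ ^ (K.filter fun k => π k ∈ Q).card ≤
      (permsOn A).card * Real.exp (-((1 - θ) * ((Q.card : ℝ) / A.card) * K.card)) := by
  have hA0 : (0 : ℝ) < A.card := by exact_mod_cast hA.card_pos
  set q := (Q.card : ℝ) / A.card with hq
  set t := (1 - θ) / θ with ht
  have ht0 : 0 ≤ t := div_nonneg (by linarith) hθ.le
  have htθ : 1 + t = θ⁻¹ := by rw [ht]; field_simp; ring
  have h := sum_permsInto_pow_le (J := ∅) hA (Finset.sdiff_subset : A \ Q ⊆ A) (by simp) hK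
    (by simp) ht0
  have e0 : permsInto A (A \ Q) ∅ = permsOn A := by simp [permsInto]
  have e1 : ((A \ Q).card : ℝ) / A.card = 1 - q := by
    rw [Finset.card_sdiff_of_subset hQ, Nat.cast_sub (Finset.card_le_card hQ), sub_div,
      div_self hA0.ne']
  rw [e0, e1, Finset.card_empty, pow_zero, one_mul] at h
  have h2 : ∀ π ∈ permsOn A, θ ^ (K.filter fun k => π k ∈ Q).card =
      θ ^ K.card * (1 + t) ^ (K.filter fun k => π k ∈ A \ Q).card := by
    intro π hπ
    have h3 : (K.filter fun k => π k ∈ A \ Q) = K.filter fun k => ¬ π k ∈ Q := by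
      refine Finset.filter_congr fun k hk => ?_
      rw [Finset.mem_sdiff, permsOn_mem_iff hπ]
      simp [hK hk]
    have h4 := Finset.card_filter_add_card_filter_not (s := K) (fun k => π k ∈ Q)
    rw [h3, htθ, ← h4, pow_add, mul_assoc, ← mul_pow, mul_inv_cancel₀ hθ.ne', one_pow, mul_one]
  rw [Finset.sum_congr rfl h2, ← Finset.mul_sum]
  refine (mul_le_mul_of_nonneg_left h (pow_nonneg hθ.le _)).trans ?_
  rw [mul_left_comm, ← mul_pow]
  refine mul_le_mul_of_nonneg_left ?_ (Nat.cast_nonneg _)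
  have h5 : θ * (1 + t * (1 - q)) = 1 - (1 - θ) * q := by
    rw [ht]; field_simp; ring
  rw [h5]
  have h6 : 1 - (1 - θ) * q ≤ Real.exp (-((1 - θ) * q)) := by
    have := Real.add_one_le_exp (-((1 - θ) * q)); linarith
  have hq1 : q ≤ 1 := by
    rw [hq, div_le_one hA0]; exact_mod_cast Finset.card_le_card hQ
  have h7 : 0 ≤ 1 - (1 - θ) * q := by
    have : (1 - θ) * q ≤ (1 - θ) * 1 := mul_le_mul_of_nonneg_left hq1 (by linarith)
    linarith
  refine (pow_le_pow_left₀ h7 h6 _).trans (le_of_eq ?_)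
  rw [← Real.exp_nat_mul]
  congr 1
  ring

end Permutations

section Averages
open scoped Classical

/-- The number of potential edges. -/
abbrev numEdges (n : ℕ) : ℕ := Fintype.card (EdgeType n)

/-- The first `m` edges of the process. -/
def firstEdges {n : ℕ} (σ : ProcessSpace n) (m : ℕ) : Finset (EdgeType n) :=
  Finset.univ.filter fun e => ((σ.symm e : Fin _) : ℕ) < m

/-- The average of a function over the orderings of the edges. -/
def avg {n : ℕ} (f : ProcessSpace n → ℝ) : ℝ := (∑ σ, f σ) / Fintype.card (ProcessSpace n)

/-- The probability of an event of the process. -/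
def pr {n : ℕ} (P : ProcessSpace n → Prop) : ℝ := avg fun σ => if P σ then 1 else 0

variable {n : ℕ}

@[simp] lemma mem_firstEdges {σ : ProcessSpace n} {m : ℕ} {e : EdgeType n} :
    e ∈ firstEdges σ m ↔ ((σ.symm e : Fin _) : ℕ) < m := by simp [firstEdges]

lemma firstEdges_mono (σ : ProcessSpace n) {m m' : ℕ} (h : m ≤ m') :
    firstEdges σ m ⊆ firstEdges σ m' := by
  intro e; rw [mem_firstEdges, mem_firstEdges]; omega

lemma card_firstEdges (σ : ProcessSpace n) {m : ℕ} (hm : m ≤ numEdges n) :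
    (firstEdges σ m).card = m := by
  have h : firstEdges σ m = (Finset.univ.filter fun i : Fin (numEdges n) => (i : ℕ) < m).map
      σ.toEmbedding := by
    ext e
    simp [Finset.mem_map_equiv]
  rw [h, Finset.card_map, Fin.card_filter_val_lt, min_eq_right hm]

lemma card_processSpace_pos (n : ℕ) : (0 : ℝ) < Fintype.card (ProcessSpace n) := by
  have : Nonempty (ProcessSpace n) := ⟨(Fintype.equivFin _).symm⟩
  exact_mod_cast Fintype.card_pos

lemma avg_mono {f g : ProcessSpace n → ℝ} (h : ∀ σ, f σ ≤ g σ) : avg f ≤ avg g :=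
  div_le_div_of_nonneg_right (Finset.sum_le_sum fun σ _ => h σ) (card_processSpace_pos n).le

lemma avg_nonneg {f : ProcessSpace n → ℝ} (h : ∀ σ, 0 ≤ f σ) : 0 ≤ avg f :=
  div_nonneg (Finset.sum_nonneg fun σ _ => h σ) (card_processSpace_pos n).le

lemma avg_const (c : ℝ) : avg (fun _ : ProcessSpace n => c) = c := by
  unfold avg
  rw [Finset.sum_const, nsmul_eq_mul, Finset.card_univ, mul_comm, mul_div_assoc,
    div_self (card_processSpace_pos n).ne', mul_one]

lemma avg_sum {α : Type*} (s : Finset α) (f : α → ProcessSpace n → ℝ) :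
    avg (fun σ => ∑ i ∈ s, f i σ) = ∑ i ∈ s, avg (f i) := by
  unfold avg
  rw [Finset.sum_comm, Finset.sum_div]

lemma avg_mul_const (f : ProcessSpace n → ℝ) (c : ℝ) : avg (fun σ => f σ * c) = avg f * c := by
  unfold avg
  rw [← Finset.sum_mul]; ring

lemma pr_nonneg (P : ProcessSpace n → Prop) : 0 ≤ pr P :=
  avg_nonneg fun σ => by split_ifs <;> norm_num

lemma pr_le_avg {P : ProcessSpace n → Prop} {f : ProcessSpace n → ℝ} (h0 : ∀ σ, 0 ≤ f σ)
    (h1 : ∀ σ, P σ → 1 ≤ f σ) : pr P ≤ avg f :=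
  avg_mono fun σ => by
    split_ifs with h
    · exact h1 σ h
    · exact h0 σ

lemma pr_mono {P P' : ProcessSpace n → Prop} (h : ∀ σ, P σ → P' σ) : pr P ≤ pr P' :=
  pr_le_avg (fun σ => by split_ifs <;> norm_num) fun σ hσ => by rw [if_pos (h σ hσ)]

lemma pr_or_le (P P' : ProcessSpace n → Prop) : pr (fun σ => P σ ∨ P' σ) ≤ pr P + pr P' := by
  unfold pr avg
  rw [← add_div, ← Finset.sum_add_distrib]
  refine div_le_div_of_nonneg_right (Finset.sum_le_sum fun σ _ => ?_) (card_processSpace_pos n).le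
  by_cases h : P σ <;> by_cases h' : P' σ <;> simp [h, h']

lemma pr_exists_le {α : Type*} (s : Finset α) (P : α → ProcessSpace n → Prop) :
    pr (fun σ => ∃ i ∈ s, P i σ) ≤ ∑ i ∈ s, pr (P i) := by
  unfold pr
  rw [← avg_sum]
  refine pr_le_avg (fun σ => Finset.sum_nonneg fun i _ => by split_ifs <;> norm_num) ?_
  rintro σ ⟨i, hi, h⟩
  have := Finset.single_le_sum (f := fun i => if P i σ then (1 : ℝ) else 0)
    (fun i _ => by split_ifs <;> norm_num) hi
  simpa [h] using this

lemma processMeasure_eq (P : ProcessSpace n → Prop) :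
    processMeasure n {σ | P σ} = ENNReal.ofReal (pr P) := by
  have h1 : pr P = ((Finset.univ.filter fun σ : ProcessSpace n => P σ).card : ℝ) /
      (Fintype.card (ProcessSpace n) : ℝ) := by
    unfold pr avg
    rw [Finset.card_filter]
    push_cast
    rfl
  rw [h1, ENNReal.ofReal_div_of_pos (card_processSpace_pos n), ENNReal.ofReal_natCast,
    ENNReal.ofReal_natCast, processMeasure, Measure.smul_apply, smul_eq_mul,
    Measure.sum_apply _ (by trivial), tsum_fintype, div_eq_mul_inv, mul_comm]
  congr 1
  rw [Finset.card_filter]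
  push_cast
  refine Finset.sum_congr rfl fun σ _ => ?_
  rw [Measure.dirac_apply' _ (by trivial)]
  simp [Set.indicator_apply]

lemma pr_eq_one_sub (P : ProcessSpace n → Prop) : pr P = 1 - pr (fun σ => ¬ P σ) := by
  have h : avg (fun σ : ProcessSpace n => (if P σ then (1 : ℝ) else 0) + if ¬ P σ then 1 else 0) =
      1 := by
    refine Eq.trans (congrArg avg (funext fun σ => ?_)) (avg_const (n := n) 1)
    by_cases h : P σ <;> simp [h]
  have h2 : avg (fun σ : ProcessSpace n => (if P σ then (1 : ℝ) else 0) + if ¬ P σ then 1 else 0) =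
      pr P + pr (fun σ => ¬ P σ) := by
    unfold pr avg
    rw [Finset.sum_add_distrib, add_div]
    congr!
  linarith

/-- Averaging over permutations of an initial segment. -/
lemma avg_le_of_permsOn (A : Finset (Fin (numEdges n))) {f g : ProcessSpace n → ℝ}
    (h : ∀ σ : ProcessSpace n,
      ∑ π ∈ permsOn A, f (π.symm.trans σ) ≤ (permsOn A).card * g σ) :
    avg f ≤ avg g := by
  have h1 : ∀ π : Equiv.Perm (Fin (numEdges n)), ∑ σ : ProcessSpace n, f (π.symm.trans σ) =
      ∑ σ, f σ := by
    intro π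
    exact Fintype.sum_equiv (Equiv.equivCongr π (Equiv.refl _)) _ _ fun σ => rfl
  have h2 : ((permsOn A).card : ℝ) * ∑ σ, f σ ≤ (permsOn A).card * ∑ σ, g σ := by
    calc ((permsOn A).card : ℝ) * ∑ σ, f σ = ∑ π ∈ permsOn A, ∑ σ, f (π.symm.trans σ) := by
          rw [Finset.sum_congr rfl fun π _ => h1 π, Finset.sum_const, nsmul_eq_mul]
      _ = ∑ σ, ∑ π ∈ permsOn A, f (π.symm.trans σ) := Finset.sum_comm
      _ ≤ ∑ σ, (permsOn A).card * g σ := Finset.sum_le_sum fun σ _ => h σ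
      _ = _ := by rw [Finset.mul_sum]
  have h3 : (0 : ℝ) < (permsOn A).card := by exact_mod_cast card_permsOn_pos A
  exact div_le_div_of_nonneg_right (le_of_mul_le_mul_left h2 h3) (card_processSpace_pos n).le

lemma mem_firstEdges_perm (σ : ProcessSpace n) (π : Equiv.Perm (Fin (numEdges n))) (m : ℕ)
    (e : EdgeType n) : e ∈ firstEdges (π.symm.trans σ) m ↔ ((π (σ.symm e) : Fin _) : ℕ) < m := by
  simp

/-- The initial segment of positions below `m`. -/
def below (n m : ℕ) : Finset (Fin (numEdges n)) := Finset.univ.filter fun i => (i : ℕ) < m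

lemma mem_below {m : ℕ} {i : Fin (numEdges n)} : i ∈ below n m ↔ (i : ℕ) < m := by simp [below]

lemma card_below {m : ℕ} (hm : m ≤ numEdges n) : (below n m).card = m := by
  rw [below, Fin.card_filter_val_lt, min_eq_right hm]

/-- Upper tail exponential moments for the first `m` edges. -/
lemma avg_pow_le {m : ℕ} (hN : 0 < numEdges n) (hm : m ≤ numEdges n) {J K : Finset (EdgeType n)}
    (hJK : Disjoint J K) {t : ℝ} (ht : 0 ≤ t) :
    avg (fun σ : ProcessSpace n => if J ⊆ firstEdges σ m then (1 + t) ^ (K ∩ firstEdges σ m).card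
      else 0) ≤ ((m : ℝ) / numEdges n) ^ J.card * (1 + t * ((m : ℝ) / numEdges n)) ^ K.card := by
  rw [← avg_const (n := n) (((m : ℝ) / numEdges n) ^ J.card *
    (1 + t * ((m : ℝ) / numEdges n)) ^ K.card)]
  refine avg_le_of_permsOn Finset.univ fun σ => ?_
  have hA : (Finset.univ : Finset (Fin (numEdges n))).Nonempty := ⟨⟨0, hN⟩, Finset.mem_univ _⟩
  have h := sum_permsInto_pow_le (Q := below n m) (J := J.map σ.symm.toEmbedding)
    (K := K.map σ.symm.toEmbedding) hA (Finset.subset_univ _) (Finset.subset_univ _)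
    (Finset.subset_univ _) ((Finset.disjoint_map _).2 hJK) ht
  rw [card_below hm, Finset.card_map, Finset.card_map, Finset.card_univ, Fintype.card_fin] at h
  refine le_trans (le_of_eq ?_) h
  rw [permsInto, Finset.sum_filter]
  refine Finset.sum_congr rfl fun π _ => ?_
  have e1 : J ⊆ firstEdges (π.symm.trans σ) m ↔
      ∀ j ∈ J.map σ.symm.toEmbedding, π j ∈ below n m := by
    simp only [Finset.mem_map_equiv, Equiv.symm_symm, mem_below]
    constructor
    · intro hJ j hj
      simpa using (mem_firstEdges_perm σ π m _).1 (hJ hj)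
    · intro hJ e he
      exact (mem_firstEdges_perm σ π m e).2 (hJ _ (by simpa using he))
  have e2 : (K ∩ firstEdges (π.symm.trans σ) m).card =
      ((K.map σ.symm.toEmbedding).filter fun k => π k ∈ below n m).card := by
    rw [← Finset.card_map σ.symm.toEmbedding]
    congr 1
    ext i
    simp [Finset.mem_map_equiv, mem_below, mem_firstEdges]
  rw [e2]
  by_cases hJ : J ⊆ firstEdges (π.symm.trans σ) m
  · rw [if_pos hJ, if_pos (e1.1 hJ)]
  · rw [if_neg hJ, if_neg fun h => hJ (e1.2 h)]

/-- Lower tail exponential moments for the first `m₀` edges given the first `m₁` edges. -/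
lemma avg_pow_le_of_le {m₀ m₁ : ℕ} (hm₁0 : 0 < m₁) (hm : m₀ ≤ m₁) (hm₁ : m₁ ≤ numEdges n)
    (h : Finset (EdgeType n) → ℝ) (h0 : ∀ S, 0 ≤ h S)
    (K : Finset (EdgeType n) → Finset (EdgeType n)) (hK : ∀ S, K S ⊆ S) {θ : ℝ} (hθ : 0 < θ)
    (hθ1 : θ ≤ 1) :
    avg (fun σ : ProcessSpace n => h (firstEdges σ m₁) *
      θ ^ (K (firstEdges σ m₁) ∩ firstEdges σ m₀).card) ≤
    avg (fun σ : ProcessSpace n => h (firstEdges σ m₁) *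
      Real.exp (-((1 - θ) * ((m₀ : ℝ) / m₁) * (K (firstEdges σ m₁)).card))) := by
  refine avg_le_of_permsOn (below n m₁) fun σ => ?_
  have hA : (below n m₁).Nonempty := by
    rw [← Finset.card_pos, card_below hm₁]; exact hm₁0
  have e0 : ∀ π ∈ permsOn (below n m₁), firstEdges (π.symm.trans σ) m₁ = firstEdges σ m₁ := by
    intro π hπ
    ext e
    rw [mem_firstEdges_perm, mem_firstEdges, ← mem_below, ← mem_below, permsOn_mem_iff hπ]
  set S := firstEdges σ m₁ with hS
  have hsub : (K S).map σ.symm.toEmbedding ⊆ below n m₁ := by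
    intro i hi
    rw [Finset.mem_map_equiv, Equiv.symm_symm] at hi
    have := hK S hi
    rw [hS, mem_firstEdges] at this
    simpa [mem_below] using this
  have key := sum_permsOn_pow_le (Q := below n m₀) hA
    (fun i hi => by rw [mem_below] at hi ⊢; omega) hsub hθ hθ1
  rw [card_below hm₁, card_below (hm.trans hm₁), Finset.card_map] at key
  have e2 : ∀ π ∈ permsOn (below n m₁), h (firstEdges (π.symm.trans σ) m₁) *
      θ ^ (K (firstEdges (π.symm.trans σ) m₁) ∩ firstEdges (π.symm.trans σ) m₀).card =
      h S * θ ^ (((K S).map σ.symm.toEmbedding).filter fun k => π k ∈ below n m₀).card := by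
    intro π hπ
    rw [e0 π hπ]
    congr 2
    rw [← Finset.card_map σ.symm.toEmbedding]
    congr 1
    ext i
    simp [Finset.mem_map_equiv, mem_below, mem_firstEdges]
  rw [Finset.sum_congr rfl e2, ← Finset.mul_sum, mul_left_comm]
  exact mul_le_mul_of_nonneg_left key (h0 S)

end Averages

section Tails
open scoped Classical
variable {n m : ℕ}

/-- The edge probability of the graph with `m` edges. -/
def prob (n m : ℕ) : ℝ := (m : ℝ) / numEdges n

lemma prob_nonneg (n m : ℕ) : 0 ≤ prob n m := by unfold prob; positivity

lemma prob_mul (hN : 0 < numEdges n) : prob n m * numEdges n = m := by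
  unfold prob
  have : (numEdges n : ℝ) ≠ 0 := by exact_mod_cast hN.ne'
  field_simp

lemma prob_mul_card_le (hN : 0 < numEdges n) (K : Finset (EdgeType n)) : prob n m * K.card ≤ m := by
  rw [← prob_mul (m := m) hN]
  refine mul_le_mul_of_nonneg_left ?_ (prob_nonneg n m)
  exact_mod_cast Finset.card_le_univ K

lemma one_add_pow_le_exp {x : ℝ} (hx : 0 ≤ x) (k : ℕ) : (1 + x) ^ k ≤ Real.exp (x * k) := by
  rw [mul_comm, Real.exp_nat_mul]
  exact pow_le_pow_left₀ (by linarith) (by linarith [Real.add_one_le_exp x]) k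

lemma pr_subset_and_le (hN : 0 < numEdges n) (hm : m ≤ numEdges n) {J K : Finset (EdgeType n)}
    (hJK : Disjoint J K) {s y : ℝ} (hs : 0 ≤ s) :
    pr (fun σ : ProcessSpace n => J ⊆ firstEdges σ m ∧ y ≤ ((K ∩ firstEdges σ m).card : ℝ)) ≤
      prob n m ^ J.card * Real.exp (s * (prob n m * K.card) - Real.log (1 + s) * y) := by
  have h1 : pr (fun σ : ProcessSpace n => J ⊆ firstEdges σ m ∧
      y ≤ ((K ∩ firstEdges σ m).card : ℝ)) ≤
      avg (fun σ : ProcessSpace n => (if J ⊆ firstEdges σ m then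
        (1 + s) ^ (K ∩ firstEdges σ m).card else 0) * Real.exp (-(Real.log (1 + s) * y))) := by
    refine pr_le_avg (fun σ => ?_) ?_
    · split_ifs
      · positivity
      · simp
    · rintro σ ⟨h1, h2⟩
      rw [if_pos h1]
      have h3 : (1 + s) ^ (K ∩ firstEdges σ m).card =
          Real.exp (Real.log (1 + s) * (K ∩ firstEdges σ m).card) := by
        rw [mul_comm, Real.exp_nat_mul, Real.exp_log (by linarith)]
      rw [h3, ← Real.exp_add]
      apply Real.one_le_exp
      have h4 : Real.log (1 + s) * y ≤ Real.log (1 + s) * (K ∩ firstEdges σ m).card :=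
        mul_le_mul_of_nonneg_left h2 (Real.log_nonneg (by linarith))
      linarith
  refine h1.trans ?_
  rw [avg_mul_const]
  refine (mul_le_mul_of_nonneg_right (avg_pow_le hN hm hJK hs) (Real.exp_pos _).le).trans ?_
  rw [sub_eq_add_neg, Real.exp_add, ← mul_assoc]
  refine mul_le_mul_of_nonneg_right ?_ (Real.exp_pos _).le
  refine mul_le_mul_of_nonneg_left ?_ (pow_nonneg (prob_nonneg n m) _)
  rw [← mul_assoc]
  exact one_add_pow_le_exp (mul_nonneg hs (prob_nonneg n m)) _

lemma pr_le_card (hN : 0 < numEdges n) (hm : m ≤ numEdges n) (K : Finset (EdgeType n)) {s : ℝ}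
    (y : ℝ) (hs : 0 ≤ s) :
    pr (fun σ : ProcessSpace n => y ≤ ((K ∩ firstEdges σ m).card : ℝ)) ≤
      Real.exp (s * (prob n m * K.card) - Real.log (1 + s) * y) := by
  have h := pr_subset_and_le (J := ∅) hN hm (Finset.disjoint_empty_left K) hs (y := y)
  simpa using h

lemma pr_subset_le (hN : 0 < numEdges n) (hm : m ≤ numEdges n) (J : Finset (EdgeType n)) :
    pr (fun σ : ProcessSpace n => J ⊆ firstEdges σ m) ≤ prob n m ^ J.card := by
  have h := pr_subset_and_le (K := ∅) (J := J) hN hm (Finset.disjoint_empty_right J) le_rfl (y := 0)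
  simpa using h

lemma pr_card_le (hN : 0 < numEdges n) (hm : m ≤ numEdges n) (K : Finset (EdgeType n)) {η : ℝ}
    (hη : 0 ≤ η) :
    pr (fun σ : ProcessSpace n => ((K ∩ firstEdges σ m).card : ℝ) ≤ (1 - η) * (prob n m * K.card)) ≤
      Real.exp (-(η ^ 2 / 2 * (prob n m * K.card))) := by
  set x := prob n m * K.card with hx
  have hx0 : 0 ≤ x := mul_nonneg (prob_nonneg n m) (Nat.cast_nonneg _)
  have h := avg_pow_le_of_le (n := n) hN hm le_rfl (fun _ => 1) (fun _ => zero_le_one)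
    (fun S => K ∩ S) (fun S => Finset.inter_subset_right) (Real.exp_pos (-η))
    (Real.exp_le_one_iff.2 (by linarith))
  have hu : ∀ σ : ProcessSpace n, firstEdges σ (numEdges n) = Finset.univ := by
    intro σ; ext e
    simp only [mem_firstEdges, Finset.mem_univ, iff_true]; exact (σ.symm e).2
  simp only [hu, Finset.inter_univ, one_mul] at h
  rw [avg_const] at h
  have h1 : pr (fun σ : ProcessSpace n => ((K ∩ firstEdges σ m).card : ℝ) ≤ (1 - η) * x) ≤
      avg (fun σ : ProcessSpace n => Real.exp (-η) ^ (K ∩ firstEdges σ m).card *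
        Real.exp (η * ((1 - η) * x))) := by
    refine pr_le_avg (fun σ => by positivity) fun σ hσ => ?_
    rw [← Real.exp_nat_mul, ← Real.exp_add]
    apply Real.one_le_exp
    have := mul_le_mul_of_nonneg_left hσ hη
    linarith
  refine h1.trans ?_
  rw [avg_mul_const]
  refine (mul_le_mul_of_nonneg_right h (Real.exp_pos _).le).trans ?_
  rw [← Real.exp_add]
  apply Real.exp_le_exp.2
  have h2 : Real.exp (-η) ≤ 1 - η + η ^ 2 / 2 := by
    have h3 := Real.quadratic_le_exp_of_nonneg hη
    rw [Real.exp_neg, inv_le_comm₀ (Real.exp_pos _) (by nlinarith [sq_nonneg (1 - η)])]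
    refine le_trans ?_ h3
    rw [inv_le_iff_one_le_mul₀ (by nlinarith [sq_nonneg (1 - η)])]
    nlinarith [sq_nonneg (η ^ 2)]
  have h4 : (1 - Real.exp (-η)) * (((m : ℕ) : ℝ) / (numEdges n : ℕ)) * K.card =
      (1 - Real.exp (-η)) * x := by rw [hx, prob]; ring
  rw [h4]
  have h5 : (η - η ^ 2 / 2) * x ≤ (1 - Real.exp (-η)) * x :=
    mul_le_mul_of_nonneg_right (by linarith) hx0
  nlinarith

lemma pr_subset_and_upper (hN : 0 < numEdges n) (hm : m ≤ numEdges n) {J F : Finset (EdgeType n)}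
    {t : ℝ} (ht : 0 < t) (ht1 : t ≤ 1) (hJ : (J.card : ℝ) ≤ t / 2 * m) :
    pr (fun σ : ProcessSpace n => J ⊆ firstEdges σ m ∧
      prob n m * F.card + t * m ≤ ((F ∩ firstEdges σ m).card : ℝ)) ≤
      prob n m ^ J.card * Real.exp (-(t ^ 2 / 16 * m)) := by
  set x := prob n m * (F \ J).card with hx
  have hm0 : (0 : ℝ) ≤ m := Nat.cast_nonneg m
  have hxm : x ≤ m := prob_mul_card_le hN _
  refine (pr_mono ?_).trans ((pr_subset_and_le (K := F \ J) (y := x + t / 2 * m) hN hm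
    Finset.disjoint_sdiff (by positivity : 0 ≤ t / 4)).trans
    (mul_le_mul_of_nonneg_left (Real.exp_le_exp.2 ?_) (pow_nonneg (prob_nonneg n m) _)))
  · rintro σ ⟨h1, h2⟩
    refine ⟨h1, ?_⟩
    have h3 : F ∩ firstEdges σ m ⊆ ((F \ J) ∩ firstEdges σ m) ∪ J := by
      intro e he
      by_cases heJ : e ∈ J
      · exact Finset.mem_union_right _ heJ
      · rw [Finset.mem_inter] at he
        exact Finset.mem_union_left _ (Finset.mem_inter.2 ⟨Finset.mem_sdiff.2 ⟨he.1, heJ⟩, he.2⟩)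
    have h4 := (Finset.card_le_card h3).trans (Finset.card_union_le _ _)
    have h5 : ((F ∩ firstEdges σ m).card : ℝ) ≤ ((F \ J) ∩ firstEdges σ m).card + J.card := by
      exact_mod_cast h4
    have h6 : x ≤ prob n m * F.card := by
      refine mul_le_mul_of_nonneg_left ?_ (prob_nonneg n m)
      exact_mod_cast Finset.card_le_card Finset.sdiff_subset
    linarith
  · rw [← hx]
    have hx0 : 0 ≤ x := mul_nonneg (prob_nonneg n m) (Nat.cast_nonneg _)
    set s := t / 4 with hs
    have hs0 : 0 < s := by positivity
    have hs1 : s ≤ 1 / 4 := by rw [hs]; linarith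
    have hlog : s - s ^ 2 / 2 ≤ Real.log (1 + s) := by
      refine le_trans ?_ (Real.le_log_one_add_of_nonneg hs0.le)
      rw [le_div_iff₀ (by linarith)]
      nlinarith [pow_pos hs0 3]
    have h1 : (s - s ^ 2 / 2) * (x + t / 2 * m) ≤ Real.log (1 + s) * (x + t / 2 * m) :=
      mul_le_mul_of_nonneg_right hlog (by positivity)
    have ht4 : t = 4 * s := by rw [hs]; ring
    rw [ht4] at h1 ⊢
    have h2 : s ^ 2 / 2 * x ≤ s ^ 2 / 2 * m := mul_le_mul_of_nonneg_left hxm (by positivity)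
    have h3 : s * (s ^ 2 * m) ≤ 1 / 4 * (s ^ 2 * m) :=
      mul_le_mul_of_nonneg_right hs1 (by positivity)
    have h4 : 0 ≤ s ^ 2 * m := by positivity
    nlinarith

lemma pr_exists_subset_and_upper (hN : 0 < numEdges n) (hm : m ≤ numEdges n) {α : Type*}
    [Fintype α] (F : Finset (EdgeType n) → α → Finset (EdgeType n)) {t κ : ℝ} (ht : 0 < t)
    (ht1 : t ≤ 1) (hκ : κ ≤ t / 2) (hκt : κ * Real.log (64 / t ^ 2) ≤ t ^ 2 / 64) :
    pr (fun σ : ProcessSpace n => ∃ J, J ⊆ firstEdges σ m ∧ (J.card : ℝ) ≤ κ * m ∧ ∃ i : α,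
      prob n m * (F J i).card + t * m ≤ ((F J i ∩ firstEdges σ m).card : ℝ)) ≤
      Fintype.card α * Real.exp (-(t ^ 2 / 32 * m)) := by
  have hm0 : (0 : ℝ) ≤ m := Nat.cast_nonneg m
  set x := t ^ 2 / 64 with hx
  have hx0 : 0 < x := by positivity
  set Js := Finset.univ.filter fun J : Finset (EdgeType n) => (J.card : ℝ) ≤ κ * m with hJs
  have h1 : pr (fun σ : ProcessSpace n => ∃ J, J ⊆ firstEdges σ m ∧ (J.card : ℝ) ≤ κ * m ∧ ∃ i : α,
      prob n m * (F J i).card + t * m ≤ ((F J i ∩ firstEdges σ m).card : ℝ)) ≤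
      ∑ J ∈ Js, ∑ _i : α, prob n m ^ J.card * Real.exp (-(t ^ 2 / 16 * m)) := by
    refine (pr_mono (P' := fun σ => ∃ J ∈ Js, ∃ i ∈ (Finset.univ : Finset α), J ⊆ firstEdges σ m ∧
      prob n m * (F J i).card + t * m ≤ ((F J i ∩ firstEdges σ m).card : ℝ)) ?_).trans ?_
    · rintro σ ⟨J, h1, h2, i, h3⟩
      exact ⟨J, by simpa [hJs] using h2, i, Finset.mem_univ i, h1, h3⟩
    · refine (pr_exists_le _ _).trans (Finset.sum_le_sum fun J hJ => ?_)
      refine (pr_exists_le _ _).trans (Finset.sum_le_sum fun i _ => ?_)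
      refine pr_subset_and_upper hN hm ht ht1 ?_
      have h2 : (J.card : ℝ) ≤ κ * m := by simpa [hJs] using hJ
      exact h2.trans (mul_le_mul_of_nonneg_right hκ hm0)
  refine h1.trans ?_
  simp_rw [Finset.sum_const, nsmul_eq_mul, Finset.card_univ]
  rw [← Finset.mul_sum]
  refine mul_le_mul_of_nonneg_left ?_ (Nat.cast_nonneg _)
  rw [← Finset.sum_mul]
  have h2 : ∑ J ∈ Js, prob n m ^ J.card ≤ Real.exp (x * m) * Real.exp (x * m) := by
    have h3 : ∀ J ∈ Js, prob n m ^ J.card ≤ (x * prob n m) ^ J.card * Real.exp (x * m) := by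
      intro J hJ
      have h4 : (J.card : ℝ) ≤ κ * m := by simpa [hJs] using hJ
      rw [mul_pow, mul_right_comm, mul_comm]
      refine le_mul_of_one_le_right (pow_nonneg (prob_nonneg n m) _) ?_
      have h5 : x = Real.exp (-Real.log (64 / t ^ 2)) := by
        rw [Real.exp_neg, Real.exp_log (by positivity), inv_div]
      have h6 : 0 ≤ Real.log (64 / t ^ 2) := by
        refine Real.log_nonneg ?_
        rw [le_div_iff₀ (by positivity)]
        nlinarith
      have h7 : x ^ J.card = Real.exp (-(J.card * Real.log (64 / t ^ 2))) := by
        rw [h5, ← Real.exp_nat_mul]; congr 1; ring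
      rw [h7, ← Real.exp_add]
      apply Real.one_le_exp
      have h8 := mul_le_mul_of_nonneg_right h4 h6
      have h9 := mul_le_mul_of_nonneg_right hκt hm0
      linarith
    refine (Finset.sum_le_sum h3).trans ?_
    rw [← Finset.sum_mul]
    refine mul_le_mul_of_nonneg_right ?_ (Real.exp_pos _).le
    refine (Finset.sum_le_sum_of_subset_of_nonneg (Finset.subset_univ Js) fun J _ _ =>
      pow_nonneg (mul_nonneg hx0.le (prob_nonneg n m)) _).trans ?_
    have h4 : ∑ J : Finset (EdgeType n), (x * prob n m) ^ J.card = (1 + x * prob n m) ^ numEdges n := by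
      rw [← Finset.powerset_univ]
      have := Finset.prod_one_add (s := (Finset.univ : Finset (EdgeType n)))
        (f := fun _ => x * prob n m)
      rw [Finset.prod_const, Finset.card_univ] at this
      rw [this]
      exact Finset.sum_congr rfl fun J _ => (Finset.prod_const _).symm
    rw [h4]
    refine (one_add_pow_le_exp (mul_nonneg hx0.le (prob_nonneg n m)) _).trans (le_of_eq ?_)
    rw [mul_assoc, prob_mul hN]
  refine (mul_le_mul_of_nonneg_right h2 (Real.exp_pos _).le).trans (le_of_eq ?_)
  rw [← Real.exp_add, ← Real.exp_add]
  congr 1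
  rw [hx]; ring

end Tails

section EdgeSets
open scoped Classical
variable {n : ℕ}

lemma pairs_le_card (G : SimpleGraph (Fin n)) (F : Finset (Fin n × Fin n)) :
    pairs G F ≤ F.card := Finset.card_filter_le _ _

lemma pairs_eq_card {G : SimpleGraph (Fin n)} {F : Finset (Fin n × Fin n)}
    (h : ∀ q ∈ F, G.Adj q.1 q.2) : pairs G F = F.card := by
  rw [pairs, Finset.filter_true_of_mem h]

/-- The graph with edge set `S`. -/
def gr (S : Finset (EdgeType n)) : SimpleGraph (Fin n) :=
  SimpleGraph.fromEdgeSet (Set.image Subtype.val (S : Set (EdgeType n)))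

lemma gr_adj {S : Finset (EdgeType n)} {a b : Fin n} :
    (gr S).Adj a b ↔ ∃ h : ¬ s(a, b).IsDiag, (⟨s(a, b), h⟩ : EdgeType n) ∈ S := by
  rw [gr, SimpleGraph.fromEdgeSet_adj]
  constructor
  · rintro ⟨⟨e, he, h⟩, -⟩
    obtain ⟨e, he'⟩ := e
    simp only at h
    subst h
    exact ⟨he', he⟩
  · rintro ⟨h, hS⟩
    exact ⟨⟨_, hS, rfl⟩, by simpa using h⟩

lemma processGraph_eq (σ : ProcessSpace n) (m : ℕ) : processGraph σ m = gr (firstEdges σ m) := by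
  unfold processGraph gr
  congr 1
  ext e
  simp only [Set.mem_ofPred_eq, Set.mem_image, Finset.mem_coe, mem_firstEdges]
  constructor
  · rintro ⟨i, hi, rfl⟩
    exact ⟨σ i, by simpa using hi, rfl⟩
  · rintro ⟨e, he, rfl⟩
    exact ⟨σ.symm e, he, by simp⟩

lemma gr_mono {S S' : Finset (EdgeType n)} (h : S ⊆ S') : gr S ≤ gr S' := by
  intro a b hab
  obtain ⟨h1, h2⟩ := gr_adj.1 hab
  exact gr_adj.2 ⟨h1, h h2⟩

lemma gr_univ : gr (Finset.univ : Finset (EdgeType n)) = ⊤ := by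
  ext a b
  rw [gr_adj]
  simp

/-- The edge set of a graph. -/
def edgesOf (Γ : SimpleGraph (Fin n)) : Finset (EdgeType n) :=
  Finset.univ.filter fun e => e.1 ∈ Γ.edgeSet

lemma gr_edgesOf (Γ : SimpleGraph (Fin n)) : gr (edgesOf Γ) = Γ := by
  ext a b
  rw [gr_adj]
  constructor
  · rintro ⟨h, hS⟩
    simpa [edgesOf] using hS
  · intro h
    exact ⟨by simpa using h.ne, by simpa [edgesOf] using h⟩

lemma edgesOf_subset {Γ : SimpleGraph (Fin n)} {S : Finset (EdgeType n)} (h : Γ ≤ gr S) :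
    edgesOf Γ ⊆ S := by
  rintro ⟨e, he⟩ heΓ
  induction e using Sym2.ind with
  | _ a b =>
    have h1 : Γ.Adj a b := by simpa [edgesOf] using heΓ
    exact (gr_adj.1 (h h1)).2

/-- The endpoints of an edge in increasing order. -/
def asc (e : EdgeType n) : Fin n × Fin n := (e.1.inf, e.1.sup)

lemma asc_lt (e : EdgeType n) : (asc e).1 < (asc e).2 := by
  obtain ⟨e, he⟩ := e
  induction e using Sym2.ind with
  | _ a b =>
    rw [Sym2.mk_isDiag_iff] at he
    simpa [asc] using Ne.symm he

lemma mk_asc (e : EdgeType n) : s((asc e).1, (asc e).2) = e.1 := by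
  obtain ⟨e, he⟩ := e
  induction e using Sym2.ind with
  | _ a b =>
    rcases le_total a b with h | h
    · simp [asc, h]
    · simp [asc, h, Sym2.eq_swap]

lemma asc_injective : Function.Injective (asc : EdgeType n → Fin n × Fin n) := by
  intro e e' h
  apply Subtype.ext
  rw [← mk_asc, h, mk_asc]

lemma asc_mk {a b : Fin n} (hab : a < b) (h : ¬ s(a, b).IsDiag) : asc ⟨s(a, b), h⟩ = (a, b) := by
  simp [asc, hab.le]

/-- The edges whose increasing pair of endpoints lies in `F`. -/
def up (F : Finset (Fin n × Fin n)) : Finset (EdgeType n) :=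
  Finset.univ.filter fun e => asc e ∈ F

/-- The edges whose decreasing pair of endpoints lies in `F`. -/
def dn (F : Finset (Fin n × Fin n)) : Finset (EdgeType n) :=
  Finset.univ.filter fun e => (asc e).swap ∈ F

@[simp] lemma mem_up {F : Finset (Fin n × Fin n)} {e : EdgeType n} : e ∈ up F ↔ asc e ∈ F := by
  simp [up]

@[simp] lemma mem_dn {F : Finset (Fin n × Fin n)} {e : EdgeType n} :
    e ∈ dn F ↔ (asc e).swap ∈ F := by simp [dn]

lemma gr_adj_asc {S : Finset (EdgeType n)} {e : EdgeType n} (he : e ∈ S) :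
    (gr S).Adj (asc e).1 (asc e).2 := by
  refine gr_adj.2 ⟨?_, ?_⟩
  · rw [mk_asc]; exact e.2
  · convert he; exact mk_asc e

lemma pairs_gr (S : Finset (EdgeType n)) (F : Finset (Fin n × Fin n)) :
    pairs (gr S) F = (up F ∩ S).card + (dn F ∩ S).card := by
  have h1 : (F.filter fun q => (gr S).Adj q.1 q.2) =
      (up F ∩ S).image asc ∪ (dn F ∩ S).image (fun e => (asc e).swap) := by
    ext ⟨a, b⟩
    simp only [Finset.mem_filter, Finset.mem_union, Finset.mem_image, Finset.mem_inter, mem_up,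
      mem_dn]
    constructor
    · rintro ⟨hF, hab⟩
      rcases lt_or_gt_of_ne hab.ne with h | h
      · obtain ⟨h1, h2⟩ := gr_adj.1 hab
        exact Or.inl ⟨_, ⟨by rwa [asc_mk h], h2⟩, asc_mk h h1⟩
      · obtain ⟨h1, h2⟩ := gr_adj.1 hab.symm
        exact Or.inr ⟨_, ⟨by rwa [asc_mk h], h2⟩, by rw [asc_mk h h1]; rfl⟩
    · rintro (⟨e, ⟨h1, h2⟩, h3⟩ | ⟨e, ⟨h1, h2⟩, h3⟩)
      · rw [h3] at h1
        have := gr_adj_asc h2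
        rw [h3] at this
        exact ⟨h1, this⟩
      · rw [h3] at h1
        have := (gr_adj_asc h2).symm
        rw [Prod.ext_iff] at h3
        simp only [Prod.fst_swap, Prod.snd_swap] at h3
        rw [h3.1, h3.2] at this
        exact ⟨h1, this⟩
  have h2 : Disjoint ((up F ∩ S).image asc) ((dn F ∩ S).image (fun e => (asc e).swap)) := by
    rw [Finset.disjoint_left]
    intro q hq hq'
    obtain ⟨e, -, rfl⟩ := Finset.mem_image.1 hq
    obtain ⟨e', -, he'⟩ := Finset.mem_image.1 hq'
    have h3 := asc_lt e
    have h4 := asc_lt e'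
    rw [← he'] at h3
    exact lt_asymm h3 h4
  rw [pairs]
  calc _ = ((up F ∩ S).image asc ∪ (dn F ∩ S).image (fun e => (asc e).swap)).card := by
        rw [← h1]
    _ = _ := by
        rw [Finset.card_union_of_disjoint h2, Finset.card_image_of_injective _ asc_injective,
          Finset.card_image_of_injective]
        exact Prod.swap_injective.comp asc_injective

lemma card_up_add_card_dn (F : Finset (Fin n × Fin n)) :
    (up F).card + (dn F).card = pairs (⊤ : SimpleGraph (Fin n)) F := by
  rw [← gr_univ, pairs_gr, Finset.inter_univ, Finset.inter_univ]

lemma card_up_add_card_dn_le (F : Finset (Fin n × Fin n)) :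
    (up F).card + (dn F).card ≤ F.card := by
  rw [card_up_add_card_dn]
  exact pairs_le_card _ F

lemma pairs_gr_univ (S : Finset (EdgeType n)) : pairs (gr S) Finset.univ = 2 * S.card := by
  have h1 : up (Finset.univ : Finset (Fin n × Fin n)) = Finset.univ := by ext; simp
  have h2 : dn (Finset.univ : Finset (Fin n × Fin n)) = Finset.univ := by ext; simp
  rw [pairs_gr, h1, h2, Finset.univ_inter]; ring

/-- The edges with endpoints given by a pair in `F`. -/
def und (F : Finset (Fin n × Fin n)) : Finset (EdgeType n) := up F ∪ dn F

lemma disjoint_up_dn {F : Finset (Fin n × Fin n)} (hF : ∀ q ∈ F, q.swap ∉ F) :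
    Disjoint (up F) (dn F) := by
  rw [Finset.disjoint_left]
  intro e h1 h2
  exact hF _ (mem_up.1 h1) (mem_dn.1 h2)

lemma card_und_inter {F : Finset (Fin n × Fin n)} (hF : ∀ q ∈ F, q.swap ∉ F)
    (S : Finset (EdgeType n)) : (und F ∩ S).card = pairs (gr S) F := by
  rw [pairs_gr, und, Finset.union_inter_distrib_right, Finset.card_union_of_disjoint]
  exact (disjoint_up_dn hF).mono Finset.inter_subset_left Finset.inter_subset_left

lemma card_und {F : Finset (Fin n × Fin n)} (hF : ∀ q ∈ F, q.swap ∉ F) (hF' : ∀ q ∈ F, q.1 ≠ q.2) :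
    (und F).card = F.card := by
  have := card_und_inter hF Finset.univ
  rw [Finset.inter_univ, gr_univ] at this
  rw [this]
  exact pairs_eq_card fun q h => (SimpleGraph.top_adj _ _).2 (hF' q h)

lemma und_subset {F : Finset (Fin n × Fin n)} {S : Finset (EdgeType n)}
    (h : ∀ q ∈ F, (gr S).Adj q.1 q.2) : und F ⊆ S := by
  intro e he
  rw [und, Finset.mem_union, mem_up, mem_dn] at he
  have h1 : (gr S).Adj (asc e).1 (asc e).2 := by
    rcases he with he | he
    · exact h _ he
    · exact (h _ he).symm
  obtain ⟨h2, h3⟩ := gr_adj.1 h1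
  convert h3
  exact (mk_asc e).symm

lemma two_mul_numEdges (n : ℕ) : (2 * numEdges n : ℝ) = n * (n - 1) := by
  have h1 := pairs_gr_univ (Finset.univ : Finset (EdgeType n))
  rw [gr_univ, Finset.card_univ] at h1
  have h2 : pairs (⊤ : SimpleGraph (Fin n)) Finset.univ + n = n * n := by
    have h3 := Finset.card_filter_add_card_filter_not (s := (Finset.univ : Finset (Fin n × Fin n)))
      (fun q => q.1 ≠ q.2)
    have h4 : (Finset.univ.filter fun q : Fin n × Fin n => ¬ q.1 ≠ q.2) =
        Finset.univ.image fun a => (a, a) := by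
      ext ⟨a, b⟩; simp
    rw [h4, Finset.card_image_of_injective _ (fun a b h => (Prod.ext_iff.1 h).1)] at h3
    simp only [Finset.card_univ, Fintype.card_prod, Fintype.card_fin] at h3
    rw [← h3, pairs]
    congr 2
    ext q
    simp
  rw [h1] at h2
  have : (2 * numEdges n + n : ℝ) = n * n := by exact_mod_cast h2
  linarith

lemma prob_eq (hn : 1 < n) (m : ℕ) : prob n m = 2 * m / (n * (n - 1)) := by
  rw [prob, ← two_mul_numEdges]
  have : (0 : ℝ) < numEdges n := by
    have h := two_mul_numEdges n
    have h2 : (1 : ℝ) < n := by exact_mod_cast hn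
    have : 0 < (n : ℝ) * (n - 1) := mul_pos (by linarith) (by linarith)
    linarith
  field_simp

end EdgeSets

section Uniformity
open scoped Classical
variable {n m : ℕ}

/-- One of the two edge sets associated with a set of pairs. -/
def side (F : Finset (Fin n × Fin n)) : Bool → Finset (EdgeType n)
  | true => up F
  | false => dn F

lemma exists_side_of_lt_pairs (hn : 1 < n) {S : Finset (EdgeType n)} {F : Finset (Fin n × Fin n)}
    {τ : ℝ} (hτ : 4 ≤ τ * (n - 1))
    (h : (2 * F.card / (n : ℝ) ^ 2 + τ) * m < pairs (gr S) F) :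
    ∃ b, prob n m * (side F b).card + τ / 4 * m ≤ ((side F b ∩ S).card : ℝ) := by
  by_contra hc
  push Not at hc
  have h1 := hc true
  have h2 := hc false
  simp only [side] at h1 h2
  have hn1 : (1 : ℝ) < n := by exact_mod_cast hn
  have hm0 : (0 : ℝ) ≤ m := Nat.cast_nonneg m
  have h3 : (pairs (gr S) F : ℝ) = (up F ∩ S).card + (dn F ∩ S).card := by
    exact_mod_cast pairs_gr S F
  have h4 : ((up F).card : ℝ) + (dn F).card ≤ F.card := by
    exact_mod_cast card_up_add_card_dn_le F
  have h5 := mul_le_mul_of_nonneg_left h4 (prob_nonneg n m)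
  have hF : (F.card : ℝ) ≤ (n : ℝ) ^ 2 := by
    have := Finset.card_le_univ F
    rw [Fintype.card_prod, Fintype.card_fin] at this
    rw [sq]; exact_mod_cast this
  have h6 : prob n m * F.card ≤ 2 * F.card / (n : ℝ) ^ 2 * m + τ / 2 * m := by
    rw [prob_eq hn]
    have e1 : 2 * (m : ℝ) / (n * (n - 1)) * F.card - 2 * F.card / (n : ℝ) ^ 2 * m =
        F.card / (n : ℝ) ^ 2 * (2 * m / (n - 1)) := by
      have : (n : ℝ) - 1 ≠ 0 := by linarith
      have : (n : ℝ) ≠ 0 := by linarith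
      field_simp
      ring
    have e2 : 2 * (m : ℝ) / (n - 1) ≤ τ / 2 * m := by
      rw [div_le_iff₀ (by linarith)]
      have := mul_le_mul_of_nonneg_right hτ hm0
      linarith
    have e3 : F.card / (n : ℝ) ^ 2 ≤ 1 := by
      rw [div_le_one (by positivity)]; exact hF
    have e4 : 0 ≤ 2 * (m : ℝ) / (n - 1) := div_nonneg (by linarith) (by linarith)
    have e5 : F.card / (n : ℝ) ^ 2 * (2 * m / (n - 1)) ≤ 1 * (2 * m / (n - 1)) :=
      mul_le_mul_of_nonneg_right e3 e4
    linarith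
  linarith

lemma pr_exists_lt_pairs (hn : 1 < n) (hN : 0 < numEdges n) (hm : m ≤ numEdges n) {α : Type*}
    [Fintype α] (F : Finset (EdgeType n) → α → Finset (Fin n × Fin n)) {τ κ : ℝ} (hτ : 0 < τ)
    (hτ1 : τ ≤ 1) (hκ : κ ≤ τ / 8) (hκτ : κ * Real.log (1024 / τ ^ 2) ≤ τ ^ 2 / 1024)
    (hnτ : 4 ≤ τ * (n - 1)) :
    pr (fun σ : ProcessSpace n => ∃ J, J ⊆ firstEdges σ m ∧ (J.card : ℝ) ≤ κ * m ∧ ∃ i : α,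
      (2 * (F J i).card / (n : ℝ) ^ 2 + τ) * m < pairs (gr (firstEdges σ m)) (F J i)) ≤
      2 * Fintype.card α * Real.exp (-(τ ^ 2 / 512 * m)) := by
  have h := pr_exists_subset_and_upper hN hm (fun J (i : α × Bool) => side (F J i.1) i.2)
    (t := τ / 4) (κ := κ) (by linarith) (by linarith) (by linarith) (by
      have e1 : 64 / (τ / 4) ^ 2 = 1024 / τ ^ 2 := by field_simp; norm_num
      rw [e1]; linarith)
  rw [Fintype.card_prod, Fintype.card_bool] at h
  refine (pr_mono ?_).trans (h.trans (le_of_eq ?_))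
  · rintro σ ⟨J, h1, h2, i, h3⟩
    obtain ⟨b, hb⟩ := exists_side_of_lt_pairs hn hnτ h3
    exact ⟨J, h1, h2, (i, b), hb⟩
  · push_cast
    have e1 : (τ / 4) ^ 2 / 32 * m = τ ^ 2 / 512 * m := by ring
    rw [e1]; ring

lemma pr_not_pathUniform_le (hn : 1 < n) (hN : 0 < numEdges n) (hm : m ≤ numEdges n) {τ κ : ℝ}
    (hτ : 0 < τ) (hτ1 : τ ≤ 1) (hκ : κ ≤ τ / 8)
    (hκτ : κ * Real.log (1024 / τ ^ 2) ≤ τ ^ 2 / 1024) (hnτ : 4 ≤ τ * (n - 1)) :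
    pr (fun σ : ProcessSpace n => ¬ PathUniform (gr (firstEdges σ m)) κ τ m) ≤
      2 * (4 ^ n * (n + 1)) * Real.exp (-(τ ^ 2 / 512 * m)) := by
  have h := pr_exists_lt_pairs hn hN hm (α := (Finset (Fin n) × Finset (Fin n)) × Option (Fin n))
    (fun J i => i.2.elim (openPairs (gr J) i.1.1 i.1.2) (rotPairs (gr J) i.1.1 i.1.2)) hτ hτ1 hκ
    hκτ hnτ
  refine (pr_mono ?_).trans (h.trans (le_of_eq ?_))
  · intro σ hσ
    by_contra hc
    push Not at hc
    refine hσ fun Γ hΓ hc2 U S => ?_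
    have h1 : ((edgesOf Γ).card : ℝ) ≤ κ * m := by
      have := pairs_gr_univ (edgesOf Γ)
      rw [gr_edgesOf] at this
      rw [this] at hc2
      push_cast at hc2
      linarith
    have h2 := hc (edgesOf Γ) (edgesOf_subset hΓ) h1
    rw [gr_edgesOf, Fintype.card_fin] at *
    exact ⟨fun x => h2 ((U, S), some x), h2 ((U, S), none)⟩
  · simp only [Fintype.card_prod, Fintype.card_finset, Fintype.card_fin, Fintype.card_option]
    push_cast
    rw [← mul_pow]; norm_num

lemma pr_not_uniform_le (hn : 1 < n) (hN : 0 < numEdges n) (hm : m ≤ numEdges n) {τ : ℝ}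
    (hτ : 0 < τ) (hτ1 : τ ≤ 1) (hnτ : 4 ≤ τ * (n - 1)) :
    pr (fun σ : ProcessSpace n => ¬ ∀ A B : Finset (Fin n),
      (pairs (gr (firstEdges σ m)) (A ×ˢ B) : ℝ) ≤ (2 * (A.card * B.card) / (n : ℝ) ^ 2 + τ) * m) ≤
      2 * 4 ^ n * Real.exp (-(τ ^ 2 / 512 * m)) := by
  have h := pr_exists_lt_pairs hn hN hm (α := Finset (Fin n) × Finset (Fin n))
    (fun J i => i.1 ×ˢ i.2) hτ hτ1 (κ := 0) (by linarith) (by rw [zero_mul]; positivity) hnτ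
  refine (pr_mono ?_).trans (h.trans (le_of_eq ?_))
  · intro σ hσ
    push Not at hσ
    obtain ⟨A, B, h1⟩ := hσ
    refine ⟨∅, Finset.empty_subset _, by simp, (A, B), ?_⟩
    simpa [Finset.card_product] using h1
  · simp only [Fintype.card_prod, Fintype.card_finset, Fintype.card_fin]
    push_cast
    rw [← mul_pow]; norm_num

lemma card_und_inter_star (v : Fin n) (S : Finset (EdgeType n)) :
    (und ((Finset.univ.erase v).image fun u => (v, u)) ∩ S).card = (nb (gr S) v).card := by
  rw [card_und_inter, pairs]
  · rw [← Finset.card_image_of_injective (nb (gr S) v) (f := fun u => (v, u))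
      (fun a b h => (Prod.ext_iff.1 h).2)]
    congr 1
    ext ⟨a, b⟩
    simp only [Finset.mem_filter, Finset.mem_image, Finset.mem_erase, Finset.mem_univ, and_true,
      mem_nb, Prod.mk.injEq]
    constructor
    · rintro ⟨⟨u, h1, rfl, rfl⟩, h⟩
      exact ⟨u, h, rfl, rfl⟩
    · rintro ⟨u, h, rfl, rfl⟩
      exact ⟨⟨u, h.ne', rfl, rfl⟩, h⟩
  · simp only [Finset.mem_image, Finset.mem_erase, Finset.mem_univ, and_true]
    rintro q ⟨u, hu, rfl⟩ ⟨w, hw, h⟩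
    exact hu (Prod.ext_iff.1 h).1.symm

lemma card_und_star (v : Fin n) :
    (und ((Finset.univ.erase v).image fun u => (v, u))).card = n - 1 := by
  have h := card_und_inter_star v Finset.univ
  rw [Finset.inter_univ, gr_univ] at h
  rw [h]
  have : nb (⊤ : SimpleGraph (Fin n)) v = Finset.univ.erase v := by
    ext u; simp [mem_nb, eq_comm]
  rw [this, Finset.card_erase_of_mem (Finset.mem_univ v), Finset.card_univ, Fintype.card_fin]

lemma prob_mul_card_und_star (hn : 1 < n) (v : Fin n) :
    prob n m * (und ((Finset.univ.erase v).image fun u => (v, u))).card = 2 * m / n := by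
  rw [card_und_star, prob_eq hn, Nat.cast_sub hn.le]
  have hn1 : (1 : ℝ) < n := by exact_mod_cast hn
  have : (n : ℝ) - 1 ≠ 0 := by linarith
  push_cast
  field_simp

lemma pr_exists_nb_le (hn : 1 < n) (hN : 0 < numEdges n) (hm : m ≤ numEdges n) {η : ℝ}
    (hη : 0 ≤ η) :
    pr (fun σ : ProcessSpace n => ∃ v, ((nb (gr (firstEdges σ m)) v).card : ℝ) ≤
      (1 - η) * (2 * m / n)) ≤ n * Real.exp (-(η ^ 2 / 2 * (2 * m / n))) := by
  have h := pr_exists_le (Finset.univ : Finset (Fin n)) (fun v (σ : ProcessSpace n) =>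
    ((nb (gr (firstEdges σ m)) v).card : ℝ) ≤ (1 - η) * (2 * m / n))
  simp only [Finset.mem_univ, true_and] at h
  refine h.trans ((Finset.sum_le_card_nsmul _ _ (Real.exp (-(η ^ 2 / 2 * (2 * m / n))))
    fun v _ => ?_).trans (le_of_eq ?_))
  · have h1 := pr_card_le hN hm (und ((Finset.univ.erase v).image fun u => (v, u))) hη
    rw [prob_mul_card_und_star hn] at h1
    simp only [card_und_inter_star] at h1
    exact h1
  · rw [Finset.card_univ, Fintype.card_fin, nsmul_eq_mul]

lemma pr_exists_le_nb (hn : 1 < n) (hN : 0 < numEdges n) (hm : m ≤ numEdges n) :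
    pr (fun σ : ProcessSpace n => ∃ v, 4 * (2 * (m : ℝ) / n) ≤ (nb (gr (firstEdges σ m)) v).card) ≤
      n * Real.exp (-(2 * m / n)) := by
  have h := pr_exists_le (Finset.univ : Finset (Fin n)) (fun v (σ : ProcessSpace n) =>
    4 * (2 * (m : ℝ) / n) ≤ (nb (gr (firstEdges σ m)) v).card)
  simp only [Finset.mem_univ, true_and] at h
  refine h.trans ((Finset.sum_le_card_nsmul _ _ (Real.exp (-(2 * m / n))) fun v _ => ?_).trans
    (le_of_eq ?_))
  · have h1 := pr_le_card hN hm (und ((Finset.univ.erase v).image fun u => (v, u)))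
      (4 * (2 * (m : ℝ) / n)) zero_le_one
    rw [prob_mul_card_und_star hn] at h1
    simp only [card_und_inter_star] at h1
    refine h1.trans (Real.exp_le_exp.2 ?_)
    have h2 : (1 : ℝ) / 2 ≤ Real.log (1 + 1) := by
      have := Real.log_two_gt_d9
      norm_num at this ⊢
      linarith
    have h3 : 0 ≤ 2 * (m : ℝ) / n := by positivity
    nlinarith
  · rw [Finset.card_univ, Fintype.card_fin, nsmul_eq_mul]

lemma pairs_square_add_card_le (G : SimpleGraph (Fin n)) (B : Finset (Fin n)) :
    pairs G (B ×ˢ B) + B.card ≤ B.card * B.card := by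
  rw [← Finset.card_product, pairs,
    ← Finset.card_image_of_injective B (f := fun a => (a, a))
      (fun a b h => (Prod.ext_iff.1 h).1), ← Finset.card_union_of_disjoint]
  · refine Finset.card_le_card fun q hq => ?_
    rcases Finset.mem_union.1 hq with hq | hq
    · exact (Finset.mem_filter.1 hq).1
    · obtain ⟨a, ha, rfl⟩ := Finset.mem_image.1 hq
      exact Finset.mem_product.2 ⟨ha, ha⟩
  · rw [Finset.disjoint_left]
    intro q hq hq'
    obtain ⟨a, ha, rfl⟩ := Finset.mem_image.1 hq'
    exact G.irrefl (Finset.mem_filter.1 hq).2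

lemma pr_le_pairs_inside (hn : 1 < n) (hN : 0 < numEdges n) (hm : m ≤ numEdges n)
    {B : Finset (Fin n)} {c γ : ℝ} (hc : 0 < c) (hc1 : c ≤ 1 / 2)
    (hB0 : B.Nonempty) (hBc : (B.card : ℝ) ≤ c * n) :
    pr (fun σ : ProcessSpace n =>
      γ * (2 * m / n) * B.card < pairs (gr (firstEdges σ m)) (B ×ˢ B)) ≤
      Real.exp (2 * m / n * B.card / 2 * (1 - γ * Real.log (1 / c))) := by
  set b := (B.card : ℝ) with hb
  set d := 2 * (m : ℝ) / n with hd
  have hb1 : 1 ≤ b := by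
    rw [hb]; exact_mod_cast hB0.card_pos
  have hn1 : (1 : ℝ) < n := by exact_mod_cast hn
  have hd0 : 0 ≤ d := by positivity
  have hud : dn (B ×ˢ B) = up (B ×ˢ B) := by
    ext e; simp [and_comm]
  have hcard : ((up (B ×ˢ B)).card : ℝ) ≤ b * (b - 1) / 2 := by
    have h1 := card_up_add_card_dn (B ×ˢ B)
    rw [hud] at h1
    have h2 := pairs_square_add_card_le (⊤ : SimpleGraph (Fin n)) B
    rw [← h1] at h2
    have h3 : ((up (B ×ˢ B)).card : ℝ) + (up (B ×ˢ B)).card + b ≤ b * b := by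
      rw [hb]; exact_mod_cast h2
    linarith
  have h := pr_le_card hN hm (up (B ×ˢ B)) (s := 1 / c - 1) (γ * d * b / 2) (by
    rw [sub_nonneg, le_div_iff₀ hc]; linarith)
  refine (pr_mono ?_).trans (h.trans (Real.exp_le_exp.2 ?_))
  · intro σ hσ
    rw [pairs_gr, hud] at hσ
    push_cast at hσ
    linarith
  · rw [add_sub_cancel, prob_eq hn]
    have e1 : 2 * (m : ℝ) / (n * (n - 1)) * (up (B ×ˢ B)).card ≤ d * b / 2 * c := by
      have e2 : 2 * (m : ℝ) / (n * (n - 1)) = d / (n - 1) := by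
        rw [hd]; field_simp
      rw [e2]
      have e3 : 0 ≤ d / (n - 1) := div_nonneg hd0 (by linarith)
      refine (mul_le_mul_of_nonneg_left hcard e3).trans ?_
      have e4 : (b - 1) / (n - 1) ≤ c := by
        rw [div_le_iff₀ (by linarith)]
        linarith
      have e5 : d / (n - 1) * (b * (b - 1) / 2) = d * b / 2 * ((b - 1) / (n - 1)) := by ring
      rw [e5]
      exact mul_le_mul_of_nonneg_left e4 (by positivity)
    have e6 : 0 ≤ 1 / c - 1 := by
      rw [sub_nonneg, le_div_iff₀ hc]; linarith
    have e7 := mul_le_mul_of_nonneg_left e1 e6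
    have e8 : (1 / c - 1) * (d * b / 2 * c) = d * b / 2 * (1 - c) := by field_simp
    have e9 : d * b / 2 * (1 - c) ≤ d * b / 2 * 1 :=
      mul_le_mul_of_nonneg_left (by linarith) (by positivity)
    linarith

lemma pr_exists_lt_pairs_inside (hn : 1 < n) (hN : 0 < numEdges n) (hm : m ≤ numEdges n)
    {c γ y : ℝ} (hc : 0 < c) (hc1 : c ≤ 1 / 2)
    (hy : Real.exp (2 * m / n / 2 * (1 - γ * Real.log (1 / c))) ≤ y) (hny : n * y ≤ 1) :
    pr (fun σ : ProcessSpace n => ¬ ∀ B : Finset (Fin n), (B.card : ℝ) ≤ c * n →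
      (pairs (gr (firstEdges σ m)) (B ×ˢ B) : ℝ) ≤ γ * (2 * m / n) * B.card) ≤ 2 * (n * y) := by
  have hy0 : 0 ≤ y := (Real.exp_pos _).le.trans hy
  set Bs := Finset.univ.filter fun B : Finset (Fin n) => (B.card : ℝ) ≤ c * n ∧ B ≠ ∅ with hBs
  have h := pr_exists_le Bs (fun B (σ : ProcessSpace n) =>
    γ * (2 * m / n) * B.card < pairs (gr (firstEdges σ m)) (B ×ˢ B))
  refine (pr_mono ?_).trans (h.trans ?_)
  · intro σ hσ
    push Not at hσ
    obtain ⟨B, h1, h2⟩ := hσ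
    refine ⟨B, ?_, h2⟩
    rw [hBs, Finset.mem_filter]
    refine ⟨Finset.mem_univ _, h1, ?_⟩
    rintro rfl
    simp [pairs] at h2
  · have h1 : ∀ B ∈ Bs, pr (fun σ : ProcessSpace n =>
        γ * (2 * m / n) * B.card < pairs (gr (firstEdges σ m)) (B ×ˢ B)) ≤ y ^ B.card := by
      intro B hB
      rw [hBs, Finset.mem_filter] at hB
      refine (pr_le_pairs_inside hn hN hm hc hc1 (Finset.nonempty_iff_ne_empty.2 hB.2.2)
        hB.2.1).trans ?_
      refine le_trans (le_of_eq ?_) (pow_le_pow_left₀ (Real.exp_pos _).le hy _)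
      rw [← Real.exp_nat_mul]
      congr 1
      ring
    refine (Finset.sum_le_sum h1).trans ?_
    have h2 : ∑ B ∈ Bs, y ^ B.card + y ^ (∅ : Finset (Fin n)).card ≤
        ∑ B : Finset (Fin n), y ^ B.card := by
      rw [← Finset.sum_erase_add _ _ (Finset.mem_univ (∅ : Finset (Fin n)))]
      gcongr
      intro B hB
      rw [hBs, Finset.mem_filter] at hB
      simpa using hB.2.2
    have h3 : ∑ B : Finset (Fin n), y ^ B.card = (1 + y) ^ n := by
      have h4 := Finset.prod_one_add (s := (Finset.univ : Finset (Fin n))) (f := fun _ => y)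
      rw [Finset.prod_const, Finset.card_univ, Fintype.card_fin, Finset.powerset_univ] at h4
      rw [h4]
      exact Finset.sum_congr rfl fun J _ => (Finset.prod_const _).symm
    rw [h3, Finset.card_empty, pow_zero] at h2
    have h4 : (1 + y) ^ n ≤ 1 + 2 * (n * y) := by
      refine (one_add_pow_le_exp hy0 n).trans ?_
      have h5 : 0 ≤ y * n := by positivity
      have h6 : |Real.exp (y * n) - 1 - y * n| ≤ (y * n) ^ 2 :=
        Real.abs_exp_sub_one_sub_id_le (by rw [abs_of_nonneg h5]; linarith)
      have h7 := (abs_le.1 h6).2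
      have h8 : (y * n) ^ 2 ≤ y * n * 1 := by
        rw [sq]; exact mul_le_mul_of_nonneg_left (by linarith) h5
      linarith
    linarith

end Uniformity

section TinyVertices
open scoped Classical
variable {n m₀ m₁ : ℕ}

/-- The vertices of degree less than `x`. -/
def tiny (G : SimpleGraph (Fin n)) (x : ℝ) : Finset (Fin n) :=
  Finset.univ.filter fun v => ((nb G v).card : ℝ) < x

lemma le_pairs_compl (G : SimpleGraph (Fin n)) {R : Finset (Fin n)} {D : ℝ}
    (hD : ∀ v, D ≤ (nb G v).card) :
    R.card * D - (R.card : ℝ) ^ 2 ≤ pairs G (R ×ˢ Rᶜ) := by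
  have h1 : pairs G (R ×ˢ Finset.univ) ≤ pairs G (R ×ˢ Rᶜ) + pairs G (R ×ˢ R) := by
    refine le_trans (pairs_mono G fun q hq _ => ?_) (pairs_union_le _ _ _)
    rw [Finset.mem_union, Finset.mem_product, Finset.mem_product, Finset.mem_compl]
    have := (Finset.mem_product.1 hq).1
    tauto
  have h2 := pairs_square_add_card_le G R
  have h3 : (R.card : ℝ) * D ≤ pairs G (R ×ˢ Finset.univ) := by
    rw [pairs_univ_right]
    push_cast
    rw [← nsmul_eq_mul]
    exact Finset.card_nsmul_le_sum _ _ _ fun v _ => hD v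
  have h4 : (pairs G (R ×ˢ Finset.univ) : ℝ) ≤ pairs G (R ×ˢ Rᶜ) + pairs G (R ×ˢ R) := by
    exact_mod_cast h1
  have h5 : (pairs G (R ×ˢ R) : ℝ) + R.card ≤ R.card * R.card := by exact_mod_cast h2
  have h6 : (0 : ℝ) ≤ R.card := Nat.cast_nonneg _
  rw [sq]
  linarith

lemma pairs_compl_le (G : SimpleGraph (Fin n)) {R : Finset (Fin n)} {x : ℝ}
    (hx : R ⊆ tiny G x) : (pairs G (R ×ˢ Rᶜ) : ℝ) ≤ R.card * x := by
  have h1 : pairs G (R ×ˢ Rᶜ) ≤ pairs G (R ×ˢ Finset.univ) :=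
    pairs_mono G fun q hq _ => Finset.mem_product.2
      ⟨(Finset.mem_product.1 hq).1, Finset.mem_univ _⟩
  have h2 : (pairs G (R ×ˢ Rᶜ) : ℝ) ≤ pairs G (R ×ˢ Finset.univ) := by exact_mod_cast h1
  refine h2.trans ?_
  rw [pairs_univ_right]
  push_cast
  rw [← nsmul_eq_mul]
  refine Finset.sum_le_card_nsmul _ _ _ fun v hv => ?_
  have := hx hv
  rw [tiny, Finset.mem_filter] at this
  exact this.2.le

/-- The bound for the probability that `r` given vertices are tiny, given the later graph. -/
def tinyBound (m₀ m₁ r : ℕ) (D x θ : ℝ) : ℝ :=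
  Real.exp (r * x * Real.log (1 / θ) - (1 - θ) * ((m₀ : ℝ) / m₁) * (r * D - (r : ℝ) ^ 2))

lemma pr_subset_tiny_le (hm₁0 : 0 < m₁) (hm : m₀ ≤ m₁) (hm₁ : m₁ ≤ numEdges n)
    {P : Finset (EdgeType n) → Prop} {R : Finset (Fin n)} {D x θ : ℝ}
    (hP : ∀ S, P S → ∀ v, D ≤ (nb (gr S) v).card) (hθ : 0 < θ) (hθ1 : θ ≤ 1) :
    pr (fun σ : ProcessSpace n => P (firstEdges σ m₁) ∧ R ⊆ tiny (gr (firstEdges σ m₀)) x) ≤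
      pr (fun σ : ProcessSpace n => P (firstEdges σ m₁)) * tinyBound m₀ m₁ R.card D x θ := by
  have hR : ∀ q ∈ R ×ˢ Rᶜ, q.swap ∉ R ×ˢ Rᶜ := by
    rintro ⟨a, b⟩ h h'
    rw [Prod.swap_prod_mk, Finset.mem_product] at h'
    rw [Finset.mem_product] at h
    exact (Finset.mem_compl.1 h.2) h'.1
  have h := avg_pow_le_of_le hm₁0 hm hm₁ (fun S => if P S then 1 else 0)
    (fun S => by split_ifs <;> norm_num) (fun S => und (R ×ˢ Rᶜ) ∩ S)
    (fun S => Finset.inter_subset_right) hθ hθ1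
  have h1 : ∀ σ : ProcessSpace n, ((und (R ×ˢ Rᶜ) ∩ firstEdges σ m₁) ∩ firstEdges σ m₀).card =
      pairs (gr (firstEdges σ m₀)) (R ×ˢ Rᶜ) := by
    intro σ
    rw [Finset.inter_assoc, Finset.inter_eq_right.2 (firstEdges_mono σ hm), card_und_inter hR]
  simp only [h1, card_und_inter hR] at h
  set L := R.card * x * Real.log (1 / θ) with hL
  have hlog : 0 ≤ Real.log (1 / θ) := Real.log_nonneg (by rw [le_div_iff₀ hθ]; linarith)
  have h2 : pr (fun σ : ProcessSpace n => P (firstEdges σ m₁) ∧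
      R ⊆ tiny (gr (firstEdges σ m₀)) x) ≤
      avg (fun σ : ProcessSpace n => ((if P (firstEdges σ m₁) then 1 else 0) *
        θ ^ pairs (gr (firstEdges σ m₀)) (R ×ˢ Rᶜ)) * Real.exp L) := by
    refine pr_le_avg (fun σ => by split_ifs <;> positivity) ?_
    rintro σ ⟨h3, h4⟩
    rw [if_pos h3, one_mul]
    have h5 : θ = Real.exp (-Real.log (1 / θ)) := by
      rw [one_div, Real.log_inv, neg_neg, Real.exp_log hθ]
    have h6 := mul_le_mul_of_nonneg_right (pairs_compl_le _ h4) hlog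
    have h7 : θ ^ pairs (gr (firstEdges σ m₀)) (R ×ˢ Rᶜ) =
        Real.exp (-(pairs (gr (firstEdges σ m₀)) (R ×ˢ Rᶜ) * Real.log (1 / θ))) := by
      conv_lhs => rw [h5]
      rw [← Real.exp_nat_mul]; congr 1; ring
    rw [h7, ← Real.exp_add]
    apply Real.one_le_exp
    linarith
  refine h2.trans ?_
  rw [avg_mul_const]
  refine (mul_le_mul_of_nonneg_right h (Real.exp_pos _).le).trans ?_
  rw [← avg_mul_const, pr, ← avg_mul_const]
  refine avg_mono fun σ => ?_
  split_ifs with h3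
  · rw [one_mul, one_mul, tinyBound, ← Real.exp_add]
    apply Real.exp_le_exp.2
    have h4 := le_pairs_compl (gr (firstEdges σ m₁)) (R := R) (hP _ h3)
    have h5 : 0 ≤ (1 - θ) * ((m₀ : ℝ) / m₁) := mul_nonneg (by linarith) (by positivity)
    have h6 := mul_le_mul_of_nonneg_left h4 h5
    linarith
  · simp

lemma card_ball_le (G : SimpleGraph (Fin n)) {L : ℕ} (hL : ∀ v, (nb G v).card ≤ L) (k : ℕ)
    (c : Fin n) : (ball G k c).card ≤ (L + 1) ^ k := by
  induction k with
  | zero => simp [ball]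
  | succ k ih =>
    rw [ball]
    refine (Finset.card_union_le _ _).trans ?_
    have h1 : ((ball G k c).biUnion (nb G)).card ≤ (ball G k c).card * L :=
      Finset.card_biUnion_le_card_mul _ _ _ fun v _ => hL v
    rw [pow_succ]
    calc _ ≤ (ball G k c).card + (ball G k c).card * L := by omega
      _ = (ball G k c).card * (L + 1) := by ring
      _ ≤ _ := Nat.mul_le_mul_right _ ih

/-- All degrees lie between `D` and `L`. -/
def Balanced (D : ℝ) (L : ℕ) (S : Finset (EdgeType n)) : Prop :=
  ∀ v, D ≤ (nb (gr S) v).card ∧ (nb (gr S) v).card ≤ L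

lemma pr_ball_le (hm₁0 : 0 < m₁) (hm : m₀ ≤ m₁) (hm₁ : m₁ ≤ numEdges n) {D x θ : ℝ} {L : ℕ}
    (hθ : 0 < θ) (hθ1 : θ ≤ 1) :
    pr (fun σ : ProcessSpace n => Balanced D L (firstEdges σ m₁) ∧
      ∃ c, 2 < (tiny (gr (firstEdges σ m₀)) x ∩ ball (gr (firstEdges σ m₁)) 3 c).card) ≤
      n * ((L : ℝ) + 1) ^ 9 * tinyBound m₀ m₁ 3 D x θ := by
  set P : Fin n → Finset (Fin n) → Finset (EdgeType n) → Prop :=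
    fun c R S => Balanced D L S ∧ R ⊆ ball (gr S) 3 c with hP
  have h1 : pr (fun σ : ProcessSpace n => Balanced D L (firstEdges σ m₁) ∧
      ∃ c, 2 < (tiny (gr (firstEdges σ m₀)) x ∩ ball (gr (firstEdges σ m₁)) 3 c).card) ≤
      ∑ c : Fin n, ∑ R ∈ Finset.powersetCard 3 (Finset.univ : Finset (Fin n)),
        pr (fun σ : ProcessSpace n => P c R (firstEdges σ m₁)) * tinyBound m₀ m₁ 3 D x θ := by
    refine (pr_mono (P' := fun σ => ∃ c ∈ (Finset.univ : Finset (Fin n)),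
      ∃ R ∈ Finset.powersetCard 3 (Finset.univ : Finset (Fin n)), P c R (firstEdges σ m₁) ∧
        R ⊆ tiny (gr (firstEdges σ m₀)) x) ?_).trans ?_
    · rintro σ ⟨h1, c, h2⟩
      obtain ⟨R, hR, hR3⟩ := Finset.exists_subset_card_eq (Nat.succ_le_of_lt h2)
      exact ⟨c, Finset.mem_univ _, R, Finset.mem_powersetCard.2 ⟨Finset.subset_univ _, hR3⟩,
        ⟨h1, hR.trans Finset.inter_subset_right⟩, hR.trans Finset.inter_subset_left⟩
    · refine (pr_exists_le _ _).trans (Finset.sum_le_sum fun c _ => ?_)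
      refine (pr_exists_le _ _).trans (Finset.sum_le_sum fun R hR => ?_)
      have h2 := pr_subset_tiny_le (R := R) (x := x) hm₁0 hm hm₁ (P := P c R)
        (fun S hS v => (hS.1 v).1) hθ hθ1
      rwa [(Finset.mem_powersetCard.1 hR).2] at h2
  refine h1.trans ?_
  simp_rw [← Finset.sum_mul]
  refine mul_le_mul_of_nonneg_right ?_ (Real.exp_pos _).le
  rw [← nsmul_eq_mul]
  have h2 : (Finset.univ : Finset (Fin n)).card = n := by simp
  conv_rhs => rw [← h2]
  refine Finset.sum_le_card_nsmul _ _ _ fun c _ => ?_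
  unfold pr
  rw [← avg_sum]
  refine (avg_mono (g := fun _ => ((L : ℝ) + 1) ^ 9) fun σ => ?_).trans (le_of_eq (avg_const _))
  by_cases hB : Balanced D L (firstEdges σ m₁)
  · beta_reduce
    simp only [Finset.sum_boole]
    have h3 : ((Finset.powersetCard 3 (Finset.univ : Finset (Fin n))).filter fun R =>
        P c R (firstEdges σ m₁)) ⊆ Finset.powersetCard 3 (ball (gr (firstEdges σ m₁)) 3 c) := by
      intro R hR
      rw [Finset.mem_filter, Finset.mem_powersetCard] at hR
      exact Finset.mem_powersetCard.2 ⟨hR.2.2, hR.1.2⟩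
    have h4 := Finset.card_le_card h3
    rw [Finset.card_powersetCard] at h4
    have h5 := h4.trans (Nat.choose_le_pow _ 3)
    have h6 := Nat.pow_le_pow_left (card_ball_le (gr (firstEdges σ m₁)) (fun v => (hB v).2) 3 c) 3
    rw [← pow_mul] at h6
    have h7 : ((((Finset.powersetCard 3 (Finset.univ : Finset (Fin n))).filter fun R =>
        P c R (firstEdges σ m₁)).card : ℕ) : ℝ) ≤ ((L : ℝ) + 1) ^ 9 := by
      exact_mod_cast h5.trans h6
    convert h7
    rfl
  · rw [Finset.sum_eq_zero]
    · positivity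
    · intro R _
      rw [if_neg]
      exact fun h => hB h.1

lemma pr_config_le (hN : 0 < numEdges n) (hm₁0 : 0 < m₁) (hm : m₀ ≤ m₁) (hm₁ : m₁ ≤ numEdges n)
    {D x θ : ℝ} {L k : ℕ} (hθ : 0 < θ) (hθ1 : θ ≤ 1) {a b : Fin n} (hab : a ≠ b)
    {F : Finset (Fin n × Fin n)} (hF : ∀ q ∈ F, q.swap ∉ F) (hF' : ∀ q ∈ F, q.1 ≠ q.2)
    (hk : F.card = k) :
    pr (fun σ : ProcessSpace n => Balanced D L (firstEdges σ m₁) ∧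
      (∀ q ∈ F, (gr (firstEdges σ m₁)).Adj q.1 q.2) ∧
      a ∈ tiny (gr (firstEdges σ m₀)) x ∧ b ∈ tiny (gr (firstEdges σ m₀)) x) ≤
      prob n m₁ ^ k * tinyBound m₀ m₁ 2 D x θ := by
  have h := pr_subset_tiny_le (R := {a, b}) (x := x) hm₁0 hm hm₁
    (P := fun S => Balanced D L S ∧ ∀ q ∈ F, (gr S).Adj q.1 q.2)
    (fun S hS v => (hS.1 v).1) hθ hθ1
  rw [Finset.card_pair hab] at h
  refine (pr_mono ?_).trans (h.trans (mul_le_mul_of_nonneg_right ?_ (Real.exp_pos _).le))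
  · rintro σ ⟨h1, h2, h3, h4⟩
    refine ⟨⟨h1, h2⟩, ?_⟩
    intro v hv
    rw [Finset.mem_insert, Finset.mem_singleton] at hv
    rcases hv with rfl | rfl
    · exact h3
    · exact h4
  · rw [← hk, ← card_und hF hF']
    exact (pr_mono fun σ hσ => und_subset hσ.2).trans (pr_subset_le hN hm₁ _)

lemma pr_tri_le (hN : 0 < numEdges n) (hm₁0 : 0 < m₁) (hm : m₀ ≤ m₁) (hm₁ : m₁ ≤ numEdges n)
    {D x θ : ℝ} {L : ℕ} (hθ : 0 < θ) (hθ1 : θ ≤ 1) (a b u : Fin n) :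
    pr (fun σ : ProcessSpace n => Balanced D L (firstEdges σ m₁) ∧
      ((gr (firstEdges σ m₁)).Adj a b ∧ (gr (firstEdges σ m₁)).Adj a u ∧
        (gr (firstEdges σ m₁)).Adj b u) ∧
      a ∈ tiny (gr (firstEdges σ m₀)) x ∧ b ∈ tiny (gr (firstEdges σ m₀)) x) ≤
      prob n m₁ ^ 3 * tinyBound m₀ m₁ 2 D x θ := by
  by_cases hd : a ≠ b ∧ a ≠ u ∧ b ≠ u
  · obtain ⟨h1, h2, h3⟩ := hd
    refine (pr_mono ?_).trans (pr_config_le (L := L) (F := {(a, b), (a, u), (b, u)}) hN hm₁0 hm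
      hm₁ hθ hθ1 h1 ?_ ?_ ?_)
    · rintro σ ⟨h4, ⟨h5, h6, h7⟩, h8⟩
      refine ⟨h4, ?_, h8⟩
      simp only [Finset.mem_insert, Finset.mem_singleton]
      rintro q (rfl | rfl | rfl) <;> assumption
    · simp only [Finset.mem_insert, Finset.mem_singleton]
      rintro q (rfl | rfl | rfl) <;> simp [h1, h2, h3, h1.symm, h2.symm, h3.symm]
    · simp only [Finset.mem_insert, Finset.mem_singleton]
      rintro q (rfl | rfl | rfl) <;> assumption
    · rw [Finset.card_eq_three]
      exact ⟨_, _, _, by simp [h3], by simp [h1], by simp [h1], rfl⟩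
  · refine le_trans (pr_mono (P' := fun _ => False) ?_) ?_
    · rintro σ ⟨-, ⟨h5, h6, h7⟩, -⟩
      exact hd ⟨h5.ne, h6.ne, h7.ne⟩
    · simp only [pr, if_false]
      rw [avg_const]
      exact mul_nonneg (pow_nonneg (prob_nonneg _ _) _) (Real.exp_pos _).le

lemma pr_quad_le (hN : 0 < numEdges n) (hm₁0 : 0 < m₁) (hm : m₀ ≤ m₁) (hm₁ : m₁ ≤ numEdges n)
    {D x θ : ℝ} {L : ℕ} (hθ : 0 < θ) (hθ1 : θ ≤ 1) (a b u v : Fin n) :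
    pr (fun σ : ProcessSpace n => Balanced D L (firstEdges σ m₁) ∧
      (a ≠ b ∧ u ≠ v ∧ (gr (firstEdges σ m₁)).Adj a u ∧ (gr (firstEdges σ m₁)).Adj b u ∧
        (gr (firstEdges σ m₁)).Adj a v ∧ (gr (firstEdges σ m₁)).Adj b v) ∧
      a ∈ tiny (gr (firstEdges σ m₀)) x ∧ b ∈ tiny (gr (firstEdges σ m₀)) x) ≤
      prob n m₁ ^ 4 * tinyBound m₀ m₁ 2 D x θ := by
  by_cases hd : a ≠ b ∧ u ≠ v ∧ a ≠ u ∧ b ≠ u ∧ a ≠ v ∧ b ≠ v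
  · obtain ⟨h1, h2, h3, h4, h5, h6⟩ := hd
    refine (pr_mono ?_).trans (pr_config_le (L := L) (F := {(a, u), (b, u), (a, v), (b, v)}) hN
      hm₁0 hm hm₁ hθ hθ1 h1 ?_ ?_ ?_)
    · rintro σ ⟨g1, ⟨-, -, g2, g3, g4, g5⟩, g6⟩
      refine ⟨g1, ?_, g6⟩
      simp only [Finset.mem_insert, Finset.mem_singleton]
      rintro q (rfl | rfl | rfl | rfl) <;> assumption
    · simp only [Finset.mem_insert, Finset.mem_singleton]
      rintro q (rfl | rfl | rfl | rfl) <;>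
        simp [h3, h4, h5, h6, h3.symm, h4.symm, h5.symm, h6.symm]
    · simp only [Finset.mem_insert, Finset.mem_singleton]
      rintro q (rfl | rfl | rfl | rfl) <;> assumption
    · rw [Finset.card_insert_of_notMem (by simp [h1, h2]),
        Finset.card_insert_of_notMem (by simp [h1.symm, h2]),
        Finset.card_insert_of_notMem (by simp [h1]), Finset.card_singleton]
  · refine le_trans (pr_mono (P' := fun _ => False) ?_) ?_
    · rintro σ ⟨-, ⟨g1, g2, g3, g4, g5, g6⟩, -⟩
      exact hd ⟨g1, g2, g3.ne, g4.ne, g5.ne, g6.ne⟩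
    · simp only [pr, if_false]
      rw [avg_const]
      exact mul_nonneg (pow_nonneg (prob_nonneg _ _) _) (Real.exp_pos _).le

lemma pr_balanced_not_sparse_le (hN : 0 < numEdges n) (hm₁0 : 0 < m₁) (hm : m₀ ≤ m₁)
    (hm₁ : m₁ ≤ numEdges n) {D x θ : ℝ} {L : ℕ} (hθ : 0 < θ) (hθ1 : θ ≤ 1) :
    pr (fun σ : ProcessSpace n => Balanced D L (firstEdges σ m₁) ∧
      ¬ Sparse (gr (firstEdges σ m₁)) (tiny (gr (firstEdges σ m₀)) x)) ≤
      n * ((L : ℝ) + 1) ^ 9 * tinyBound m₀ m₁ 3 D x θ +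
      (n * (n * (n * (prob n m₁ ^ 3 * tinyBound m₀ m₁ 2 D x θ))) +
       n * (n * (n * (n * (prob n m₁ ^ 4 * tinyBound m₀ m₁ 2 D x θ))))) := by
  set Tri : Fin n → Fin n → Fin n → ProcessSpace n → Prop := fun a b u σ =>
    Balanced D L (firstEdges σ m₁) ∧
      ((gr (firstEdges σ m₁)).Adj a b ∧ (gr (firstEdges σ m₁)).Adj a u ∧
        (gr (firstEdges σ m₁)).Adj b u) ∧
      a ∈ tiny (gr (firstEdges σ m₀)) x ∧ b ∈ tiny (gr (firstEdges σ m₀)) x with hTri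
  set Quad : Fin n → Fin n → Fin n → Fin n → ProcessSpace n → Prop := fun a b u v σ =>
    Balanced D L (firstEdges σ m₁) ∧
      (a ≠ b ∧ u ≠ v ∧ (gr (firstEdges σ m₁)).Adj a u ∧ (gr (firstEdges σ m₁)).Adj b u ∧
        (gr (firstEdges σ m₁)).Adj a v ∧ (gr (firstEdges σ m₁)).Adj b v) ∧
      a ∈ tiny (gr (firstEdges σ m₀)) x ∧ b ∈ tiny (gr (firstEdges σ m₀)) x with hQuad
  have key : ∀ (P : Fin n → ProcessSpace n → Prop) (y : ℝ), (∀ a, pr (P a) ≤ y) →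
      pr (fun σ => ∃ a, P a σ) ≤ n * y := by
    intro P y hy
    have h := pr_exists_le (Finset.univ : Finset (Fin n)) P
    simp only [Finset.mem_univ, true_and] at h
    refine h.trans ((Finset.sum_le_card_nsmul _ _ y fun a _ => hy a).trans (le_of_eq ?_))
    rw [Finset.card_univ, Fintype.card_fin, nsmul_eq_mul]
  refine (pr_mono (P' := fun σ => (Balanced D L (firstEdges σ m₁) ∧
      ∃ c, 2 < (tiny (gr (firstEdges σ m₀)) x ∩ ball (gr (firstEdges σ m₁)) 3 c).card) ∨
      ((∃ a b u, Tri a b u σ) ∨ ∃ a b u v, Quad a b u v σ)) ?_).trans ?_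
  · rintro σ ⟨h1, h2⟩
    by_contra hc
    push Not at hc
    obtain ⟨h3, h4, h5⟩ := hc
    refine h2 ⟨h3 h1, ?_, ?_⟩
    · intro a ha b hb u h6 h7 h8
      exact h4 a b u ⟨h1, ⟨h6, h7, h8⟩, ha, hb⟩
    · intro a ha b hb u v h6 h7 h8 h9 h10 h11
      exact h5 a b u v ⟨h1, ⟨h6, h7, h8, h9, h10, h11⟩, ha, hb⟩
  · refine (pr_or_le _ _).trans (add_le_add (pr_ball_le hm₁0 hm hm₁ hθ hθ1) ?_)
    refine (pr_or_le _ _).trans (add_le_add ?_ ?_)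
    · exact key _ _ fun a => key _ _ fun b => key _ _ fun u =>
        pr_tri_le hN hm₁0 hm hm₁ hθ hθ1 a b u
    · exact key _ _ fun a => key _ _ fun b => key _ _ fun u => key _ _ fun v =>
        pr_quad_le hN hm₁0 hm hm₁ hθ hθ1 a b u v

end TinyVertices

section Estimates
open scoped Classical
variable {n m m₀ m₁ : ℕ}

lemma one_le_log_div {ε : ℝ} (hε : 0 < ε) (hε1 : ε ≤ 1 / 10) : 1 ≤ Real.log (8 / ε) := by
  rw [Real.le_log_iff_exp_le (by positivity)]
  refine Real.exp_one_lt_d9.le.trans ?_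
  rw [le_div_iff₀ hε]
  linarith

lemma tinyBound_le {ε ℓ : ℝ} (hε : 0 < ε) (hε1 : ε ≤ 1 / 10) (hℓ : 0 ≤ ℓ) (hn : 0 < n)
    (hm : m₀ ≤ m₁) (hm₁ : 0 < m₁) (hm₀ : (1 + ε) / 6 * n * ℓ ≤ m₀) (r : ℕ) :
    tinyBound m₀ m₁ r ((1 - ε / 8) * (2 * m₁ / n)) (ε / (24 * Real.log (8 / ε)) * ℓ) (ε / 8) ≤
      Real.exp ((r : ℝ) ^ 2 - r * ((1 + ε / 2) / 3 * ℓ)) := by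
  have hlog := one_le_log_div hε hε1
  have hn0 : (0 : ℝ) < n := by exact_mod_cast hn
  have hm10 : (0 : ℝ) < m₁ := by exact_mod_cast hm₁
  have hr : (0 : ℝ) ≤ r := Nat.cast_nonneg r
  unfold tinyBound
  apply Real.exp_le_exp.2
  have e1 : (1 : ℝ) / (ε / 8) = 8 / ε := by field_simp
  rw [e1]
  have e2 : r * (ε / (24 * Real.log (8 / ε)) * ℓ) * Real.log (8 / ε) = r * ℓ * (ε / 24) := by
    field_simp
  rw [e2]
  set a := (m₀ : ℝ) / m₁ with ha
  have ha0 : 0 ≤ a := by positivity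
  have ha1 : a ≤ 1 := by
    rw [ha, div_le_one hm10]; exact_mod_cast hm
  have e3 : a * (2 * m₁ / n) = 2 * m₀ / n := by rw [ha]; field_simp
  have e4 : (1 + ε) / 3 * ℓ ≤ a * (2 * m₁ / n) := by
    rw [e3, le_div_iff₀ hn0]; linarith
  have e5 : (1 - ε / 8) * a * (r : ℝ) ^ 2 ≤ (r : ℝ) ^ 2 := by
    have : (1 - ε / 8) * a ≤ 1 := by
      have := mul_le_mul (by linarith : 1 - ε / 8 ≤ 1) ha1 ha0 zero_le_one
      linarith
    exact mul_le_of_le_one_left (by positivity) this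
  have e6 : (1 + 5 * ε / 8) ≤ (1 - ε / 8) ^ 2 * (1 + ε) := by nlinarith [pow_pos hε 2, pow_pos hε 3]
  have e7 : (1 - ε / 8) ^ 2 * r * ((1 + ε) / 3 * ℓ) ≤ (1 - ε / 8) ^ 2 * r * (a * (2 * m₁ / n)) :=
    mul_le_mul_of_nonneg_left e4 (by positivity)
  have e8 := mul_le_mul_of_nonneg_right e6 (by positivity : 0 ≤ r * ℓ / 3)
  have e9 : (1 - ε / 8) * a * (r * ((1 - ε / 8) * (2 * m₁ / n)) - (r : ℝ) ^ 2) =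
    (1 - ε / 8) ^ 2 * r * (a * (2 * m₁ / n)) - (1 - ε / 8) * a * (r : ℝ) ^ 2 := by ring
  rw [e9]
  linarith

/-- The bound for the failure of sparsity, as a function of the logarithm of `n`. -/
def sparseBound (ε C ℓ : ℝ) : ℝ :=
  (13 * C * ℓ) ^ 9 * Real.exp (9 - ε / 2 * ℓ) +
    ((6 * C * ℓ) ^ 3 * Real.exp (4 - 2 / 3 * ℓ) + (6 * C * ℓ) ^ 4 * Real.exp (4 - 2 / 3 * ℓ))

lemma tendsto_pow_mul_exp (a b c : ℝ) (k : ℕ) (hc : 0 < c) :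
    Tendsto (fun ℓ : ℝ => (a * ℓ) ^ k * Real.exp (b - c * ℓ)) atTop (nhds 0) := by
  have h := (tendsto_rpow_mul_exp_neg_mul_atTop_nhds_zero k c hc).const_mul (a ^ k * Real.exp b)
  rw [mul_zero] at h
  refine h.congr fun ℓ => ?_
  rw [Real.rpow_natCast, mul_pow, sub_eq_add_neg, Real.exp_add, neg_mul]
  ring

lemma tendsto_sparseBound {ε : ℝ} (hε : 0 < ε) (C : ℝ) :
    Tendsto (sparseBound ε C) atTop (nhds 0) := by
  have h := (tendsto_pow_mul_exp (13 * C) 9 (ε / 2) 9 (by positivity)).add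
    ((tendsto_pow_mul_exp (6 * C) 4 (2 / 3) 3 (by positivity)).add
      (tendsto_pow_mul_exp (6 * C) 4 (2 / 3) 4 (by positivity)))
  simp only [add_zero] at h
  exact h

lemma pr_not_sparse_le {ε C ℓ : ℝ} (hε : 0 < ε) (hε1 : ε ≤ 1 / 10) (hC : 1 ≤ C) (hn : 1 < n)
    (hℓ : ℓ = Real.log n) (hℓ1 : 1 ≤ ℓ) (hN : 0 < numEdges n) (hm : m₀ ≤ m₁) (hm₁0 : 0 < m₁)
    (hm₁ : m₁ ≤ numEdges n) (hm₀ : (1 + ε) / 6 * n * ℓ ≤ m₀) (hd : 2 * (m₁ : ℝ) / n ≤ 3 * C * ℓ) :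
    pr (fun σ : ProcessSpace n =>
      Balanced ((1 - ε / 8) * (2 * m₁ / n)) ⌊4 * (2 * (m₁ : ℝ) / n)⌋₊ (firstEdges σ m₁) ∧
      ¬ Sparse (gr (firstEdges σ m₁))
        (tiny (gr (firstEdges σ m₀)) (ε / (24 * Real.log (8 / ε)) * ℓ))) ≤
      sparseBound ε C ℓ := by
  have hn1 : (1 : ℝ) < n := by exact_mod_cast hn
  have hn2 : (2 : ℝ) ≤ n := by exact_mod_cast hn
  have hexp : Real.exp ℓ = n := by rw [hℓ, Real.exp_log (by linarith)]
  refine (pr_balanced_not_sparse_le hN hm₁0 hm hm₁ (by positivity : 0 < ε / 8)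
    (by linarith)).trans ?_
  set d := 2 * (m₁ : ℝ) / n with hdd
  have hd0 : 0 ≤ d := by positivity
  have hL : ((⌊4 * d⌋₊ : ℕ) : ℝ) ≤ 4 * d := Nat.floor_le (by positivity)
  have hCℓ : 1 ≤ C * ℓ := one_le_mul_of_one_le_of_one_le hC hℓ1
  have t3 := tinyBound_le hε hε1 (by linarith) (by omega) hm hm₁0 hm₀ 3
  have t2 := tinyBound_le hε hε1 (by linarith) (by omega) hm hm₁0 hm₀ 2
  rw [← hdd] at t3 t2
  set b3 := tinyBound m₀ m₁ 3 ((1 - ε / 8) * d) (ε / (24 * Real.log (8 / ε)) * ℓ) (ε / 8)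
  set b2 := tinyBound m₀ m₁ 2 ((1 - ε / 8) * d) (ε / (24 * Real.log (8 / ε)) * ℓ) (ε / 8) with hb2
  have hb20 : 0 ≤ b2 := (Real.exp_pos _).le
  have t2' : b2 ≤ Real.exp (4 - 2 / 3 * ℓ) := by
    refine t2.trans (Real.exp_le_exp.2 ?_)
    push_cast
    have := mul_nonneg hε.le (by linarith : (0 : ℝ) ≤ ℓ)
    linarith
  have t3' : n * b3 ≤ Real.exp (9 - ε / 2 * ℓ) := by
    rw [← hexp]
    refine (mul_le_mul_of_nonneg_left t3 (Real.exp_pos _).le).trans ?_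
    rw [← Real.exp_add]
    apply Real.exp_le_exp.2
    push_cast
    linarith
  have hp : n * prob n m₁ ≤ 6 * C * ℓ := by
    rw [prob_eq hn]
    have e1 : n * (2 * (m₁ : ℝ) / (n * (n - 1))) = d * (n / (n - 1)) := by
      have : (n : ℝ) - 1 ≠ 0 := by linarith
      rw [hdd]; field_simp
    have e2 : (n : ℝ) / (n - 1) ≤ 2 := by
      rw [div_le_iff₀ (by linarith)]; linarith
    rw [e1]
    have := mul_le_mul_of_nonneg_left e2 hd0
    linarith
  have hp0 : 0 ≤ n * prob n m₁ := mul_nonneg (by linarith) (prob_nonneg _ _)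
  unfold sparseBound
  refine add_le_add ?_ (add_le_add ?_ ?_)
  · have e1 : (((⌊4 * d⌋₊ : ℕ) : ℝ) + 1) ^ 9 ≤ (13 * C * ℓ) ^ 9 :=
      pow_le_pow_left₀ (by positivity) (by linarith) 9
    calc n * (((⌊4 * d⌋₊ : ℕ) : ℝ) + 1) ^ 9 * b3 = (((⌊4 * d⌋₊ : ℕ) : ℝ) + 1) ^ 9 * (n * b3) := by
          ring
      _ ≤ (13 * C * ℓ) ^ 9 * Real.exp (9 - ε / 2 * ℓ) :=
        mul_le_mul e1 t3' (mul_nonneg (by linarith) (Real.exp_pos _).le) (by positivity)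
  · calc n * (n * (n * (prob n m₁ ^ 3 * b2))) = (n * prob n m₁) ^ 3 * b2 := by ring
      _ ≤ _ := mul_le_mul (pow_le_pow_left₀ hp0 hp 3) t2' hb20 (by positivity)
  · calc n * (n * (n * (n * (prob n m₁ ^ 4 * b2)))) = (n * prob n m₁) ^ 4 * b2 := by ring
      _ ≤ _ := mul_le_mul (pow_le_pow_left₀ hp0 hp 4) t2' hb20 (by positivity)

lemma uniform_tail_le {τ ℓ : ℝ} (hn : 1 < n) (hℓ : ℓ = Real.log n) (hℓτ : 24576 / τ ^ 2 ≤ ℓ)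
    (hτ : 0 < τ) (hm : n * ℓ / 6 ≤ m) :
    2 * (4 ^ n * ((n : ℝ) + 1)) * Real.exp (-(τ ^ 2 / 512 * m)) ≤ Real.exp (-(4 * ℓ)) := by
  have hn1 : (1 : ℝ) < n := by exact_mod_cast hn
  have h4 : (4 : ℝ) ^ n ≤ Real.exp (2 * n) := by
    rw [mul_comm, Real.exp_nat_mul]
    refine pow_le_pow_left₀ (by norm_num) ?_ n
    have := Real.add_one_le_exp (1 : ℝ)
    have h2 : Real.exp 2 = Real.exp 1 * Real.exp 1 := by rw [← Real.exp_add]; norm_num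
    rw [h2]
    nlinarith
  have h5 : (n : ℝ) + 1 ≤ Real.exp n := Real.add_one_le_exp _
  have h6 : (2 : ℝ) ≤ Real.exp n := by linarith
  have h7 : ℓ ≤ n := by
    rw [hℓ]
    exact (Real.log_le_sub_one_of_pos (by linarith)).trans (by linarith)
  have h8 : 8 * (n : ℝ) ≤ τ ^ 2 / 512 * m := by
    rw [div_le_iff₀ (by positivity)] at hℓτ
    have e1 := mul_le_mul_of_nonneg_left hm (by positivity : 0 ≤ τ ^ 2 / 512)
    have e2 := mul_le_mul_of_nonneg_left hℓτ (by linarith : (0 : ℝ) ≤ n)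
    linarith
  calc 2 * (4 ^ n * ((n : ℝ) + 1)) * Real.exp (-(τ ^ 2 / 512 * m))
      ≤ Real.exp n * (Real.exp (2 * n) * Real.exp n) * Real.exp (-(τ ^ 2 / 512 * m)) := by
        gcongr
    _ = Real.exp (4 * n - τ ^ 2 / 512 * m) := by
        rw [← Real.exp_add, ← Real.exp_add, ← Real.exp_add]; congr 1; ring
    _ ≤ _ := Real.exp_le_exp.2 (by linarith)

/-- The graph with `m` edges is far from pseudorandom. -/
def Irregular (κ τ τ₂ c γ : ℝ) (m : ℕ) (σ : ProcessSpace n) : Prop :=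
  ¬ PathUniform (gr (firstEdges σ m)) κ τ m ∨
  (¬ ∀ A B : Finset (Fin n), (pairs (gr (firstEdges σ m)) (A ×ˢ B) : ℝ) ≤
    (2 * (A.card * B.card) / (n : ℝ) ^ 2 + τ₂) * m) ∨
  ¬ ∀ B : Finset (Fin n), (B.card : ℝ) ≤ c * n →
    (pairs (gr (firstEdges σ m)) (B ×ˢ B) : ℝ) ≤ γ * (2 * m / n) * B.card

lemma pr_irregular_le {κ τ τ₂ c γ ℓ : ℝ} (hn : 1 < n) (hℓ : ℓ = Real.log n) (hN : 0 < numEdges n)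
    (hm : m ≤ numEdges n) (hτ : 0 < τ) (hτ1 : τ ≤ 1) (hκ : κ ≤ τ / 8)
    (hκτ : κ * Real.log (1024 / τ ^ 2) ≤ τ ^ 2 / 1024) (hτ₂ : 0 < τ₂) (hτ₂1 : τ₂ ≤ τ)
    (hc : 0 < c) (hc1 : c ≤ 1 / 2) (hγc : 37 ≤ γ * Real.log (1 / c))
    (hℓτ : 24576 / τ₂ ^ 2 ≤ ℓ) (hnτ : 4 ≤ τ₂ * (n - 1)) (hmn : n * ℓ / 6 ≤ m) :
    pr (fun σ : ProcessSpace n => Irregular κ τ τ₂ c γ m σ) ≤ 4 * Real.exp (-(4 * ℓ)) := by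
  have hn1 : (1 : ℝ) < n := by exact_mod_cast hn
  have hℓ0 : 0 ≤ ℓ := by rw [hℓ]; exact Real.log_nonneg hn1.le
  have hexp : Real.exp ℓ = n := by rw [hℓ, Real.exp_log (by linarith)]
  have h1 : pr (fun σ : ProcessSpace n => ¬ PathUniform (gr (firstEdges σ m)) κ τ m) ≤
      Real.exp (-(4 * ℓ)) := by
    refine (pr_not_pathUniform_le hn hN hm hτ hτ1 hκ hκτ ?_).trans
      (uniform_tail_le hn hℓ (le_trans ?_ hℓτ) hτ hmn)
    · exact hnτ.trans (mul_le_mul_of_nonneg_right hτ₂1 (by linarith))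
    · gcongr
  have h2 := (pr_not_uniform_le hn hN hm hτ₂ (hτ₂1.trans hτ1) hnτ)
  have h2' : 2 * 4 ^ n * Real.exp (-(τ₂ ^ 2 / 512 * m)) ≤ Real.exp (-(4 * ℓ)) := by
    refine le_trans ?_ (uniform_tail_le hn hℓ hℓτ hτ₂ hmn)
    rw [← mul_assoc]
    refine mul_le_mul_of_nonneg_right ?_ (Real.exp_pos _).le
    exact le_mul_of_one_le_right (by positivity) (by linarith)
  have h3 := pr_exists_lt_pairs_inside (γ := γ) (y := Real.exp (-(6 * ℓ))) hn hN hm hc hc1 (by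
    apply Real.exp_le_exp.2
    have e1 : ℓ / 3 ≤ 2 * m / n := by
      rw [le_div_iff₀ (by linarith)]; linarith
    have e2 : 2 * (m : ℝ) / n / 2 * (1 - γ * Real.log (1 / c)) ≤ 2 * m / n / 2 * (-36) :=
      mul_le_mul_of_nonneg_left (by linarith) (by positivity)
    linarith) (by
    rw [← hexp, ← Real.exp_add, Real.exp_le_one_iff]; linarith)
  have h3' : n * Real.exp (-(6 * ℓ)) ≤ Real.exp (-(4 * ℓ)) := by
    rw [← hexp, ← Real.exp_add]
    exact Real.exp_le_exp.2 (by linarith)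
  refine (pr_or_le _ _).trans ?_
  have h4 := pr_or_le (fun σ : ProcessSpace n => ¬ ∀ A B : Finset (Fin n),
    (pairs (gr (firstEdges σ m)) (A ×ˢ B) : ℝ) ≤
      (2 * (A.card * B.card) / (n : ℝ) ^ 2 + τ₂) * m) (fun σ : ProcessSpace n =>
    ¬ ∀ B : Finset (Fin n), (B.card : ℝ) ≤ c * n →
      (pairs (gr (firstEdges σ m)) (B ×ˢ B) : ℝ) ≤ γ * (2 * m / n) * B.card)
  linarith

lemma firstEdges_of_le (σ : ProcessSpace n) (hm : numEdges n ≤ m) :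
    firstEdges σ m = firstEdges σ (numEdges n) := by
  ext e
  simp only [mem_firstEdges]
  have := (σ.symm e).2
  exact ⟨fun _ => this, fun _ => lt_of_lt_of_le this hm⟩

end Estimates

section Conclusion
open scoped Classical
variable {n m₀ m₁ : ℕ}

lemma Resilient.anti {G : SimpleGraph V} {α α' : ℝ} {P : SimpleGraph V → Prop} (h : α ≤ α')
    (hG : Resilient G α' P) : Resilient G α P := fun H hH hdeg =>
  hG H hH fun v => (hdeg v).trans (mul_le_mul_of_nonneg_right h (Nat.cast_nonneg _))

/-- The process fails to be pseudorandom after time `m₀`. -/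
def Exceptional (η δ₀ κ τ τ₂ c γ ℓ : ℝ) (m₀ m₁ : ℕ) (σ : ProcessSpace n) : Prop :=
  (∃ m ∈ Finset.Icc m₀ (numEdges n), Irregular κ τ τ₂ c γ m σ) ∨
  (∃ m ∈ Finset.Icc m₁ (numEdges n), ∃ v,
    ((nb (gr (firstEdges σ m)) v).card : ℝ) ≤ (1 - η) * (2 * m / n)) ∨
  (∃ v, 4 * (2 * (m₁ : ℝ) / n) ≤ (nb (gr (firstEdges σ m₁)) v).card) ∨
  (Balanced ((1 - η) * (2 * m₁ / n)) ⌊4 * (2 * (m₁ : ℝ) / n)⌋₊ (firstEdges σ m₁) ∧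
    ¬ Sparse (gr (firstEdges σ m₁)) (tiny (gr (firstEdges σ m₀)) (δ₀ * ℓ)))

lemma pr_exceptional_le {ε C κ τ τ₂ c γ ℓ : ℝ} (hε : 0 < ε) (hε1 : ε ≤ 1 / 10)
    (hC : C = 5 / (ε / 8) ^ 2) (hn : 1 < n) (hℓ : ℓ = Real.log n) (hℓ1 : 1 ≤ ℓ)
    (hm : m₀ ≤ m₁) (hm₁ : m₁ ≤ numEdges n)
    (hm₀ : (1 + ε) / 6 * n * ℓ ≤ m₀) (hm₁C : C * n * ℓ ≤ m₁) (hd : 2 * (m₁ : ℝ) / n ≤ 3 * C * ℓ)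
    (hτ : 0 < τ) (hτ1 : τ ≤ 1) (hκ : κ ≤ τ / 8)
    (hκτ : κ * Real.log (1024 / τ ^ 2) ≤ τ ^ 2 / 1024) (hτ₂ : 0 < τ₂) (hτ₂1 : τ₂ ≤ τ)
    (hc : 0 < c) (hc1 : c ≤ 1 / 2) (hγc : 37 ≤ γ * Real.log (1 / c))
    (hℓτ : 24576 / τ₂ ^ 2 ≤ ℓ) (hnτ : 4 ≤ τ₂ * (n - 1)) :
    pr (fun σ : ProcessSpace n =>
      Exceptional (ε / 8) (ε / (24 * Real.log (8 / ε))) κ τ τ₂ c γ ℓ m₀ m₁ σ) ≤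
      4 * Real.exp (-(2 * ℓ)) + (Real.exp (-(2 * ℓ)) + (Real.exp (-ℓ) + sparseBound ε C ℓ)) := by
  have hn1 : (1 : ℝ) < n := by exact_mod_cast hn
  have hn2 : (2 : ℝ) ≤ n := by exact_mod_cast hn
  have hexp : Real.exp ℓ = n := by rw [hℓ, Real.exp_log (by linarith)]
  have hC1 : 1 ≤ C := by
    rw [hC, le_div_iff₀ (by positivity)]
    have := pow_le_pow_left₀ (by positivity) (by linarith : ε / 8 ≤ 1) 2
    linarith
  have hnℓ : 1 ≤ n * ℓ := one_le_mul_of_one_le_of_one_le hn1.le hℓ1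
  have hm₀n : n * ℓ / 6 ≤ (m₀ : ℝ) := by
    have := mul_nonneg hε.le (by linarith : (0 : ℝ) ≤ n * ℓ)
    linarith
  have hm₁0 : 0 < m₁ := by
    have : (0 : ℝ) < m₀ := by linarith
    have : 0 < m₀ := by exact_mod_cast this
    omega
  have hN : 0 < numEdges n := hm₁0.trans_le hm₁
  have hNn : (numEdges n : ℝ) + 1 ≤ Real.exp (2 * ℓ) := by
    have h1 := two_mul_numEdges n
    have h2 : Real.exp (2 * ℓ) = n * n := by rw [two_mul, Real.exp_add, hexp]
    rw [h2]
    nlinarith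
  have hcard : ∀ a, ((Finset.Icc a (numEdges n)).card : ℝ) ≤ Real.exp (2 * ℓ) := by
    intro a
    refine le_trans ?_ hNn
    rw [Nat.card_Icc]
    exact_mod_cast Nat.sub_le _ _
  have hexp2 : Real.exp (2 * ℓ) * Real.exp (-(4 * ℓ)) = Real.exp (-(2 * ℓ)) := by
    rw [← Real.exp_add]; congr 1; ring
  refine (pr_or_le _ _).trans (add_le_add ?_ ((pr_or_le _ _).trans (add_le_add ?_
    ((pr_or_le _ _).trans (add_le_add ?_ ?_)))))
  · refine (pr_exists_le _ _).trans ((Finset.sum_le_card_nsmul _ _ (4 * Real.exp (-(4 * ℓ)))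
      fun m hmem => ?_).trans ?_)
    · rw [Finset.mem_Icc] at hmem
      have : (m₀ : ℝ) ≤ m := by exact_mod_cast hmem.1
      exact pr_irregular_le hn hℓ hN hmem.2 hτ hτ1 hκ hκτ hτ₂ hτ₂1 hc hc1 hγc hℓτ hnτ
        (by linarith)
    · rw [nsmul_eq_mul]
      have := mul_le_mul_of_nonneg_right (hcard m₀) (Real.exp_pos (-(4 * ℓ))).le
      linarith
  · refine (pr_exists_le _ _).trans ((Finset.sum_le_card_nsmul _ _ (Real.exp (-(4 * ℓ)))
      fun m hmem => ?_).trans ?_)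
    · rw [Finset.mem_Icc] at hmem
      have hmm : (m₁ : ℝ) ≤ m := by exact_mod_cast hmem.1
      refine (pr_exists_nb_le hn hN hmem.2 (by positivity)).trans ?_
      have h1 : 2 * C * ℓ ≤ 2 * m / n := by
        rw [le_div_iff₀ (by linarith)]; linarith
      have h2 : (ε / 8) ^ 2 / 2 * (2 * C * ℓ) = 5 * ℓ := by
        rw [hC]; field_simp
      have h3 := mul_le_mul_of_nonneg_left h1 (by positivity : 0 ≤ (ε / 8) ^ 2 / 2)
      rw [← hexp, ← Real.exp_add]
      apply Real.exp_le_exp.2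
      rw [hexp]
      linarith
    · rw [nsmul_eq_mul]
      have := mul_le_mul_of_nonneg_right (hcard m₁) (Real.exp_pos (-(4 * ℓ))).le
      linarith
  · refine (pr_exists_le_nb hn hN hm₁).trans ?_
    have h1 : 2 * ℓ ≤ 2 * m₁ / n := by
      rw [le_div_iff₀ (by linarith)]
      have := mul_le_mul_of_nonneg_right hC1 (by linarith : (0 : ℝ) ≤ n * ℓ)
      linarith
    rw [← hexp, ← Real.exp_add]
    apply Real.exp_le_exp.2
    rw [hexp]
    linarith
  · exact pr_not_sparse_le hε hε1 hC1 hn hℓ hℓ1 hN hm hm₁0 hm₁ hm₀ hd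

lemma resilient_of_not_exceptional {ε C δ κ τ₂ c γ ℓ D₀ : ℝ} (hε : 0 < ε) (hε1 : ε ≤ 1 / 10)
    (hC : C = 5 / (ε / 8) ^ 2) (hδ : δ = ε / (24 * Real.log (8 / ε)) / (3 * C)) (hn : 1 < n)
    (hℓ1 : 1 ≤ ℓ) (hℓD : 3 * D₀ ≤ ℓ) (hm : m₀ ≤ m₁) (hm₁ : m₁ ≤ numEdges n)
    (hm₀ : (1 + ε) / 6 * n * ℓ ≤ m₀) (hd : 2 * (m₁ : ℝ) / n ≤ 3 * C * ℓ)
    (hτ₂1 : τ₂ ≤ ε / 100)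
    (key : ∀ (G : SimpleGraph (Fin n)) (T : Finset (Fin n)) (m d : ℝ), 0 < n → 2 * m = n * d →
      D₀ ≤ d →
      Sparse G T → (∀ a, a ∉ T → δ * d ≤ (nb G a).card) → (T.card : ℝ) ≤ ε / 100 * n →
      (pairs G Finset.univ : ℝ) = 2 * m →
      (∀ B : Finset (Fin n), (B.card : ℝ) ≤ c * n → (pairs G (B ×ˢ B) : ℝ) ≤ γ * d * B.card) →
      (∀ A B : Finset (Fin n), (pairs G (A ×ˢ B) : ℝ) ≤
        (2 * (A.card * B.card) / (n : ℝ) ^ 2 + τ₂) * m) →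
      PathUniform G κ (ε / 100) m → Resilient (twoCore G) (1 / 2 - ε) IsHam)
    {σ : ProcessSpace n}
    (hσ : ¬ Exceptional (ε / 8) (ε / (24 * Real.log (8 / ε))) κ (ε / 100) τ₂ c γ ℓ m₀ m₁ σ)
    {m : ℕ} (hm₀m : m₀ ≤ m) : Resilient (twoCore (processGraph σ m)) (1 / 2 - ε) IsHam := by
  wlog hmN : m ≤ numEdges n with ih
  · rw [processGraph_eq, firstEdges_of_le σ (by omega), ← processGraph_eq]
    exact ih hε hε1 hC hδ hn hℓ1 hℓD hm hm₁ hm₀ hd hτ₂1 key hσ (hm.trans hm₁) le_rfl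
  have hn1 : (1 : ℝ) < n := by exact_mod_cast hn
  have hnn : (n : ℝ) ≠ 0 := by linarith
  have hlog := one_le_log_div hε hε1
  set δ₀ := ε / (24 * Real.log (8 / ε)) with hδ₀
  have hC1 : 1 ≤ C := by
    rw [hC, le_div_iff₀ (by positivity)]
    have := pow_le_pow_left₀ (by positivity) (by linarith : ε / 8 ≤ 1) 2
    linarith
  have hδ₀0 : 0 < δ₀ := by positivity
  have hδ₀1 : δ₀ ≤ ε / 24 := by
    rw [hδ₀]
    exact div_le_div_of_nonneg_left hε.le (by norm_num) (by linarith)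
  have hδ0 : 0 ≤ δ := by rw [hδ]; positivity
  have hδ1 : δ ≤ 1 / 2 := by
    rw [hδ, div_le_iff₀ (by linarith)]; linarith
  simp only [Exceptional, not_or] at hσ
  obtain ⟨hreg, hdeg, hmax, hsp⟩ := hσ
  push Not at hreg hdeg hmax
  have hdl : ∀ m : ℕ, m₀ ≤ m → ℓ / 3 ≤ 2 * (m : ℝ) / n := by
    intro m h
    have h1 : (m₀ : ℝ) ≤ m := by exact_mod_cast h
    have h2 : 0 ≤ ε * (n * ℓ) := by positivity
    rw [le_div_iff₀ (by linarith)]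
    linarith
  have hirr := hreg m (Finset.mem_Icc.2 ⟨hm₀m, hmN⟩)
  have hirr₀ := hreg m₀ (Finset.mem_Icc.2 ⟨le_rfl, hm.trans hm₁⟩)
  simp only [Irregular, not_or, not_not] at hirr hirr₀
  have hpairs : ∀ m : ℕ, m ≤ numEdges n →
      (pairs (gr (firstEdges σ m)) Finset.univ : ℝ) = 2 * m := by
    intro m h
    rw [pairs_gr_univ, card_firstEdges σ h]; push_cast; rfl
  have hmd : ∀ m : ℕ, 2 * (m : ℝ) = n * (2 * m / n) := by
    intro m; field_simp
  have hsparse : Sparse (gr (firstEdges σ m₁)) (tiny (gr (firstEdges σ m₀)) (δ₀ * ℓ)) := by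
    by_contra h
    refine hsp ⟨fun v => ⟨(hdeg m₁ (Finset.mem_Icc.2 ⟨le_rfl, hm₁⟩) v).le, Nat.le_floor ?_⟩, h⟩
    exact (hmax v).le
  rw [processGraph_eq]
  have hkey := fun T => key (gr (firstEdges σ m)) T m (2 * m / n) (by omega) (hmd m)
    (by linarith [hdl m hm₀m])
  rcases le_total m m₁ with hle | hle
  · refine hkey (tiny (gr (firstEdges σ m₀)) (δ₀ * ℓ))
      (hsparse.mono (gr_mono (firstEdges_mono σ hle))) ?_ ?_ (hpairs m hmN) hirr.2.2 hirr.2.1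
      hirr.1
    · intro a ha
      simp only [tiny, Finset.mem_filter, Finset.mem_univ, true_and, not_lt] at ha
      have h1 : (nb (gr (firstEdges σ m₀)) a).card ≤ (nb (gr (firstEdges σ m)) a).card := by
        refine Finset.card_le_card fun u hu => ?_
        simp only [nb, Finset.mem_filter, Finset.mem_univ, true_and] at hu ⊢
        exact gr_mono (firstEdges_mono σ hm₀m) hu
      have h2 : ((nb (gr (firstEdges σ m₀)) a).card : ℝ) ≤ (nb (gr (firstEdges σ m)) a).card := by
        exact_mod_cast h1
      have h3 : 2 * (m : ℝ) / n ≤ 2 * m₁ / n := by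
        have : (m : ℝ) ≤ m₁ := by exact_mod_cast hle
        gcongr
      have h4 : δ * (2 * m / n) ≤ δ * (3 * C * ℓ) :=
        mul_le_mul_of_nonneg_left (h3.trans hd) hδ0
      have h5 : δ * (3 * C * ℓ) = δ₀ * ℓ := by
        rw [hδ]; field_simp
      linarith
    · have h1 := card_low_degree (G := gr (firstEdges σ m₀)) (n := n) (m := m₀)
        (d := 2 * m₀ / n) (τ := τ₂) (η := 1 / 2) (by simp) (by linarith) (hmd m₀)
        (by linarith [hdl m₀ le_rfl]) (hpairs m₀ (hm.trans hm₁)) hirr₀.2.1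
      have h2 : tiny (gr (firstEdges σ m₀)) (δ₀ * ℓ) ⊆ Finset.univ.filter fun a =>
          ((nb (gr (firstEdges σ m₀)) a).card : ℝ) < (1 - 1 / 2) * (2 * m₀ / n) := by
        intro a ha
        simp only [tiny, Finset.mem_filter, Finset.mem_univ, true_and] at ha ⊢
        have h3 : δ₀ * ℓ ≤ ℓ / 6 := by
          have := mul_le_mul_of_nonneg_right (by linarith : δ₀ ≤ 1 / 6)
            (by linarith : (0 : ℝ) ≤ ℓ)
          linarith
        linarith [hdl m₀ le_rfl]
      have h3 : ((tiny (gr (firstEdges σ m₀)) (δ₀ * ℓ)).card : ℝ) ≤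
          (Finset.univ.filter fun a => ((nb (gr (firstEdges σ m₀)) a).card : ℝ) <
            (1 - 1 / 2) * (2 * m₀ / n)).card := by
        exact_mod_cast Finset.card_le_card h2
      have h4 := mul_le_mul_of_nonneg_right hτ₂1 (by linarith : (0 : ℝ) ≤ n)
      linarith
  · refine hkey ∅ ⟨by simp, by simp, by simp⟩ ?_ ?_ (hpairs m hmN) hirr.2.2 hirr.2.1 hirr.1
    · intro a _
      refine le_trans ?_ (hdeg m (Finset.mem_Icc.2 ⟨hle, hmN⟩) a).le
      exact mul_le_mul_of_nonneg_right (by linarith) (by positivity)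
    · simp only [Finset.card_empty, Nat.cast_zero]
      positivity

lemma eventually_log_mul_le (K : ℝ) :
    ∀ᶠ n : ℕ in atTop, K * Real.log n ≤ n := by
  have h := (Real.isLittleO_log_id_atTop.comp_tendsto
    (tendsto_natCast_atTop_atTop (R := ℝ))).bound (by positivity : 0 < 1 / (|K| + 1))
  filter_upwards [h, eventually_ge_atTop 1] with n hn hn1
  have hn1 : (1 : ℝ) ≤ n := by exact_mod_cast hn1
  simp only [Function.comp, id, Real.norm_eq_abs] at hn
  rw [abs_of_nonneg (Real.log_nonneg hn1), abs_of_nonneg (by linarith : (0 : ℝ) ≤ n),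
    one_div_mul_eq_div, le_div_iff₀ (by positivity)] at hn
  have := mul_le_mul_of_nonneg_right (le_abs_self K) (Real.log_nonneg hn1)
  have := Real.log_nonneg hn1
  linarith

lemma tendsto_pr_not_resilient {ε : ℝ} (hε : 0 < ε) (hε1 : ε ≤ 1 / 10) :
    Tendsto (fun n : ℕ => pr (fun σ : ProcessSpace n => ¬ ∀ m : ℕ,
      (1 + ε) / 6 * n * Real.log n ≤ (m : ℝ) →
        Resilient (twoCore (processGraph σ m)) (1 / 2 - ε) IsHam)) atTop (nhds 0) := by
  have hlog := one_le_log_div hε hε1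
  obtain ⟨C, hC⟩ : ∃ C, C = 5 / (ε / 8) ^ 2 := ⟨_, rfl⟩
  have hC1 : 1 ≤ C := by
    rw [hC, le_div_iff₀ (by positivity)]
    have := pow_le_pow_left₀ (by positivity) (by linarith : ε / 8 ≤ 1) 2
    linarith
  obtain ⟨δ, hδ⟩ : ∃ δ, δ = ε / (24 * Real.log (8 / ε)) / (3 * C) := ⟨_, rfl⟩
  have hδ0 : 0 < δ := by rw [hδ]; positivity
  obtain ⟨τ, hτ⟩ : ∃ τ, τ = ε / 100 := ⟨_, rfl⟩
  have hτ0 : 0 < τ := by rw [hτ]; positivity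
  have hτ1 : τ ≤ 1 := by linarith
  have hlogτ : 0 < Real.log (1024 / τ ^ 2) := by
    apply Real.log_pos
    rw [lt_div_iff₀ (by positivity)]
    have := pow_le_pow_left₀ hτ0.le hτ1 2
    linarith
  obtain ⟨κ, hκ⟩ : ∃ κ, κ = min (τ / 8) (τ ^ 2 / 1024 / Real.log (1024 / τ ^ 2)) := ⟨_, rfl⟩
  have hκ0 : 0 < κ := by rw [hκ]; positivity
  have hκ1 : κ ≤ τ / 8 := by rw [hκ]; exact min_le_left _ _
  have hκ2 : κ * Real.log (1024 / τ ^ 2) ≤ τ ^ 2 / 1024 := by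
    rw [← le_div_iff₀ hlogτ, hκ]; exact min_le_right _ _
  obtain ⟨γ, hγ, hγ'⟩ := exists_constants hε hε1 hδ0 hκ0
  obtain ⟨c, hc⟩ : ∃ c, c = Real.exp (-(37 / γ + 1)) := ⟨_, rfl⟩
  have hc0 : 0 < c := by rw [hc]; positivity
  have hc1 : c ≤ 1 / 2 := by
    have h1 : Real.exp (-(37 / γ + 1)) ≤ Real.exp (-1) := by
      apply Real.exp_le_exp.2
      have : 0 < 37 / γ := by positivity
      linarith
    have h2 : Real.exp (-1) ≤ 1 / 2 := by
      rw [Real.exp_neg, one_div]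
      have := Real.add_one_le_exp (1 : ℝ)
      exact inv_anti₀ (by norm_num) (by linarith)
    rw [hc]; linarith
  have hγc : 37 ≤ γ * Real.log (1 / c) := by
    rw [one_div, Real.log_inv, hc, Real.log_exp]
    have : γ * (37 / γ) = 37 := by field_simp
    linarith
  obtain ⟨τ₂, hτ₂, hτ₂1, D₀, hD₀⟩ := hγ' c hc0
  have hlim : Tendsto (fun n : ℕ => Real.log n) atTop atTop :=
    Real.tendsto_log_atTop.comp tendsto_natCast_atTop_atTop
  have hexp0 : ∀ a : ℝ, 0 < a → Tendsto (fun ℓ : ℝ => Real.exp (-(a * ℓ))) atTop (nhds 0) := by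
    intro a ha
    exact Real.tendsto_exp_neg_atTop_nhds_zero.comp (tendsto_id.const_mul_atTop ha)
  have hbound : Tendsto (fun ℓ : ℝ => 4 * Real.exp (-(2 * ℓ)) + (Real.exp (-(2 * ℓ)) +
      (Real.exp (-ℓ) + sparseBound ε C ℓ))) atTop (nhds 0) := by
    have h := ((hexp0 2 (by norm_num)).const_mul 4).add ((hexp0 2 (by norm_num)).add
      (Real.tendsto_exp_neg_atTop_nhds_zero.add (tendsto_sparseBound hε C)))
    simp only [mul_zero, add_zero] at h
    exact h
  refine tendsto_of_tendsto_of_tendsto_of_le_of_le' tendsto_const_nhds (hbound.comp hlim)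
    (Eventually.of_forall fun n => pr_nonneg _) ?_
  filter_upwards [eventually_gt_atTop 1, hlim.eventually_ge_atTop 1,
    hlim.eventually_ge_atTop (3 * D₀), hlim.eventually_ge_atTop (24576 / τ₂ ^ 2),
    (tendsto_natCast_atTop_atTop (R := ℝ)).eventually_ge_atTop (4 / τ₂ + 1),
    eventually_log_mul_le (4 * (C + 1))] with n hn hℓ1 hℓD hℓτ hnτ hnC
  obtain ⟨ℓ, hℓ⟩ : ∃ ℓ, ℓ = Real.log n := ⟨_, rfl⟩
  simp only [Function.comp]
  rw [← hℓ] at hℓ1 hℓD hℓτ hnC ⊢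
  have hn1 : (1 : ℝ) < n := by exact_mod_cast hn
  have hn2 : (2 : ℝ) ≤ n := by exact_mod_cast hn
  have hnτ : 4 ≤ τ₂ * (n - 1) := by
    rw [← div_le_iff₀' hτ₂]; linarith
  have hnℓ : n ≤ n * ℓ := le_mul_of_one_le_right (by linarith) hℓ1
  have hCnℓ : n * ℓ ≤ C * (n * ℓ) := le_mul_of_one_le_left (by linarith) hC1
  set m₀ := ⌈(1 + ε) / 6 * n * ℓ⌉₊ with hm₀
  set m₁ := ⌈C * n * ℓ⌉₊ with hm₁
  have hm₀l : (1 + ε) / 6 * n * ℓ ≤ m₀ := Nat.le_ceil _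
  have hm₁l : C * n * ℓ ≤ m₁ := Nat.le_ceil _
  have hm₁u : (m₁ : ℝ) < C * n * ℓ + 1 := Nat.ceil_lt_add_one (by linarith)
  have hm : m₀ ≤ m₁ := by
    apply Nat.ceil_mono
    have := mul_le_mul_of_nonneg_right (by linarith : (1 + ε) / 6 ≤ 1)
      (by linarith : (0 : ℝ) ≤ n * ℓ)
    linarith
  have hm₁N : m₁ ≤ numEdges n := by
    have h1 := two_mul_numEdges n
    have h2 := mul_le_mul_of_nonneg_left hnC (by linarith : (0 : ℝ) ≤ n)
    have h3 : (n : ℝ) * 2 ≤ n * n := mul_le_mul_of_nonneg_left hn2 (by linarith)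
    have h4 : (m₁ : ℝ) ≤ numEdges n := by linarith
    exact_mod_cast h4
  have hd : 2 * (m₁ : ℝ) / n ≤ 3 * C * ℓ := by
    rw [div_le_iff₀ (by linarith)]
    linarith
  refine le_trans (pr_mono fun σ hσ => ?_) (pr_exceptional_le (κ := κ) (c := c) (γ := γ) hε hε1 hC
    hn hℓ hℓ1 hm hm₁N hm₀l hm₁l hd hτ0 hτ1 hκ1 hκ2 hτ₂ (by rw [hτ]; exact hτ₂1) hc0 hc1 hγc hℓτ
    hnτ)
  by_contra hex
  refine hσ fun m hmm => ?_
  rw [hτ] at hex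
  exact resilient_of_not_exceptional hε hε1 hC hδ hn hℓ1 hℓD hm hm₁N hm₀l hd hτ₂1
    (fun G T m d => hD₀ n G T m d) hex (Nat.ceil_le.2 hmm)

end Conclusion

theorem statement_2 (ε : ℝ) (hε : 0 < ε) :
    Tendsto (fun n : ℕ =>
      processMeasure n {σ : ProcessSpace n |
        ∀ m : ℕ, (1 + ε) / 6 * n * Real.log n ≤ (m : ℝ) →
          Resilient (twoCore (processGraph σ m)) (1 / 2 - ε) IsHam})
      atTop (nhds 1) := by
  obtain ⟨ε', h0, h1, h2⟩ : ∃ ε' : ℝ, 0 < ε' ∧ ε' ≤ ε ∧ ε' ≤ 1 / 10 :=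
    ⟨min ε (1 / 10), by positivity, min_le_left _ _, min_le_right _ _⟩
  have h := tendsto_pr_not_resilient h0 h2
  have hα : 1 / 2 - ε ≤ 1 / 2 - ε' := by linarith
  have hmono : ∀ n : ℕ, (1 + ε') / 6 * n * Real.log n ≤ (1 + ε) / 6 * n * Real.log n := by
    intro n
    have := mul_nonneg (Nat.cast_nonneg (α := ℝ) n) (Real.log_natCast_nonneg n)
    have := mul_le_mul_of_nonneg_right h1 this
    linarith
  have hbad : ∀ n : ℕ, pr (fun σ : ProcessSpace n => ¬ ∀ m : ℕ,
      (1 + ε) / 6 * n * Real.log n ≤ (m : ℝ) →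
        Resilient (twoCore (processGraph σ m)) (1 / 2 - ε) IsHam) ≤
      pr (fun σ : ProcessSpace n => ¬ ∀ m : ℕ,
      (1 + ε') / 6 * n * Real.log n ≤ (m : ℝ) →
        Resilient (twoCore (processGraph σ m)) (1 / 2 - ε') IsHam) := fun n =>
    pr_mono fun σ hσ hall => hσ fun m hm => (hall m ((hmono n).trans hm)).anti hα
  have h3 := ENNReal.tendsto_ofReal ((squeeze_zero (fun n => pr_nonneg _) hbad h).const_sub 1)
  rw [sub_zero, ENNReal.ofReal_one] at h3
  refine h3.congr fun n => ?_
  rw [processMeasure_eq]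
  exact congrArg ENNReal.ofReal (pr_eq_one_sub _).symm

end
end RGP
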